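/- Let s ≥ 2 and for each m ∈ ℕ let P_m be a dyadic digital (t_m, m, s)-net in base 2 with t_m ≤ (1/10)·log₂ m. Then for every w ∈ ℝ, 2^{-sm} ∑_{T ∈ Q^s(2^m)} vol{ Y ∈ [0,1)^s : D(P_m ⊕ T, Y)/M_{s,2}(P_m) < w } → Φ(w) as m → ∞; that is, with T uniform on Q^s(2^m) and Y uniform on [0,1)^s, the normalized discrepancy D(P_m ⊕ T, Y)/M_{s,2}(P_m) converges weakly to the standard Gaussian distribution. -/

import Mathlib

open MeasureTheory Filter

noncomputable section

attribute [local instance] Classical.propDecidable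

/-- The `a`-th binary digit (`a ≥ 1`) of the dyadic expansion of `x ∈ [0,1)`
(the finite expansion is used for dyadic rationals). -/
def bdigit (a : ℕ) (x : ℝ) : ℕ := (⌊x * 2 ^ a⌋).toNat % 2

/-- Digitwise addition modulo 2 of dyadic expansions: `x ⊕ y`. -/
def xorReal (x y : ℝ) : ℝ :=
  ∑' a : ℕ, (((bdigit (a + 1) x + bdigit (a + 1) y) % 2 : ℕ) : ℝ) / 2 ^ (a + 1)

/-- Coordinatewise digitwise addition `⊕` on vectors. -/
def xorVec {s : ℕ} (X Y : Fin s → ℝ) : Fin s → ℝ := fun i => xorReal (X i) (Y i)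

/-- Local discrepancy `D(P, Y)` of a finite point set `P` in `[0,1)^s`. -/
def Dloc {N s : ℕ} (P : Fin N → Fin s → ℝ) (Y : Fin s → ℝ) : ℝ :=
  (∑ n : Fin N, if ∀ i, 0 ≤ P n i ∧ P n i < Y i then (1 : ℝ) else 0) -
    (N : ℝ) * ∏ i, Y i

/-- `P` is a `(t,m,s)`-net in base 2: every elementary dyadic box of volume
`2^(t-m)` contains exactly `2^t` of the points. -/
def IsNet (t m s : ℕ) (P : Fin (2 ^ m) → Fin s → ℝ) : Prop :=
  ∀ d a : Fin s → ℕ, (∀ i, a i < 2 ^ d i) → (∑ i, d i) + t = m →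
    (Finset.univ.filter fun n => ∀ i,
        (a i : ℝ) / 2 ^ d i ≤ P n i ∧ P n i < ((a i : ℝ) + 1) / 2 ^ d i).card = 2 ^ t

/-- The digits `x_{n,i,j}` of the `n`-th point of the dyadic digital net with
generating matrices `C`. -/
def netDig (m s : ℕ) (C : Fin s → Matrix (Fin m) (Fin m) (ZMod 2)) (n : ℕ) :
    Fin s → Fin m → ZMod 2 :=
  fun i j => ∑ r : Fin m, C i j r * (if n.testBit r then 1 else 0)

/-- The `n`-th point of the dyadic digital net with generating matrices `C`. -/
def netPoint (m s : ℕ) (C : Fin s → Matrix (Fin m) (Fin m) (ZMod 2)) (n : ℕ) :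
    Fin s → ℝ :=
  fun i => ∑ j : Fin m, ((netDig m s C n i j).val : ℝ) / 2 ^ ((j : ℕ) + 1)

/-- The unit cube `[0,1]^s`. -/
def cube (s : ℕ) : Set (Fin s → ℝ) := Set.univ.pi fun _ => Set.Icc (0 : ℝ) 1

/-- The point of `Q^s(2^m)` with coordinates `T i / 2^m`. -/
def Qpt {s : ℕ} (m : ℕ) (T : Fin s → Fin (2 ^ m)) : Fin s → ℝ :=
  fun i => ((T i : ℕ) : ℝ) / 2 ^ m

/-- `M_{s,p}(P) = (2^{-sm} ∑_{T ∈ Q^s(2^m)} ∫_{[0,1]^s} |D(P ⊕ T, Y)|^p dY)^{1/p}`. -/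
def Msp (s m : ℕ) (p : ℝ) {N : ℕ} (P : Fin N → Fin s → ℝ) : ℝ :=
  ((2 : ℝ) ^ (-(s * m : ℤ)) * ∑ T : Fin s → Fin (2 ^ m),
      ∫ Y in cube s, |Dloc (fun n => xorVec (P n) (Qpt m T)) Y| ^ p) ^ (1 / p)

/-- The standard normal distribution function `Φ`. -/
def PhiCDF (w : ℝ) : ℝ :=
  (Real.sqrt (2 * Real.pi))⁻¹ * ∫ u in Set.Iio w, Real.exp (-u ^ 2 / 2)

/-- `χ_p`, the `p`-th absolute moment of the standard Gaussian. -/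
def chiMoment (p : ℝ) : ℝ :=
  (Real.sqrt (2 * Real.pi))⁻¹ * ∫ u : ℝ, |u| ^ p * Real.exp (-u ^ 2 / 2)

/-- Digits `y_{n,i,j}` of the points of the dyadic digital sequence generated by
the `ℕ × ℕ` matrices `C` over `F_2`. -/
def seqDig (s : ℕ) (C : Fin s → ℕ → ℕ → ZMod 2) (n : ℕ) : Fin s → ℕ → ZMod 2 :=
  fun i j => ∑ r ∈ Finset.range (n + 1), C i j r * (if n.testBit r then 1 else 0)

/-- The `n`-th point of the dyadic digital sequence generated by `C`. -/
def seqPoint (s : ℕ) (C : Fin s → ℕ → ℕ → ZMod 2) (n : ℕ) : Fin s → ℝ :=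
  fun i => ∑' j : ℕ, ((seqDig s C n i j).val : ℝ) / 2 ^ (j + 1)

/-- The digital sequence generated by `C` is a dyadic digital `(T,s)`-sequence:
for all `m ≥ 1` and `k ≥ 0` the block `X_{k2^m}, …, X_{k2^m+2^m-1}` is a
`(T(m),m,s)`-net in base 2. -/
def IsTSeq (s : ℕ) (Tf : ℕ → ℕ) (C : Fin s → ℕ → ℕ → ZMod 2) : Prop :=
  (∀ m, Tf m ≤ m) ∧
  ∀ m, 1 ≤ m → ∀ k : ℕ,
    IsNet (Tf m) m s fun n : Fin (2 ^ m) => seqPoint s C (k * 2 ^ m + (n : ℕ))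

/-- The dual net `P_m^⊥` of the digital net generated by `C`. -/
def dualNet (m s : ℕ) (C : Fin s → Matrix (Fin m) (Fin m) (ZMod 2)) :
    Finset (Fin s → Fin m → ZMod 2) :=
  Finset.univ.filter fun mm => ∀ n : Fin (2 ^ m),
    (∑ i, ∑ j, mm i j * netDig m s C (n : ℕ) i j) = 0

/-- `ρ(b)`: the position of the last nonzero digit (`ρ(0) = 0`). -/
def rhoF {m : ℕ} (b : Fin m → ZMod 2) : ℕ :=
  (Finset.univ.filter fun j => b j ≠ 0).sup fun j => (j : ℕ) + 1

/-- The 1-indexed component `𝔪_{i,a}` (as `0` or `1`), with the convention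
`𝔪_{i,0} = 0`. -/
def mAt {m : ℕ} (b : Fin m → ZMod 2) (a : ℕ) : ℕ :=
  if h : 1 ≤ a ∧ a ≤ m then (b ⟨a - 1, by omega⟩).val else 0

/-- The 1-indexed digit of a digit array, with the convention that digit `0`
and digits beyond `m` are `0`. -/
def dAt {m : ℕ} (y : Fin m → Fin 2) (a : ℕ) : ℕ :=
  if h : 1 ≤ a ∧ a ≤ m then (y ⟨a - 1, by omega⟩).val else 0

/-- `κ(A)`: the number of nonzero entries of `A`. -/
def kapF {s : ℕ} (A : Fin s → ℕ) : ℕ := (Finset.univ.filter fun i => A i ≠ 0).card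

/-- `a₀(A) = a₁ + ⋯ + a_s`. -/
def a0F {s : ℕ} (A : Fin s → ℕ) : ℕ := ∑ i, A i

/-- `Λ_A(T ⊕ Y^{(m)})` as a function of the digit arrays `t`, `y` of `T`, `Y`:
`∑_{𝔪 ∈ P^{⊥,*}, ρ(𝔪_i) ≤ a_i} e(∑_i (∑_j 𝔪_{i,j}(t_{i,j}+y_{i,j}) + 𝔪_{i,a_i}))`,
where `e(n) = exp(πin) = (-1)^n`. -/
def LamF (m s : ℕ) (C : Fin s → Matrix (Fin m) (Fin m) (ZMod 2)) (A : Fin s → ℕ)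
    (t y : Fin s → Fin m → Fin 2) : ℝ :=
  ∑ mm ∈ (dualNet m s C).filter fun mm => mm ≠ 0 ∧ ∀ i, rhoF (mm i) ≤ A i,
    (-1 : ℝ) ^
      (∑ i, ((∑ j, (mm i j).val * ((t i j : ℕ) + (y i j : ℕ))) + mAt (mm i) (A i)))

/-- The Rademacher function `r_A(Y)` as a function of the digit array of `Y`. -/
def rademF {m s : ℕ} (A : Fin s → ℕ) (y : Fin s → Fin m → Fin 2) : ℝ :=
  ∏ i, (-1 : ℝ) ^ dAt (y i) (A i)

/-- `Ψ_A = (-1)^{κ(A)} 2^{m-s-a₀(A)} r_A(Y) Λ_A(T ⊕ Y^{(m)})` at digit level. -/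
def PsiF (m s : ℕ) (C : Fin s → Matrix (Fin m) (Fin m) (ZMod 2)) (A : Fin s → ℕ)
    (t y : Fin s → Fin m → Fin 2) : ℝ :=
  (-1 : ℝ) ^ kapF A * (2 : ℝ) ^ ((m : ℤ) - (s : ℤ) - (a0F A : ℤ)) *
    rademF A y * LamF m s C A t y

/-- `V₀ = 10 log₂ m`. -/
def V0 (m : ℕ) : ℝ := 10 * Real.logb 2 m

/-- `I_{m,s,k} = {A ∈ I_m^s : max_i a_i = k, a₀(A) ∈ (m - t_m, m + V₀)}`. -/
def IndexSet (m s tm k : ℕ) : Finset (Fin s → ℕ) :=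
  (Fintype.piFinset fun _ : Fin s => Finset.range (m + 1)).filter fun A =>
    Finset.univ.sup A = k ∧ ((m : ℝ) - tm < a0F A ∧ (a0F A : ℝ) < m + V0 m)

/-- `I_{m,s,m+1} = {A ∈ I_m^s : a₀(A) ≥ m + V₀}`. -/
def IndexTail (m s : ℕ) : Finset (Fin s → ℕ) :=
  (Fintype.piFinset fun _ : Fin s => Finset.range (m + 1)).filter fun A =>
    (m : ℝ) + V0 m ≤ (a0F A : ℝ)

/-- `𝔇_k(T,Y) = ∑_{A ∈ I_{m,s,k}} Ψ_A` at digit level. -/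
def DDk (m s tm : ℕ) (C : Fin s → Matrix (Fin m) (Fin m) (ZMod 2)) (k : ℕ)
    (t y : Fin s → Fin m → Fin 2) : ℝ :=
  ∑ A ∈ IndexSet m s tm k, PsiF m s C A t y

/-- `R(T,Y) = ∑_{A ∈ I_{m,s,m+1}} Ψ_A` at digit level. -/
def Rtail (m s : ℕ) (C : Fin s → Matrix (Fin m) (Fin m) (ZMod 2))
    (t y : Fin s → Fin m → Fin 2) : ℝ :=
  ∑ A ∈ IndexTail m s, PsiF m s C A t y

/-- `E^{(m)}_{Y,T}(f)`: the average of `f` over all digit arrays. -/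
def Em (m s : ℕ) (f : (Fin s → Fin m → Fin 2) → (Fin s → Fin m → Fin 2) → ℝ) : ℝ :=
  (2 : ℝ) ^ (-(2 * s * m : ℤ)) *
    ∑ t : Fin s → Fin m → Fin 2, ∑ y : Fin s → Fin m → Fin 2, f t y

/-- Keep the first `k` digits of `t`, replace the remaining ones by those of `t'`. -/
def mergeDig {m s : ℕ} (k : ℕ) (t t' : Fin s → Fin m → Fin 2) :
    Fin s → Fin m → Fin 2 :=
  fun i j => if (j : ℕ) < k then t i j else t' i j

/-- The conditional expectation `E^{(m)}_{Y,T}(f | F_k)` with respect to the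
σ-field `F_k` generated by the dyadic cubes of side `2^{-k}`: the average of `f`
over the digits of index `> k`, as a function of the digit arrays `t`, `y`. -/
def EmCond (m s k : ℕ)
    (f : (Fin s → Fin m → Fin 2) → (Fin s → Fin m → Fin 2) → ℝ)
    (t y : Fin s → Fin m → Fin 2) : ℝ :=
  (2 : ℝ) ^ (-(2 * s * m : ℤ)) *
    ∑ t' : Fin s → Fin m → Fin 2, ∑ y' : Fin s → Fin m → Fin 2,
      f (mergeDig k t t') (mergeDig k y y')

/-- `Θ_{A₁,A₂,k} = E^{(m)}_{Y,T}(Ψ_{A₁}Ψ_{A₂} | F_{k-1}) - E^{(m)}_{Y,T}(Ψ_{A₁}Ψ_{A₂})`. -/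
def ThetaF (m s : ℕ) (C : Fin s → Matrix (Fin m) (Fin m) (ZMod 2))
    (A1 A2 : Fin s → ℕ) (k : ℕ) (t y : Fin s → Fin m → Fin 2) : ℝ :=
  EmCond m s (k - 1) (fun t' y' => PsiF m s C A1 t' y' * PsiF m s C A2 t' y') t y -
    Em m s fun t' y' => PsiF m s C A1 t' y' * PsiF m s C A2 t' y'

/-- `Υ_{d₁,d₂,d₃,J,k}` for a partition `J = (J₁,J₂,J₃)` of `{1,…,s}` and
`k = (k₁,k₂)`. -/
def Ups (m s tm : ℕ) (C : Fin s → Matrix (Fin m) (Fin m) (ZMod 2))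
    (J1 J2 J3 : Finset (Fin s)) (k1 k2 : ℕ) : ℝ :=
  ∑ A1 ∈ IndexSet m s tm k1, ∑ A2 ∈ IndexSet m s tm k1,
    ∑ A3 ∈ IndexSet m s tm k2, ∑ A4 ∈ IndexSet m s tm k2,
      (Em m s fun t y => ThetaF m s C A1 A2 k1 t y * ThetaF m s C A3 A4 k2 t y) *
        (if (Finset.univ.filter fun i => A1 i = A2 i) = J1 ∧
            (Finset.univ.filter fun i => A1 i < A2 i) = J2 ∧
            (Finset.univ.filter fun i => A2 i < A1 i) = J3 ∧
            (Finset.univ.filter fun i => A3 i = A4 i) = J1 ∧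
            (Finset.univ.filter fun i => A3 i < A4 i) = J2 ∧
            (Finset.univ.filter fun i => A4 i < A3 i) = J3 then (1 : ℝ) else 0)

/-- The array of the first `m` dyadic digits of the coordinates of `Y`. -/
def digitsOf (m s : ℕ) (Y : Fin s → ℝ) : Fin s → Fin m → Fin 2 :=
  fun i j => ⟨bdigit ((j : ℕ) + 1) (Y i), by unfold bdigit; omega⟩

/-- Truncation `y^{(m)}` to the first `m` dyadic digits. -/
def truncR (m : ℕ) (y : ℝ) : ℝ :=
  ∑ j ∈ Finset.range m, (bdigit (j + 1) y : ℝ) / 2 ^ (j + 1)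

/-- The elementary interval `Π_a` (`Π_0 = [0,1)`, `Π_a = [2^{-a}, 2^{1-a})`). -/
def PiBox (a : ℕ) : Set ℝ :=
  if a = 0 then Set.Ico 0 1 else Set.Ico ((2 : ℝ) ^ (-(a : ℤ))) ((2 : ℝ) ^ (1 - (a : ℤ)))

/-- `λ_A(Y) = 1_{Π_A}(Y) - vol(Π_A)`. -/
def lamA {s : ℕ} (A : Fin s → ℕ) (Y : Fin s → ℝ) : ℝ :=
  (if ∀ i, Y i ∈ PiBox (A i) then (1 : ℝ) else 0) - (2 : ℝ) ^ (-(a0F A : ℤ))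

/-- The micro-local discrepancy `λ_A(P_m^{(m)} ⊕ T ⊕ Y^{(m)})`. -/
def lamNet (m s : ℕ) (C : Fin s → Matrix (Fin m) (Fin m) (ZMod 2))
    (T Y : Fin s → ℝ) (A : Fin s → ℕ) : ℝ :=
  ∑ n : Fin (2 ^ m),
    lamA A fun i =>
      xorReal (xorReal (truncR m (netPoint m s C (n : ℕ) i)) (T i)) (truncR m (Y i))

/-- The Rademacher function `r_A(Y)` for a real point `Y`. -/
def rademReal {s : ℕ} (A : Fin s → ℕ) (Y : Fin s → ℝ) : ℝ :=
  ∏ i, if A i = 0 then (1 : ℝ) else 1 - 2 * (bdigit (A i) (Y i) : ℝ)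

/-- The truncated discrepancy
`D^{(m)}(P_m ⊕ T, Y) = 2^{-s} ∑_{A ∈ I_m^s} (-1)^{κ(A)} λ_A(P_m^{(m)} ⊕ T ⊕ Y^{(m)}) r_A(Y)`. -/
def Dm (m s : ℕ) (C : Fin s → Matrix (Fin m) (Fin m) (ZMod 2)) (T Y : Fin s → ℝ) : ℝ :=
  (2 : ℝ) ^ (-(s : ℤ)) *
    ∑ A ∈ Fintype.piFinset fun _ : Fin s => Finset.range (m + 1),
      (-1 : ℝ) ^ kapF A * lamNet m s C T Y A * rademReal A Y

/-- `𝔼_{Y,T,m}(f) = 2^{-sm} ∑_{T ∈ Q^s(2^m)} ∫_{[0,1]^s} f(T,Y) dY`. -/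
def EE (m s : ℕ) (f : (Fin s → ℝ) → (Fin s → ℝ) → ℝ) : ℝ :=
  (2 : ℝ) ^ (-(s * m : ℤ)) * ∑ T : Fin s → Fin (2 ^ m), ∫ Y in cube s, f (Qpt m T) Y

open scoped BigOperators

namespace NetCLT

/-- The dyadic rational with the given binary digits. -/
def bval {m : ℕ} (x : Fin m → ZMod 2) : ℝ := ∑ j : Fin m, ((x j).val : ℝ) / 2 ^ ((j : ℕ) + 1)

/-- The sign character of `ZMod 2`. -/
def sgn (b : ZMod 2) : ℝ := if b = 0 then 1 else -1

/-- Membership of a digit string in the dyadic interval `Π_a`. -/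
def InPi {m : ℕ} (a : ℕ) (z : Fin m → ZMod 2) : Prop :=
  ∀ j : Fin m, (j : ℕ) + 1 ≤ a → z j = if (j : ℕ) + 1 = a then 1 else 0

theorem zmod_two_cases (b : ZMod 2) : b = 0 ∨ b = 1 := by
  fin_cases b
  · exact Or.inl rfl
  · exact Or.inr rfl

theorem zmod_two_val_one : (1 : ZMod 2).val = 1 := rfl

theorem zmod_two_one_add_one : (1 : ZMod 2) + 1 = 0 := rfl

theorem sgn_zero : sgn 0 = 1 := by simp [sgn]

theorem sgn_one : sgn 1 = -1 := by simp [sgn]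

theorem sgn_eq (b : ZMod 2) : sgn b = 1 - 2 * (b.val : ℝ) := by
  rcases zmod_two_cases b with rfl | rfl
  · simp [sgn_zero]
  · rw [sgn_one, zmod_two_val_one]; norm_num

theorem sgn_mul_self (b : ZMod 2) : sgn b * sgn b = 1 := by
  rcases zmod_two_cases b with rfl | rfl <;> simp [sgn_zero, sgn_one]

theorem bval_succ {m : ℕ} (x : Fin (m + 1) → ZMod 2) :
    bval x = ((x 0).val + bval fun j => x j.succ) / 2 := by
  unfold bval
  rw [Fin.sum_univ_succ, add_div, Finset.sum_div]
  congr 1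
  · simp
  · refine Finset.sum_congr rfl fun j _ => ?_
    rw [Fin.val_succ]
    field_simp
    ring

theorem bval_castSucc {m : ℕ} (x : Fin (m + 1) → ZMod 2) :
    bval x = (bval fun j : Fin m => x j.castSucc) + (x (Fin.last m)).val / 2 ^ (m + 1) := by
  unfold bval
  rw [Fin.sum_univ_castSucc]
  simp

theorem bval_nonneg {m : ℕ} (x : Fin m → ZMod 2) : 0 ≤ bval x :=
  Finset.sum_nonneg fun _ _ => by positivity

theorem bval_le {m : ℕ} (x : Fin m → ZMod 2) : bval x ≤ 1 - 1 / 2 ^ m := by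
  induction m with
  | zero => simp [bval]
  | succ m ih =>
    rw [bval_succ]
    have h := ih fun j => x j.succ
    have h2 : ((x 0).val : ℝ) ≤ 1 := by
      exact_mod_cast Nat.lt_succ_iff.mp (ZMod.val_lt (x 0))
    rw [pow_succ, div_mul_eq_div_div]
    linarith

theorem bval_lt_one {m : ℕ} (x : Fin m → ZMod 2) : bval x < 1 := by
  have := bval_le x
  have h : (0 : ℝ) < 1 / 2 ^ m := by positivity
  linarith

theorem exists_bval_eq_div {m : ℕ} (x : Fin m → ZMod 2) : ∃ K : ℕ, bval x = K / 2 ^ m := by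
  induction m with
  | zero => exact ⟨0, by simp [bval]⟩
  | succ m ih =>
    obtain ⟨K, hK⟩ := ih fun j => x j.castSucc
    refine ⟨2 * K + (x (Fin.last m)).val, ?_⟩
    rw [bval_castSucc, hK]
    push_cast
    field_simp
    ring

theorem bdigit_bval {m : ℕ} (a : ℕ) (x : Fin m → ZMod 2) :
    bdigit (a + 1) (bval x) = if h : a < m then (x ⟨a, h⟩).val else 0 := by
  induction m generalizing a with
  | zero => simp [bval, bdigit]
  | succ m ih =>
    have h0 := bval_nonneg fun j => x j.succ
    have h1 := bval_lt_one fun j => x j.succ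
    have hv : (x 0).val < 2 := ZMod.val_lt (x 0)
    cases a with
    | zero =>
      have : ⌊bval x * 2 ^ (0 + 1)⌋ = ((x 0).val : ℤ) := by
        rw [bval_succ, Int.floor_eq_iff]
        push_cast
        constructor <;> linarith
      simp only [bdigit, this, Int.toNat_natCast, Nat.zero_lt_succ, dite_true]
      exact Nat.mod_eq_of_lt hv
    | succ b =>
      have h := ih b fun j => x j.succ
      have e : bval x * 2 ^ (b + 1 + 1) =
          ((2 * ((x 0).val * 2 ^ b) : ℤ) : ℝ) + (bval fun j => x j.succ) * 2 ^ (b + 1) := by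
        rw [bval_succ]; push_cast; ring
      have hn : 0 ≤ ⌊(bval fun j => x j.succ) * 2 ^ (b + 1)⌋ := Int.floor_nonneg.2 (by positivity)
      have : bdigit (b + 1 + 1) (bval x) = bdigit (b + 1) (bval fun j => x j.succ) := by
        unfold bdigit
        rw [e, Int.floor_intCast_add]
        have hk : (0 : ℤ) ≤ (x 0).val * 2 ^ b := by positivity
        generalize ((x 0).val * 2 ^ b : ℤ) = k at *
        generalize ⌊(bval fun j => x j.succ) * 2 ^ (b + 1)⌋ = l at *
        omega
      rw [this, h]
      by_cases hb : b < m
      · simp [hb]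
      · simp [hb]

theorem xorReal_bval {m : ℕ} (x u : Fin m → ZMod 2) :
    xorReal (bval x) (bval u) = bval (x + u) := by
  unfold xorReal
  rw [tsum_eq_sum (s := Finset.range m), ← Fin.sum_univ_eq_sum_range
    (fun a => (((bdigit (a + 1) (bval x) + bdigit (a + 1) (bval u)) % 2 : ℕ) : ℝ) / 2 ^ (a + 1)) m]
  · unfold bval
    refine Finset.sum_congr rfl fun j _ => ?_
    congr 2
    have hx := bdigit_bval j x
    have hu := bdigit_bval j u
    unfold bval at hx hu
    rw [hx, hu, dif_pos j.2, dif_pos j.2, Pi.add_apply, ZMod.val_add]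
  · intro b hb
    have : ¬ b < m := by simpa using hb
    rw [bdigit_bval, bdigit_bval, dif_neg this, dif_neg this]
    simp

theorem bval_injective (m : ℕ) : Function.Injective (bval : (Fin m → ZMod 2) → ℝ) := by
  intro x y h
  funext j
  have hx := bdigit_bval j x
  have hy := bdigit_bval j y
  rw [dif_pos j.2] at hx hy
  rw [h] at hx
  exact ZMod.val_injective 2 (hx.symm.trans hy)

theorem floor_mul_two_pow_succ {x : ℝ} (hx : 0 ≤ x) (k : ℕ) :
    ⌊x * 2 ^ (k + 1)⌋ = 2 * ⌊x * 2 ^ k⌋ + bdigit (k + 1) x := by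
  have h1 := Int.floor_le (x * 2 ^ k)
  have h2 := Int.lt_floor_add_one (x * 2 ^ k)
  have hn : 0 ≤ ⌊x * 2 ^ (k + 1)⌋ := Int.floor_nonneg.2 (by positivity)
  have h3 : 2 * ⌊x * 2 ^ k⌋ ≤ ⌊x * 2 ^ (k + 1)⌋ := by
    rw [Int.le_floor]; push_cast; rw [pow_succ]; linarith
  have h4 : ⌊x * 2 ^ (k + 1)⌋ < 2 * ⌊x * 2 ^ k⌋ + 2 := by
    rw [Int.floor_lt]; push_cast; rw [pow_succ]; linarith
  unfold bdigit
  omega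

/-- The first `m` binary digits of a real number. -/
def digB (m : ℕ) (x : ℝ) : Fin m → ZMod 2 := fun j => (bdigit ((j : ℕ) + 1) x : ZMod 2)

theorem val_natCast_bdigit (a : ℕ) (x : ℝ) : ((bdigit a x : ℕ) : ZMod 2).val = bdigit a x := by
  rw [ZMod.val_natCast]
  exact Nat.mod_mod _ _

theorem bval_digB (m : ℕ) {x : ℝ} (h0 : 0 ≤ x) (h1 : x < 1) :
    bval (digB m x) = ⌊x * 2 ^ m⌋ / 2 ^ m := by
  induction m with
  | zero => simp [bval, Int.floor_eq_zero_iff.2 (show x ∈ Set.Ico (0 : ℝ) 1 from ⟨h0, h1⟩)]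
  | succ m ih =>
    have : (fun j : Fin m => digB (m + 1) x j.castSucc) = digB m x := rfl
    rw [bval_castSucc, this, ih, floor_mul_two_pow_succ h0]
    simp only [digB, val_natCast_bdigit, Fin.val_last]
    push_cast
    field_simp
    ring

theorem bval_digB_le (m : ℕ) {x : ℝ} (h0 : 0 ≤ x) (h1 : x < 1) : bval (digB m x) ≤ x := by
  rw [bval_digB m h0 h1, div_le_iff₀ (by positivity)]
  exact Int.floor_le _

theorem lt_bval_digB_add (m : ℕ) {x : ℝ} (h0 : 0 ≤ x) (h1 : x < 1) :
    x < bval (digB m x) + 1 / 2 ^ m := by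
  rw [bval_digB m h0 h1, ← add_div, lt_div_iff₀ (by positivity)]
  exact Int.lt_floor_add_one _

theorem bval_eq_or_lt {m : ℕ} (x y : Fin m → ZMod 2) :
    x = y ∨ bval x + 1 / 2 ^ m ≤ bval y ∨ bval y + 1 / 2 ^ m ≤ bval x := by
  obtain ⟨K, hK⟩ := exists_bval_eq_div x
  obtain ⟨L, hL⟩ := exists_bval_eq_div y
  rcases lt_trichotomy K L with h | h | h
  · right; left
    rw [hK, hL, ← add_div]
    gcongr
    exact_mod_cast h
  · left
    exact bval_injective m (by rw [hK, hL, h])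
  · right; right
    rw [hK, hL, ← add_div]
    gcongr
    exact_mod_cast h

theorem digB_eq_iff (m : ℕ) {x : ℝ} (h0 : 0 ≤ x) (h1 : x < 1) (y : Fin m → ZMod 2) :
    digB m x = y ↔ bval y ≤ x ∧ x < bval y + 1 / 2 ^ m := by
  constructor
  · rintro rfl
    exact ⟨bval_digB_le m h0 h1, lt_bval_digB_add m h0 h1⟩
  · rintro ⟨h2, h3⟩
    have h4 := bval_digB_le m h0 h1
    have h5 := lt_bval_digB_add m h0 h1
    rcases bval_eq_or_lt (digB m x) y with h | h | h
    · exact h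
    · linarith
    · linarith

theorem floor_eq_floor_iff_bdigit {x y : ℝ} (hx : 0 ≤ x) (hx1 : x < 1) (hy : 0 ≤ y) (hy1 : y < 1)
    (k : ℕ) : ⌊x * 2 ^ k⌋ = ⌊y * 2 ^ k⌋ ↔ ∀ j < k, bdigit (j + 1) x = bdigit (j + 1) y := by
  induction k with
  | zero =>
    simp [Int.floor_eq_zero_iff.2 (show x ∈ Set.Ico (0 : ℝ) 1 from ⟨hx, hx1⟩),
      Int.floor_eq_zero_iff.2 (show y ∈ Set.Ico (0 : ℝ) 1 from ⟨hy, hy1⟩)]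
  | succ k ih =>
    rw [floor_mul_two_pow_succ hx, floor_mul_two_pow_succ hy]
    have h1 : bdigit (k + 1) x < 2 := Nat.mod_lt _ (by norm_num)
    have h2 : bdigit (k + 1) y < 2 := Nat.mod_lt _ (by norm_num)
    constructor
    · intro h j hj
      rcases Nat.lt_succ_iff_lt_or_eq.1 hj with hj | rfl
      · exact ih.1 (by omega) j hj
      · omega
    · intro h
      rw [ih.2 fun j hj => h j (by omega), h k (by omega)]

theorem inPi_zero {m : ℕ} (z : Fin m → ZMod 2) : InPi 0 z := fun j hj => by omega

theorem inPi_succ_iff {m : ℕ} (a : ℕ) (z : Fin (m + 1) → ZMod 2) :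
    InPi (a + 1 + 1) z ↔ z 0 = 0 ∧ InPi (a + 1) fun j => z j.succ := by
  unfold InPi
  rw [Fin.forall_fin_succ]
  simp

theorem inPi_one_iff {m : ℕ} (z : Fin (m + 1) → ZMod 2) : InPi 1 z ↔ z 0 = 1 := by
  unfold InPi
  rw [Fin.forall_fin_succ]
  simp

theorem lt_indicator_expansion {m : ℕ} (x y : Fin m → ZMod 2) :
    (if bval x < bval y then (1 : ℝ) else 0) + (if x = y then 1 / 2 else 0) =
      (1 - ∑ a : Fin m, sgn (y a) * if InPi ((a : ℕ) + 1) (x + y) then 1 else 0) / 2 := by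
  induction m with
  | zero =>
    have : x = y := Subsingleton.elim _ _
    simp [this]
  | succ m ih =>
    have h := ih (fun j => x j.succ) fun j => y j.succ
    have hx0 := bval_nonneg fun j => x j.succ
    have hx1 := bval_lt_one fun j => x j.succ
    have hy0 := bval_nonneg fun j => y j.succ
    have hy1 := bval_lt_one fun j => y j.succ
    rw [Fin.sum_univ_succ]
    simp only [Fin.val_zero, Fin.val_succ, zero_add, inPi_succ_iff, inPi_one_iff, bval_succ x,
      bval_succ y, Pi.add_apply]
    have heq : x = y ↔ x 0 = y 0 ∧ (fun j : Fin m => x j.succ) = fun j : Fin m => y j.succ := by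
      constructor
      · rintro rfl; exact ⟨rfl, rfl⟩
      · rintro ⟨h0, h1⟩
        funext j
        refine Fin.cases h0 (fun i => congrFun h1 i) j
    simp only [heq]
    rcases zmod_two_cases (x 0) with h0 | h0 <;> rcases zmod_two_cases (y 0) with h1 | h1 <;>
      simp only [h0, h1]
    · simp only [add_zero, zero_ne_one, if_false, mul_zero, zero_add, true_and]
      refine Eq.trans ?_ h
      congr 2
      apply propext
      constructor <;> intro h <;> simp at h ⊢ <;> linarith
    · simp only [zero_add, one_ne_zero, if_true, false_and, if_false, mul_zero,
        Finset.sum_const_zero, sgn_one, zero_ne_one]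
      rw [if_pos]
      · norm_num
      · simp [zmod_two_val_one]; linarith
    · simp only [add_zero, one_ne_zero, if_true, false_and, if_false, mul_zero,
        Finset.sum_const_zero, sgn_zero]
      rw [if_neg]
      · norm_num
      · simp [zmod_two_val_one]; linarith
    · simp only [zmod_two_one_add_one, zero_ne_one, if_false, mul_zero, zero_add, true_and]
      refine Eq.trans ?_ h
      congr 2
      apply propext
      constructor <;> intro h <;> linarith

theorem bval_midpoint {m : ℕ} (y : Fin m → ZMod 2) :
    bval y + 1 / 2 ^ (m + 1) = (1 - ∑ a : Fin m, sgn (y a) * (1 / 2 ^ ((a : ℕ) + 1))) / 2 := by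
  induction m with
  | zero => simp [bval]
  | succ m ih =>
    have h := ih fun j => y j.succ
    rw [Fin.sum_univ_succ, bval_succ, sgn_eq]
    have e : ∑ i : Fin m, sgn (y i.succ) * (1 / 2 ^ ((i.succ : ℕ) + 1)) =
        (∑ i : Fin m, sgn (y i.succ) * (1 / 2 ^ ((i : ℕ) + 1))) / 2 := by
      rw [Finset.sum_div]
      refine Finset.sum_congr rfl fun i _ => ?_
      rw [Fin.val_succ, pow_succ]
      field_simp
    rw [e, pow_succ, Fin.val_zero]
    rw [div_mul_eq_div_div]
    linarith

end NetCLT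

namespace NetCLT

/-- The one-dimensional Rademacher function of index `a` (equal to `1` for `a = 0`). -/
def rad {m : ℕ} (a : ℕ) (y : Fin m → ZMod 2) : ℝ :=
  ∏ j : Fin m, if (j : ℕ) + 1 = a then sgn (y j) else 1

/-- The multivariate Rademacher function of index `A`. -/
def radA {s m : ℕ} (A : Fin s → ℕ) (y : Fin s → Fin m → ZMod 2) : ℝ := ∏ i, rad (A i) (y i)

/-- The four indices coincide in pairs. -/
def Paired (a b c d : ℕ) : Prop := (a = b ∧ c = d) ∨ (a = c ∧ b = d) ∨ (a = d ∧ b = c)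

theorem expect_prod_pi {K ι κ : Type*} [Field K] [CharZero K] [Fintype ι] [DecidableEq ι]
    [Fintype κ] (f : ι → κ → K) :
    Finset.expect Finset.univ (fun y : ι → κ => ∏ i, f i (y i)) =
      ∏ i, Finset.expect Finset.univ (f i) := by
  simp only [Fintype.expect_eq_sum_div_card, Finset.prod_div_distrib, Finset.prod_univ_sum,
    Fintype.piFinset_univ, Finset.prod_const, Finset.card_univ, Fintype.card_fun, Nat.cast_pow]

theorem expect_zmod_two {K : Type*} [Field K] [CharZero K] (f : ZMod 2 → K) :
    Finset.expect Finset.univ f = (f 0 + f 1) / 2 := by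
  rw [Fintype.expect_eq_sum_div_card]
  have : ∑ i, f i = f 0 + f 1 := Fin.sum_univ_two f
  rw [this, ZMod.card]
  norm_num

theorem rad_zero {m : ℕ} (y : Fin m → ZMod 2) : rad 0 y = 1 := by simp [rad]

theorem rad_succ {m : ℕ} (j : Fin m) (y : Fin m → ZMod 2) : rad ((j : ℕ) + 1) y = sgn (y j) := by
  unfold rad
  rw [Finset.prod_eq_single j]
  · simp
  · intro b _ hb
    rw [if_neg]
    intro h
    exact hb (Fin.ext (by omega))
  · simp

theorem rad_mul_self {m : ℕ} (a : ℕ) (y : Fin m → ZMod 2) : rad a y * rad a y = 1 := by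
  unfold rad
  rw [← Finset.prod_mul_distrib]
  refine Finset.prod_eq_one fun j _ => ?_
  split_ifs
  · exact sgn_mul_self _
  · norm_num

theorem radA_mul_self {s m : ℕ} (A : Fin s → ℕ) (y : Fin s → Fin m → ZMod 2) :
    radA A y * radA A y = 1 := by
  unfold radA
  rw [← Finset.prod_mul_distrib]
  exact Finset.prod_eq_one fun j _ => rad_mul_self _ _

theorem abs_radA {s m : ℕ} (A : Fin s → ℕ) (y : Fin s → Fin m → ZMod 2) : |radA A y| = 1 := by
  have h := radA_mul_self A y
  rcases mul_self_eq_one_iff.1 h with h | h <;> simp [h]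

theorem expect_rad_four {m : ℕ} {a b c d : ℕ} (ha : a ≤ m) (hb : b ≤ m) (hc : c ≤ m) (hd : d ≤ m)
    (h : ¬ Paired a b c d) :
    (𝔼 y : Fin m → ZMod 2, rad a y * rad b y * rad c y * rad d y) = 0 := by
  have key : ∃ v, 1 ≤ v ∧ v ≤ m ∧ ((if v = a then 1 else 0) + (if v = b then 1 else 0) +
      (if v = c then 1 else 0) + (if v = d then 1 else 0)) % 2 = 1 := by
    by_contra hcon
    push Not at hcon
    have h1 := hcon a
    have h2 := hcon b
    have h3 := hcon c
    have h4 := hcon d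
    unfold Paired at h
    grind
  obtain ⟨v, h1, h2, h3⟩ := key
  unfold rad
  simp only [← Finset.prod_mul_distrib]
  rw [expect_prod_pi (fun (j : Fin m) (b' : ZMod 2) =>
    (if (j : ℕ) + 1 = a then sgn b' else 1) * (if (j : ℕ) + 1 = b then sgn b' else 1) *
    (if (j : ℕ) + 1 = c then sgn b' else 1) * (if (j : ℕ) + 1 = d then sgn b' else 1))]
  refine Finset.prod_eq_zero (Finset.mem_univ (⟨v - 1, by omega⟩ : Fin m)) ?_
  rw [expect_zmod_two]
  have : v - 1 + 1 = v := by omega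
  simp only [this, sgn_zero, sgn_one]
  split_ifs at h3 ⊢ <;> simp_all

theorem expect_radA_four {s m : ℕ} {A B C D : Fin s → ℕ} (hA : ∀ i, A i ≤ m) (hB : ∀ i, B i ≤ m)
    (hC : ∀ i, C i ≤ m) (hD : ∀ i, D i ≤ m) (h : ¬ ∀ i, Paired (A i) (B i) (C i) (D i)) :
    (𝔼 y : Fin s → Fin m → ZMod 2, radA A y * radA B y * radA C y * radA D y) = 0 := by
  unfold radA
  simp only [← Finset.prod_mul_distrib]
  rw [expect_prod_pi (fun (i : Fin s) (y : Fin m → ZMod 2) =>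
    rad (A i) y * rad (B i) y * rad (C i) y * rad (D i) y)]
  push Not at h
  obtain ⟨i, hi⟩ := h
  exact Finset.prod_eq_zero (Finset.mem_univ i) (expect_rad_four (hA i) (hB i) (hC i) (hD i) hi)

theorem expect_radA_two {s m : ℕ} {A B : Fin s → ℕ} (hA : ∀ i, A i ≤ m) (hB : ∀ i, B i ≤ m)
    (h : A ≠ B) : (𝔼 y : Fin s → Fin m → ZMod 2, radA A y * radA B y) = 0 := by
  have h4 := expect_radA_four (C := 0) (D := 0) hA hB (fun i => Nat.zero_le m)
    (fun i => Nat.zero_le m) (by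
      intro hp
      refine h (funext fun i => ?_)
      have := hp i
      unfold Paired at this
      simp at this
      omega)
  have h0 : ∀ y : Fin s → Fin m → ZMod 2, radA 0 y = 1 := fun y => by simp [radA, rad_zero]
  simpa [h0] using h4

theorem abs_expect_radA_four_le {s m : ℕ} (A B C D : Fin s → ℕ) :
    |𝔼 y : Fin s → Fin m → ZMod 2, radA A y * radA B y * radA C y * radA D y| ≤ 1 := by
  refine (Finset.abs_expect_le _ _).trans (Finset.expect_le Finset.univ_nonempty fun y _ => ?_)
  simp [abs_mul, abs_radA]

theorem expect_sq_sum_radA {s m : ℕ} (S : Finset (Fin s → ℕ)) (hS : ∀ A ∈ S, ∀ i, A i ≤ m)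
    (c : (Fin s → ℕ) → ℝ) :
    (𝔼 y : Fin s → Fin m → ZMod 2, (∑ A ∈ S, c A * radA A y) ^ 2) = ∑ A ∈ S, c A ^ 2 := by
  simp only [sq, Finset.sum_mul_sum]
  rw [Finset.expect_sum_comm]
  refine Finset.sum_congr rfl fun A hA => ?_
  rw [Finset.expect_sum_comm, Finset.sum_eq_single_of_mem A hA]
  · have : ∀ y : Fin s → Fin m → ZMod 2, c A * radA A y * (c A * radA A y) = c A * c A := fun y => by
      rw [mul_mul_mul_comm, radA_mul_self, mul_one]
    simp [this]
  · intro B hB hne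
    have : ∀ y : Fin s → Fin m → ZMod 2,
        c A * radA A y * (c B * radA B y) = c A * c B * (radA A y * radA B y) := fun y => by ring
    simp only [this]
    rw [← Finset.mul_expect, expect_radA_two (hS A hA) (hS B hB) hne.symm, mul_zero]

/-- The coefficient of the `j`-th sign of the first coordinate in a Rademacher chaos. -/
def chaosCoef {r m : ℕ} (S : Finset (Fin (r + 1) → ℕ)) (c : (Fin (r + 1) → ℕ) → ℝ) (j : Fin m)
    (v : Fin r → Fin m → ZMod 2) : ℝ :=
  ∑ A ∈ S, if A 0 = (j : ℕ) + 1 then c A * radA (Fin.tail A) v else 0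

theorem sum_radA_cons {r m : ℕ} (S : Finset (Fin (r + 1) → ℕ))
    (hS : ∀ A ∈ S, 1 ≤ A 0 ∧ ∀ i, A i ≤ m) (c : (Fin (r + 1) → ℕ) → ℝ)
    (u : Fin m → ZMod 2) (v : Fin r → Fin m → ZMod 2) :
    ∑ A ∈ S, c A * radA A (Fin.cons u v : Fin (r + 1) → Fin m → ZMod 2) =
      ∑ j, sgn (u j) * chaosCoef S c j v := by
  unfold chaosCoef
  simp only [Finset.mul_sum]
  rw [Finset.sum_comm]
  refine Finset.sum_congr rfl fun A hA => ?_
  obtain ⟨h1, h2⟩ := hS A hA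
  have h3 := h2 0
  rw [Finset.sum_eq_single (⟨A 0 - 1, by omega⟩ : Fin m)]
  · have e : A 0 = A 0 - 1 + 1 := by omega
    rw [if_pos e]
    have hr : rad (A 0) u = sgn (u ⟨A 0 - 1, by omega⟩) := by
      conv_lhs => rw [e]
      exact rad_succ ⟨A 0 - 1, by omega⟩ u
    unfold radA
    rw [Fin.prod_univ_succ]
    simp only [Fin.cons_zero, Fin.cons_succ, Fin.tail, hr]
    ring
  · intro j _ hj
    rw [if_neg, mul_zero]
    intro h
    exact hj (Fin.ext (by simp; omega))
  · simp

theorem expect_cons {K : Type*} [AddCommMonoid K] [Module ℚ≥0 K] {r : ℕ} {κ : Type*} [Fintype κ]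
    (f : (Fin (r + 1) → κ) → K) :
    Finset.expect Finset.univ f = 𝔼 v : Fin r → κ, 𝔼 u : κ, f (Fin.cons u v) := by
  rw [Finset.expect_comm, ← Finset.expect_product', Finset.univ_product_univ]
  exact (Fintype.expect_equiv (Fin.consEquiv fun _ => κ) _ _ fun p => rfl).symm

theorem expect_cexp_sum_sgn {m : ℕ} (θ : ℝ) (d : Fin m → ℝ) :
    (𝔼 u : Fin m → ZMod 2, Complex.exp ((θ * ∑ j, sgn (u j) * d j : ℝ) * Complex.I)) =
      ((∏ j, Real.cos (θ * d j) : ℝ) : ℂ) := by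
  have : ∀ u : Fin m → ZMod 2, Complex.exp ((θ * ∑ j, sgn (u j) * d j : ℝ) * Complex.I) =
      ∏ j, Complex.exp ((sgn (u j) * (θ * d j) : ℝ) * Complex.I) := fun u => by
    rw [← Complex.exp_sum, ← Finset.sum_mul, ← Complex.ofReal_sum, Finset.mul_sum]
    congr 3
    exact Finset.sum_congr rfl fun j _ => by ring
  simp only [this]
  rw [expect_prod_pi fun (j : Fin m) (b : ZMod 2) =>
    Complex.exp ((sgn b * (θ * d j) : ℝ) * Complex.I)]
  push_cast
  refine Finset.prod_congr rfl fun j _ => ?_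
  rw [expect_zmod_two, sgn_zero, sgn_one, Complex.cos]
  push_cast
  congr 2
  · simp
  · simp

theorem abs_cos_sub_exp_le (x : ℝ) : |Real.cos x - Real.exp (-x ^ 2 / 2)| ≤ 2 * x ^ 4 := by
  by_cases hx : |x| ≤ 1
  · have h1 := Real.cos_bound hx
    have hx2 : x ^ 2 ≤ 1 := (sq_le_one_iff_abs_le_one x).2 hx
    have h2 : |Real.exp (-x ^ 2 / 2) - 1 - (-x ^ 2 / 2)| ≤ (-x ^ 2 / 2) ^ 2 :=
      Real.abs_exp_sub_one_sub_id_le (by rw [abs_le]; constructor <;> nlinarith [sq_nonneg x])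
    have h3 : |x| ^ 4 = x ^ 4 := by rw [show (4 : ℕ) = 2 * 2 from rfl, pow_mul, pow_mul, sq_abs]
    rw [h3, abs_le] at h1
    rw [abs_le] at h2 ⊢
    have h4 : 0 ≤ x ^ 4 := by positivity
    have h5 : (-x ^ 2 / 2) ^ 2 = x ^ 4 / 4 := by ring
    rw [h5] at h2
    constructor <;> linarith [h1.1, h1.2, h2.1, h2.2]
  · push Not at hx
    have h1 : 1 ≤ x ^ 4 := by
      have : 1 ≤ x ^ 2 := (one_le_sq_iff_one_le_abs x).2 hx.le
      nlinarith
    have h2 := Real.abs_cos_le_one x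
    have h3 : Real.exp (-x ^ 2 / 2) ≤ 1 := Real.exp_le_one_iff.2 (by nlinarith [sq_nonneg x])
    have h4 := Real.exp_pos (-x ^ 2 / 2)
    rw [abs_le] at h2 ⊢
    constructor <;> linarith [h2.1, h2.2]

theorem abs_prod_sub_prod_le {ι : Type*} (s : Finset ι) (f g : ι → ℝ) (hf : ∀ i, |f i| ≤ 1)
    (hg : ∀ i, |g i| ≤ 1) : |∏ i ∈ s, f i - ∏ i ∈ s, g i| ≤ ∑ i ∈ s, |f i - g i| := by
  induction s using Finset.induction_on with
  | empty => simp
  | insert a s ha ih =>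
    rw [Finset.prod_insert ha, Finset.prod_insert ha, Finset.sum_insert ha]
    have e : f a * ∏ i ∈ s, f i - g a * ∏ i ∈ s, g i =
        (f a - g a) * ∏ i ∈ s, f i + g a * (∏ i ∈ s, f i - ∏ i ∈ s, g i) := by ring
    have h1 : |∏ i ∈ s, f i| ≤ 1 := by
      rw [Finset.abs_prod]
      exact Finset.prod_le_one (fun i _ => abs_nonneg _) fun i _ => hf i
    rw [e]
    refine (abs_add_le _ _).trans ?_
    rw [abs_mul, abs_mul]
    have h2 := abs_nonneg (f a - g a)
    have h3 := abs_nonneg (∏ i ∈ s, f i - ∏ i ∈ s, g i)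
    have h4 := hg a
    nlinarith

theorem abs_exp_neg_sub_exp_neg_le {a b : ℝ} (ha : 0 ≤ a) (hb : 0 ≤ b) :
    |Real.exp (-a) - Real.exp (-b)| ≤ |a - b| := by
  wlog h : a ≤ b generalizing a b
  · rw [abs_sub_comm, abs_sub_comm a]
    exact this hb ha (le_of_not_ge h)
  have h1 := Real.add_one_le_exp (a - b)
  have h2 : Real.exp (-b) = Real.exp (-a) * Real.exp (a - b) := by rw [← Real.exp_add]; ring_nf
  have h3 : Real.exp (-a) ≤ 1 := Real.exp_le_one_iff.2 (by linarith)
  have h4 := Real.exp_pos (-a)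
  have h5 : Real.exp (a - b) ≤ 1 := Real.exp_le_one_iff.2 (by linarith)
  rw [abs_of_nonneg, abs_of_nonpos (by linarith : a - b ≤ 0), h2]
  · nlinarith
  · rw [h2]; nlinarith

theorem abs_prod_cos_sub_le {m : ℕ} (θ : ℝ) (d : Fin m → ℝ) :
    |∏ j, Real.cos (θ * d j) - Real.exp (-θ ^ 2 / 2)| ≤
      2 * θ ^ 4 * ∑ j, d j ^ 4 + θ ^ 2 / 2 * |∑ j, d j ^ 2 - 1| := by
  have h1 : |∏ j, Real.cos (θ * d j) - ∏ j, Real.exp (-(θ * d j) ^ 2 / 2)| ≤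
      2 * θ ^ 4 * ∑ j, d j ^ 4 := by
    refine (abs_prod_sub_prod_le _ _ _ (fun j => Real.abs_cos_le_one _) fun j => ?_).trans ?_
    · rw [abs_of_pos (Real.exp_pos _)]
      exact Real.exp_le_one_iff.2 (by nlinarith [sq_nonneg (θ * d j)])
    · rw [Finset.mul_sum]
      refine Finset.sum_le_sum fun j _ => (abs_cos_sub_exp_le _).trans (le_of_eq (by ring))
  have h2 : |∏ j, Real.exp (-(θ * d j) ^ 2 / 2) - Real.exp (-θ ^ 2 / 2)| ≤
      θ ^ 2 / 2 * |∑ j, d j ^ 2 - 1| := by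
    have e1 : ∏ j, Real.exp (-(θ * d j) ^ 2 / 2) = Real.exp (-(θ ^ 2 / 2 * ∑ j, d j ^ 2)) := by
      rw [← Real.exp_sum, Finset.mul_sum, ← Finset.sum_neg_distrib]
      congr 1
      exact Finset.sum_congr rfl fun j _ => by ring
    rw [e1, show -θ ^ 2 / 2 = -(θ ^ 2 / 2 * 1) by ring]
    refine (abs_exp_neg_sub_exp_neg_le (by positivity) (by positivity)).trans (le_of_eq ?_)
    rw [← mul_sub, abs_mul, abs_of_nonneg (by positivity : 0 ≤ θ ^ 2 / 2)]
  calc _ ≤ _ := abs_sub_le _ (∏ j, Real.exp (-(θ * d j) ^ 2 / 2)) _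
    _ ≤ _ := add_le_add h1 h2

theorem norm_expect_le {ι : Type*} [Fintype ι] (f : ι → ℂ) : ‖𝔼 i, f i‖ ≤ 𝔼 i, ‖f i‖ := by
  rw [Fintype.expect_eq_sum_div_card, Fintype.expect_eq_sum_div_card, norm_div,
    Complex.norm_natCast]
  gcongr
  exact norm_sum_le _ _

theorem norm_expect_cexp_chaos_sub_le {r m : ℕ} (S : Finset (Fin (r + 1) → ℕ))
    (hS : ∀ A ∈ S, 1 ≤ A 0 ∧ ∀ i, A i ≤ m) (c : (Fin (r + 1) → ℕ) → ℝ) (θ : ℝ) :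
    ‖(𝔼 y : Fin (r + 1) → Fin m → ZMod 2,
        Complex.exp ((θ * ∑ A ∈ S, c A * radA A y : ℝ) * Complex.I)) -
        (Real.exp (-θ ^ 2 / 2) : ℝ)‖ ≤
      2 * θ ^ 4 * (𝔼 v : Fin r → Fin m → ZMod 2, ∑ j, chaosCoef S c j v ^ 4) +
        θ ^ 2 / 2 * 𝔼 v : Fin r → Fin m → ZMod 2, |∑ j, chaosCoef S c j v ^ 2 - 1| := by
  rw [expect_cons]
  simp only [sum_radA_cons S hS, expect_cexp_sum_sgn]
  rw [← Fintype.expect_const (ι := Fin r → Fin m → ZMod 2) ((Real.exp (-θ ^ 2 / 2) : ℝ) : ℂ),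
    ← Finset.expect_sub_distrib, Finset.mul_expect, Finset.mul_expect,
    ← Finset.expect_add_distrib]
  refine (norm_expect_le _).trans (Finset.expect_le_expect fun v _ => ?_)
  rw [← Complex.ofReal_sub, Complex.norm_real]
  exact abs_prod_cos_sub_le θ _

end NetCLT

namespace NetCLT

theorem eq_of_sum_eq {ι : Type*} [Fintype ι] {f g : ι → ℕ} (i : ι) (h : ∀ j, j ≠ i → f j = g j)
    (hs : ∑ j, f j = ∑ j, g j) : f = g := by
  have h1 := Finset.add_sum_erase Finset.univ f (Finset.mem_univ i)
  have h2 := Finset.add_sum_erase Finset.univ g (Finset.mem_univ i)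
  have h3 : ∑ j ∈ Finset.univ.erase i, f j = ∑ j ∈ Finset.univ.erase i, g j :=
    Finset.sum_congr rfl fun j hj => h j (Finset.ne_of_mem_erase hj)
  funext j
  by_cases hj : j = i
  · subst hj; omega
  · exact h j hj

theorem card_box_one {r : ℕ} (i : Fin (r + 1)) (M w : ℕ) :
    (Fintype.piFinset fun j : Fin (r + 1) =>
      if j = i then Finset.range w else Finset.range M).card = M ^ r * w := by
  rw [Fintype.card_piFinset, ← Finset.mul_prod_erase Finset.univ _ (Finset.mem_univ i), if_pos rfl,
    Finset.card_range, mul_comm]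
  congr 1
  rw [Finset.prod_congr rfl (g := fun _ => M), Finset.prod_const,
    Finset.card_erase_of_mem (Finset.mem_univ _), Finset.card_univ, Fintype.card_fin,
    Nat.add_sub_cancel]
  intro j hj
  rw [if_neg (Finset.ne_of_mem_erase hj), Finset.card_range]

theorem card_box_two {r : ℕ} {i : Fin (r + 1)} (hi : i ≠ 0) (M v w : ℕ) :
    (Fintype.piFinset fun j : Fin (r + 1) =>
      if j = i then Finset.range w else if j = 0 then Finset.range v else Finset.range M).card =
        M ^ (r - 1) * (v * w) := by
  have h0 : (0 : Fin (r + 1)) ∈ Finset.univ.erase i :=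
    Finset.mem_erase.2 ⟨hi.symm, Finset.mem_univ _⟩
  rw [Fintype.card_piFinset, ← Finset.mul_prod_erase Finset.univ _ (Finset.mem_univ i), if_pos rfl,
    Finset.card_range, ← Finset.mul_prod_erase _ _ h0, if_neg hi.symm, if_pos rfl,
    Finset.card_range, Finset.prod_congr rfl (g := fun _ => M), Finset.prod_const,
    Finset.card_erase_of_mem h0, Finset.card_erase_of_mem (Finset.mem_univ _), Finset.card_univ,
    Fintype.card_fin, Nat.add_sub_cancel]
  · ring
  intro j hj
  rw [if_neg (Finset.ne_of_mem_erase (Finset.mem_of_mem_erase hj)),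
    if_neg (Finset.ne_of_mem_erase hj), Finset.card_range]

/-- The elements of `S` have entries at most `m` and sums in a window of length `w`. -/
def InWindow {r : ℕ} (S : Finset (Fin (r + 1) → ℕ)) (m t w : ℕ) : Prop :=
  ∀ A ∈ S, (∀ i, A i ≤ m) ∧ m ≤ ∑ i, A i + t ∧ ∑ i, A i + t < m + w

/-- The position of the sum of `A` in its window. -/
def height {r : ℕ} (m t : ℕ) (A : Fin (r + 1) → ℕ) : ℕ := ∑ i, A i + t - m

section Counting

variable {r m t w : ℕ} {S : Finset (Fin (r + 1) → ℕ)}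

theorem height_lt (hS : InWindow S m t w) {A : Fin (r + 1) → ℕ} (hA : A ∈ S) : height m t A < w := by
  have := hS A hA
  unfold height
  omega

theorem sum_eq_of_height (hS : InWindow S m t w) {A B : Fin (r + 1) → ℕ} (hA : A ∈ S) (hB : B ∈ S)
    (h : height m t A = height m t B) : ∑ i, A i = ∑ i, B i := by
  have h1 := hS A hA
  have h2 := hS B hB
  unfold height at h
  omega

theorem card_filter_zero_le (hS : InWindow S m t w) {i : Fin (r + 1)} (hi : i ≠ 0)
    (h0 : ∀ A ∈ S, A 0 = 0) : S.card ≤ (m + 1) ^ (r - 1) * w := by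
  have hc := card_box_two hi (m + 1) 1 w
  rw [one_mul] at hc
  rw [← hc]
  refine Finset.card_le_card_of_injOn (fun A j => if j = i then height m t A else A j) ?_ ?_
  · intro A hA
    refine Finset.mem_coe.2 (Fintype.mem_piFinset.2 fun j => ?_)
    have := height_lt hS hA
    have h1 := (hS A hA).1 j
    have h2 := h0 A hA
    dsimp only
    split_ifs with h3 h4
    · simpa using this
    · simp [h4, h2]
    · simp; omega
  · intro A hA B hB hAB
    refine eq_of_sum_eq i (fun j hj => ?_) (sum_eq_of_height hS hA hB ?_)
    · simpa [hj] using congrFun hAB j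
    · simpa using congrFun hAB i

theorem card_pairs_le (hS : InWindow S m t w) {i : Fin (r + 1)} (hi : i ≠ 0) :
    ((S ×ˢ S).filter fun p => p.1 0 = p.2 0).card ≤
      ((m + 1) ^ r * w) * ((m + 1) ^ (r - 1) * w) := by
  have hc := card_box_two hi (m + 1) 1 w
  rw [one_mul] at hc
  rw [← hc, ← card_box_one i (m + 1) w, ← Finset.card_product]
  refine Finset.card_le_card_of_injOn (fun p => (fun j => if j = i then height m t p.1 else p.1 j,
    fun j => if j = i then height m t p.2 else if j = 0 then 0 else p.2 j)) ?_ ?_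
  · rintro ⟨A, B⟩ hp
    simp only [Finset.coe_filter, Set.mem_ofPred_eq, Finset.mem_product] at hp
    obtain ⟨⟨hA, hB⟩, h0⟩ := hp
    have hhA := height_lt hS hA
    have hhB := height_lt hS hB
    refine Finset.mem_coe.2 (Finset.mem_product.2 ⟨Fintype.mem_piFinset.2 fun j => ?_,
      Fintype.mem_piFinset.2 fun j => ?_⟩)
    · have h1 := (hS A hA).1 j
      dsimp only
      split_ifs <;> simp <;> omega
    · have h1 := (hS B hB).1 j
      dsimp only
      split_ifs <;> simp <;> omega
  · rintro ⟨A, B⟩ hp ⟨A', B'⟩ hp' h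
    simp only [Finset.coe_filter, Set.mem_ofPred_eq, Finset.mem_product] at hp hp'
    obtain ⟨⟨hA, hB⟩, h0⟩ := hp
    obtain ⟨⟨hA', hB'⟩, h0'⟩ := hp'
    simp only [Prod.mk.injEq] at h ⊢
    have e1 : A = A' := by
      refine eq_of_sum_eq i (fun j hj => ?_) (sum_eq_of_height hS hA hA' ?_)
      · simpa [hj] using congrFun h.1 j
      · simpa using congrFun h.1 i
    refine ⟨e1, eq_of_sum_eq i (fun j hj => ?_) (sum_eq_of_height hS hB hB' ?_)⟩
    · by_cases hj0 : j = 0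
      · rw [hj0, ← h0, ← h0', e1]
      · simpa [hj, hj0] using congrFun h.2 j
    · simpa using congrFun h.2 i

theorem card_overlap_le (hS : InWindow S m t w) :
    ((S ×ˢ S).filter fun p => m < ∑ i, min (p.1 i) (p.2 i) + t).card ≤
      ((m + 1) ^ r * w) * (w ^ (r + 1) * w ^ (r + 1)) := by
  have hc : (Fintype.piFinset fun _ : Fin (r + 1) => Finset.range w).card = w ^ (r + 1) := by
    rw [Fintype.card_piFinset]
    simp
  rw [← hc, ← card_box_one 0 (m + 1) w, ← Finset.card_product, ← Finset.card_product]
  refine Finset.card_le_card_of_injOn (fun p => (fun j => if j = 0 then height m t p.1 else p.1 j,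
    fun j => p.1 j - min (p.1 j) (p.2 j), fun j => p.2 j - min (p.1 j) (p.2 j))) ?_ ?_
  · rintro ⟨A, B⟩ hp
    simp only [Finset.coe_filter, Set.mem_ofPred_eq, Finset.mem_product] at hp
    obtain ⟨⟨hA, hB⟩, h0⟩ := hp
    have hhA := height_lt hS hA
    have hle : ∀ C ∈ S, (∀ l, min (A l) (B l) ≤ C l) → ∀ j, C j - min (A j) (B j) < w := by
      intro C hC hmin j
      have h1 : C j - min (A j) (B j) ≤ ∑ l, (C l - min (A l) (B l)) :=
        Finset.single_le_sum (f := fun l => C l - min (A l) (B l)) (fun _ _ => Nat.zero_le _)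
          (Finset.mem_univ j)
      have h2 : ∑ l, (C l - min (A l) (B l)) + ∑ l, min (A l) (B l) = ∑ l, C l := by
        rw [← Finset.sum_add_distrib]
        exact Finset.sum_congr rfl fun l _ => Nat.sub_add_cancel (hmin l)
      have h3 := hS C hC
      omega
    refine Finset.mem_coe.2 (Finset.mem_product.2 ⟨Fintype.mem_piFinset.2 fun j => ?_,
      Finset.mem_product.2 ⟨Fintype.mem_piFinset.2 fun j => ?_,
        Fintype.mem_piFinset.2 fun j => ?_⟩⟩)
    · have h1 := (hS A hA).1 j
      dsimp only
      split_ifs <;> simp <;> omega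
    · exact Finset.mem_range.2 (hle A hA (fun l => min_le_left _ _) j)
    · exact Finset.mem_range.2 (hle B hB (fun l => min_le_right _ _) j)
  · rintro ⟨A, B⟩ hp ⟨A', B'⟩ hp' h
    simp only [Finset.coe_filter, Set.mem_ofPred_eq, Finset.mem_product] at hp hp'
    obtain ⟨⟨hA, hB⟩, h0⟩ := hp
    obtain ⟨⟨hA', hB'⟩, h0'⟩ := hp'
    simp only [Prod.mk.injEq] at h ⊢
    have e1 : A = A' := by
      refine eq_of_sum_eq 0 (fun j hj => ?_) (sum_eq_of_height hS hA hA' ?_)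
      · simpa [hj] using congrFun h.1 j
      · simpa using congrFun h.1 0
    refine ⟨e1, funext fun j => ?_⟩
    have h2 := congrFun h.2.1 j
    have h3 := congrFun h.2.2 j
    simp only [e1] at h2 h3
    omega

/-- The three ways in which four indices may coincide in pairs. -/
def Pattern (k : Fin 3) (a b c d : ℕ) : Prop :=
  if k = 0 then a = b ∧ c = d else if k = 1 then a = c ∧ b = d else a = d ∧ b = c

theorem exists_pattern {a b c d : ℕ} (h : Paired a b c d) : ∃ k, Pattern k a b c d := by
  rcases h with h | h | h
  · exact ⟨0, by simpa [Pattern] using h⟩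
  · exact ⟨1, by simpa [Pattern] using h⟩
  · exact ⟨2, by simpa [Pattern] using h⟩

theorem card_pattern_le (hS : InWindow S m t w) {i : Fin (r + 1)} (hi : i ≠ 0)
    (π : Fin (r + 1) → Fin 3) (hπ : π i ≠ 0) :
    (((S ×ˢ S) ×ˢ (S ×ˢ S)).filter fun p => p.1.1 0 = p.1.2 0 ∧ p.2.1 0 = p.2.2 0 ∧
      ∀ j, Pattern (π j) (p.1.1 j) (p.1.2 j) (p.2.1 j) (p.2.2 j)).card ≤
      ((m + 1) ^ r * w) * ((m + 1) ^ (r - 1) * (w * w)) := by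
  rw [← card_box_two hi (m + 1) w w, ← card_box_one i (m + 1) w, ← Finset.card_product]
  refine Finset.card_le_card_of_injOn (fun p =>
    (fun j => if j = i then height m t p.1.1 else p.1.1 j,
    fun j => if j = i then height m t p.1.2 else if j = 0 then height m t p.2.1 else
      if π j = 0 then p.2.1 j else p.1.2 j)) ?_ ?_
  · rintro ⟨⟨A, B⟩, ⟨C, D⟩⟩ hp
    simp only [Finset.coe_filter, Set.mem_ofPred_eq, Finset.mem_product] at hp
    obtain ⟨⟨⟨hA, hB⟩, ⟨hC, hD⟩⟩, -⟩ := hp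
    have hhA := height_lt hS hA
    have hhB := height_lt hS hB
    have hhC := height_lt hS hC
    refine Finset.mem_coe.2 (Finset.mem_product.2 ⟨Fintype.mem_piFinset.2 fun j => ?_,
      Fintype.mem_piFinset.2 fun j => ?_⟩)
    · have h1 := (hS A hA).1 j
      dsimp only
      split_ifs <;> simp <;> omega
    · have h1 := (hS B hB).1 j
      have h2 := (hS C hC).1 j
      dsimp only
      split_ifs <;> simp <;> omega
  · rintro ⟨⟨A, B⟩, ⟨C, D⟩⟩ hp ⟨⟨A', B'⟩, ⟨C', D'⟩⟩ hp' h
    simp only [Finset.coe_filter, Set.mem_ofPred_eq, Finset.mem_product] at hp hp'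
    obtain ⟨⟨⟨hA, hB⟩, ⟨hC, hD⟩⟩, h1, h2, h3⟩ := hp
    obtain ⟨⟨⟨hA', hB'⟩, ⟨hC', hD'⟩⟩, h1', h2', h3'⟩ := hp'
    simp only [Prod.mk.injEq] at h ⊢
    have eA : A = A' := by
      refine eq_of_sum_eq i (fun j hj => ?_) (sum_eq_of_height hS hA hA' ?_)
      · simpa [hj] using congrFun h.1 j
      · simpa using congrFun h.1 i
    have hq : ∀ j, j ≠ i → j ≠ 0 → (if π j = 0 then C j else B j) = if π j = 0 then C' j else B' j :=
      fun j hj hj0 => by simpa only [if_neg hj, if_neg hj0] using congrFun h.2 j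
    have eB : B = B' := by
      refine eq_of_sum_eq i (fun j hj => ?_) (sum_eq_of_height hS hB hB' ?_)
      · by_cases hj0 : j = 0
        · rw [hj0, ← h1, ← h1', eA]
        · have a1 := h3 j
          have a2 := h3' j
          have a3 := hq j hj hj0
          by_cases hk : π j = 0
          · simp only [Pattern, if_pos hk] at a1 a2
            rw [← a1.1, ← a2.1, eA]
          · simpa [hk] using a3
      · simpa using congrFun h.2 i
    have eC : C = C' := by
      refine eq_of_sum_eq 0 (fun j hj0 => ?_) (sum_eq_of_height hS hC hC' ?_)
      · have a1 := h3 j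
        have a2 := h3' j
        by_cases hk : π j = 0
        · have hj : j ≠ i := by
            rintro rfl
            exact hπ hk
          simpa [hk] using hq j hj hj0
        · simp only [Pattern, if_neg hk] at a1 a2
          subst eA eB
          split_ifs at a1 a2 <;> omega
      · simpa [hi.symm] using congrFun h.2 0
    refine ⟨⟨eA, eB⟩, eC, funext fun j => ?_⟩
    have a1 := h3 j
    have a2 := h3' j
    subst eA eB eC
    unfold Pattern at a1 a2
    split_ifs at a1 a2 <;> omega

theorem card_quads_le (hS : InWindow S m t w) :
    (((S ×ˢ S) ×ˢ (S ×ˢ S)).filter fun p => p.1.1 ≠ p.1.2 ∧ p.1.1 0 = p.1.2 0 ∧ p.2.1 0 = p.2.2 0 ∧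
      ∀ j, Paired (p.1.1 j) (p.1.2 j) (p.2.1 j) (p.2.2 j)).card ≤
      ((r + 1) * 3 ^ (r + 1)) * (((m + 1) ^ r * w) * ((m + 1) ^ (r - 1) * (w * w))) := by
  set Q : Fin (r + 1) × (Fin (r + 1) → Fin 3) →
      Finset (((Fin (r + 1) → ℕ) × (Fin (r + 1) → ℕ)) × ((Fin (r + 1) → ℕ) × (Fin (r + 1) → ℕ))) :=
    fun k => if k.1 ≠ 0 ∧ k.2 k.1 ≠ 0 then
      ((S ×ˢ S) ×ˢ (S ×ˢ S)).filter fun p => p.1.1 0 = p.1.2 0 ∧ p.2.1 0 = p.2.2 0 ∧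
        ∀ j, Pattern (k.2 j) (p.1.1 j) (p.1.2 j) (p.2.1 j) (p.2.2 j) else ∅ with hQ
  have hcard : (Finset.univ : Finset (Fin (r + 1) × (Fin (r + 1) → Fin 3))).card =
      (r + 1) * 3 ^ (r + 1) := by simp
  rw [← hcard]
  refine (Finset.card_le_card (t := Finset.univ.biUnion Q) ?_).trans
    (Finset.card_biUnion_le_card_mul _ _ _ fun k _ => ?_)
  · rintro ⟨⟨A, B⟩, ⟨C, D⟩⟩ hp
    rw [Finset.mem_filter] at hp
    obtain ⟨hmem, hne, h1, h2, h3⟩ := hp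
    dsimp only at hne h1 h2 h3
    choose π hπ using fun j => exists_pattern (h3 j)
    obtain ⟨i, hi⟩ := Function.ne_iff.1 hne
    rw [Finset.mem_biUnion]
    refine ⟨(i, π), Finset.mem_univ _, ?_⟩
    have hk : i ≠ 0 ∧ π i ≠ 0 := by
      refine ⟨fun h => hi (h ▸ h1), fun h => hi ?_⟩
      have := hπ i
      simp only [Pattern, if_pos h] at this
      exact this.1
    simp only [hQ]
    rw [if_pos hk, Finset.mem_filter]
    exact ⟨hmem, h1, h2, hπ⟩
  · simp only [hQ]
    split_ifs with h
    · exact card_pattern_le hS h.1 k.2 h.2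
    · simp

end Counting

theorem le_card_of_sum_eq {r m : ℕ} (hr : 1 ≤ r) {S : Finset (Fin (r + 1) → ℕ)}
    (hS : ∀ A : Fin (r + 1) → ℕ, 1 ≤ A 0 → (∀ i, A i ≤ m) → ∑ i, A i = m + 1 → A ∈ S) :
    (m / (r + 1)) ^ r ≤ S.card := by
  have hc : (Fintype.piFinset fun _ : Fin r => Finset.Icc 1 (m / (r + 1))).card =
      (m / (r + 1)) ^ r := by
    rw [Fintype.card_piFinset]
    simp
  rw [← hc]
  refine Finset.card_le_card_of_injOn
    (fun v => (Fin.cons (m + 1 - ∑ i, v i) v : Fin (r + 1) → ℕ)) ?_ ?_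
  · intro v hv
    have hv' : ∀ i, 1 ≤ v i ∧ v i ≤ m / (r + 1) := fun i => by
      simpa using Fintype.mem_piFinset.1 (Finset.mem_coe.1 hv) i
    have h1 : ∑ i, v i ≤ r * (m / (r + 1)) := by
      refine (Finset.sum_le_sum fun i _ => (hv' i).2).trans ?_
      simp
    have h2 : r ≤ ∑ i, v i := by
      refine le_trans ?_ (Finset.sum_le_sum fun i _ => (hv' i).1)
      simp
    have h3 : r * (m / (r + 1)) ≤ m := by
      have := Nat.mul_div_le m (r + 1)
      nlinarith
    refine Finset.mem_coe.2 (hS _ ?_ (fun i => ?_) ?_)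
    · simp only [Fin.cons_zero]; omega
    · refine Fin.cases ?_ (fun j => ?_) i
      · simp only [Fin.cons_zero]; omega
      · simp only [Fin.cons_succ]
        exact (hv' j).2.trans (Nat.div_le_self _ _)
    · rw [Fin.sum_cons]; omega
  · intro v _ v' _ h
    exact (Fin.cons_injective2 h).2

end NetCLT

namespace NetCLT

/-- Digit arrays of points of `[0,1)^s`. -/
abbrev Dig (s m : ℕ) : Type := Fin s → Fin m → ZMod 2

/-- The digit map of a digital net as a homomorphism. -/
def netHom (m s : ℕ) (C : Fin s → Matrix (Fin m) (Fin m) (ZMod 2)) :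
    (Fin m → ZMod 2) →+ Dig s m where
  toFun e i j := ∑ r : Fin m, C i j r * e r
  map_zero' := by funext i j; simp
  map_add' e e' := by funext i j; simp [mul_add, Finset.sum_add_distrib]

/-- The binary digits of `n < 2^m`. -/
def bitVec (m : ℕ) (n : Fin (2 ^ m)) : Fin m → ZMod 2 :=
  fun r => if (n : ℕ).testBit r then 1 else 0

theorem bitVec_bijective (m : ℕ) : Function.Bijective (bitVec m) := by
  rw [Fintype.bijective_iff_injective_and_card]
  refine ⟨fun a b h => ?_, by simp [ZMod.card]⟩
  refine Fin.ext (Nat.eq_of_testBit_eq fun r => ?_)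
  by_cases hr : r < m
  · have := congrFun h ⟨r, hr⟩
    simp only [bitVec] at this
    cases ha : (a : ℕ).testBit r <;> cases hb : (b : ℕ).testBit r <;> simp [ha, hb] at this ⊢
  · have hm : 2 ^ m ≤ 2 ^ r := Nat.pow_le_pow_right (by norm_num) (by omega)
    rw [Nat.testBit_lt_two_pow (a.2.trans_le hm), Nat.testBit_lt_two_pow (b.2.trans_le hm)]

theorem netPoint_eq_bval (m s : ℕ) (C : Fin s → Matrix (Fin m) (Fin m) (ZMod 2)) (n : Fin (2 ^ m))
    (i : Fin s) : netPoint m s C n i = bval (netHom m s C (bitVec m n) i) := rfl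

theorem sum_netHom {M : Type*} [AddCommMonoid M] (m s : ℕ)
    (C : Fin s → Matrix (Fin m) (Fin m) (ZMod 2)) (f : Dig s m → M) :
    ∑ n : Fin (2 ^ m), f (netHom m s C (bitVec m n)) = ∑ e, f (netHom m s C e) :=
  Function.Bijective.sum_comp (bitVec_bijective m) fun e => f (netHom m s C e)

variable {s m : ℕ}

/-- The digit arrays `x` and `u` agree on the first `A i` digits in coordinate `i`. -/
def Agree (A : Fin s → ℕ) (x u : Dig s m) : Prop := ∀ i, ∀ j : Fin m, (j : ℕ) < A i → x i j = u i j

/-- The number of points of the net agreeing with `u` on the first digits prescribed by `A`. -/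
def cnt (g : (Fin m → ZMod 2) →+ Dig s m) (A : Fin s → ℕ) (u : Dig s m) : ℕ :=
  (Finset.univ.filter fun e => Agree A (g e) u).card

/-- The net property expressed through digits. -/
def IsDigNet (t : ℕ) (g : (Fin m → ZMod 2) →+ Dig s m) : Prop :=
  t ≤ m ∧ ∀ d : Fin s → ℕ, ∑ i, d i + t = m → ∀ u, cnt g d u = 2 ^ t

theorem bdigit_bval_eq_iff {x u : Fin m → ZMod 2} {d : ℕ} (hd : d ≤ m) :
    (∀ j < d, bdigit (j + 1) (bval x) = bdigit (j + 1) (bval u)) ↔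
      ∀ j : Fin m, (j : ℕ) < d → x j = u j := by
  constructor
  · intro h j hj
    have := h j hj
    rw [bdigit_bval, bdigit_bval, dif_pos j.2, dif_pos j.2] at this
    exact ZMod.val_injective 2 this
  · intro h j hj
    rw [bdigit_bval, bdigit_bval, dif_pos (hj.trans_le hd), dif_pos (hj.trans_le hd),
      h ⟨j, hj.trans_le hd⟩ hj]

theorem isDigNet_netHom {t : ℕ} {C : Fin s → Matrix (Fin m) (Fin m) (ZMod 2)} (htm : t ≤ m)
    (h : IsNet t m s fun n : Fin (2 ^ m) => netPoint m s C (n : ℕ)) : IsDigNet t (netHom m s C) := by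
  refine ⟨htm, fun d hd u => ?_⟩
  have hdm : ∀ i, d i ≤ m := fun i => by
    have := Finset.single_le_sum (f := d) (fun _ _ => Nat.zero_le _) (Finset.mem_univ i)
    omega
  have hfl : ∀ i, (0 : ℤ) ≤ ⌊bval (u i) * 2 ^ d i⌋ := fun i =>
    Int.floor_nonneg.2 (mul_nonneg (bval_nonneg _) (by positivity))
  have ha : ∀ i, ((⌊bval (u i) * 2 ^ d i⌋.toNat : ℕ) : ℤ) = ⌊bval (u i) * 2 ^ d i⌋ := fun i =>
    Int.toNat_of_nonneg (hfl i)
  have hbox := h d (fun i => ⌊bval (u i) * 2 ^ d i⌋.toNat) (fun i => by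
    have h1 : ⌊bval (u i) * 2 ^ d i⌋ < 2 ^ d i := by
      rw [Int.floor_lt]
      push_cast
      have := bval_lt_one (u i)
      have h2 : (0 : ℝ) < 2 ^ d i := by positivity
      nlinarith
    have := ha i
    zify
    omega) hd
  rw [← hbox, cnt]
  refine (Finset.card_bijective (bitVec m) (bitVec_bijective m) fun n => ?_).symm
  rw [Finset.mem_filter, Finset.mem_filter, and_iff_right (Finset.mem_univ _),
    and_iff_right (Finset.mem_univ _), Agree]
  refine forall_congr' fun i => ?_
  rw [← bdigit_bval_eq_iff (hdm i), ← floor_eq_floor_iff_bdigit (bval_nonneg _) (bval_lt_one _)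
    (bval_nonneg _) (bval_lt_one _), Int.floor_eq_iff, ← ha i, Int.toNat_natCast]
  change _ ≤ bval (netHom m s C (bitVec m n) i) ∧ bval (netHom m s C (bitVec m n) i) < _ ↔ _
  have h2 : (0 : ℝ) < 2 ^ d i := by positivity
  rw [div_le_iff₀ h2, lt_div_iff₀ h2]
  norm_cast

theorem exists_le_sum_eq {ι : Type*} [Fintype ι] (A : ι → ℕ) {k : ℕ} (hk : k ≤ ∑ i, A i) :
    ∃ B : ι → ℕ, (∀ i, B i ≤ A i) ∧ ∑ i, B i = k := by
  obtain ⟨n, hn⟩ := Nat.exists_eq_add_of_le hk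
  induction n generalizing A with
  | zero => exact ⟨A, fun _ => le_rfl, by omega⟩
  | succ n ih =>
    obtain ⟨i, hi⟩ : ∃ i, A i ≠ 0 := by
      by_contra! h0
      simp [h0] at hn
    have hsum : ∑ l, Function.update A i (A i - 1) l + 1 = ∑ l, A l := by
      rw [Finset.sum_update_of_mem (Finset.mem_univ i),
        ← Finset.add_sum_erase Finset.univ A (Finset.mem_univ i), Finset.sdiff_singleton_eq_erase]
      omega
    obtain ⟨B, hB, hs⟩ := ih (Function.update A i (A i - 1)) (by omega) (by omega)
    refine ⟨B, fun l => (hB l).trans ?_, hs⟩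
    by_cases hl : l = i
    · subst hl; simp
    · simp [Function.update_of_ne hl]

theorem Agree.mono {A B : Fin s → ℕ} (h : ∀ i, B i ≤ A i) {x u : Dig s m} (hx : Agree A x u) :
    Agree B x u := fun i j hj => hx i j (hj.trans_le (h i))

theorem cnt_congr (g : (Fin m → ZMod 2) →+ Dig s m) {A : Fin s → ℕ} {u u' : Dig s m}
    (h : Agree A u u') : cnt g A u = cnt g A u' := by
  unfold cnt
  congr 1
  refine Finset.filter_congr fun e _ => ?_
  exact forall_congr' fun i => forall_congr' fun j => forall_congr' fun hj => by rw [h i j hj]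

theorem cnt_add_range (g : (Fin m → ZMod 2) →+ Dig s m) (A : Fin s → ℕ) (u : Dig s m)
    (e : Fin m → ZMod 2) : cnt g A (u + g e) = cnt g A u := by
  unfold cnt
  refine (Finset.card_bijective (fun e' => e' + e) (AddGroup.addRight_bijective e) fun e' => ?_).symm
  rw [Finset.mem_filter, Finset.mem_filter]
  simp [Agree]

theorem expect_cnt (g : (Fin m → ZMod 2) →+ Dig s m) {A : Fin s → ℕ} (hA : ∀ i, A i ≤ m) :
    (𝔼 u, (cnt g A u : ℝ)) = 2 ^ m / 2 ^ ∑ i, A i := by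
  have h1 : ∀ u, (cnt g A u : ℝ) =
      ∑ e, ∏ i, ∏ j : Fin m, if (j : ℕ) < A i then if g e i j = u i j then 1 else 0 else 1 := by
    intro u
    rw [cnt, Finset.card_filter]
    push_cast
    refine Finset.sum_congr rfl fun e _ => ?_
    split_ifs with h
    · refine (Finset.prod_eq_one fun i _ => Finset.prod_eq_one fun j _ => ?_).symm
      split_ifs with h1 h2
      · rfl
      · exact absurd (h i j h1) h2
      · rfl
    · simp only [Agree, not_forall] at h
      obtain ⟨i, j, hj, hne⟩ := h
      refine (Finset.prod_eq_zero (Finset.mem_univ i)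
        (Finset.prod_eq_zero (Finset.mem_univ j) ?_)).symm
      rw [if_pos hj, if_neg hne]
  simp only [h1]
  rw [Finset.expect_sum_comm]
  have h2 : ∀ e, (𝔼 u : Dig s m, ∏ i, ∏ j : Fin m,
      if (j : ℕ) < A i then if g e i j = u i j then (1 : ℝ) else 0 else 1) =
        1 / 2 ^ ∑ i, A i := by
    intro e
    rw [expect_prod_pi fun i (y : Fin m → ZMod 2) => ∏ j : Fin m,
      if (j : ℕ) < A i then if g e i j = y j then (1 : ℝ) else 0 else 1, ← Finset.prod_pow_eq_pow_sum,
      one_div, ← Finset.prod_inv_distrib]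
    refine Finset.prod_congr rfl fun i _ => ?_
    rw [expect_prod_pi fun (j : Fin m) (b : ZMod 2) =>
      if (j : ℕ) < A i then if g e i j = b then (1 : ℝ) else 0 else 1]
    have h3 : ∀ j : Fin m, (𝔼 b : ZMod 2,
        if (j : ℕ) < A i then if g e i j = b then (1 : ℝ) else 0 else 1) =
          if (j : ℕ) < A i then 2⁻¹ else 1 := by
      intro j
      rw [expect_zmod_two]
      rcases zmod_two_cases (g e i j) with h | h <;> rw [h] <;> split_ifs <;> simp_all
    simp only [h3]
    rw [← Finset.prod_filter, Finset.prod_const, inv_pow]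
    congr 2
    rw [Fin.card_filter_val_lt, min_eq_right (hA i)]
  simp only [h2]
  simp [div_eq_mul_inv, ZMod.card]

theorem exists_agree {r : ℕ} {t : ℕ} {g : (Fin m → ZMod 2) →+ Dig (r + 1) m} (hg : IsDigNet t g)
    {A : Fin (r + 1) → ℕ} (hA : ∑ i, A i + t ≤ m) (u : Dig (r + 1) m) : ∃ e, Agree A (g e) u := by
  have hd : ∑ i, (A i + if i = 0 then m - t - ∑ i, A i else 0) + t = m := by
    rw [Finset.sum_add_distrib, Finset.sum_ite_eq' Finset.univ, if_pos (Finset.mem_univ _)]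
    omega
  have h := hg.2 _ hd u
  have hpos : 0 < cnt g (fun i => A i + if i = 0 then m - t - ∑ i, A i else 0) u := by
    rw [h]; positivity
  obtain ⟨e, he⟩ := Finset.card_pos.1 hpos
  exact ⟨e, Agree.mono (fun i => Nat.le_add_right _ _) (Finset.mem_filter.1 he).2⟩

theorem cnt_eq_of_le {r : ℕ} {t : ℕ} {g : (Fin m → ZMod 2) →+ Dig (r + 1) m} (hg : IsDigNet t g)
    {A : Fin (r + 1) → ℕ} (hA : ∑ i, A i + t ≤ m) (u : Dig (r + 1) m) :
    (cnt g A u : ℝ) = 2 ^ m / 2 ^ ∑ i, A i := by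
  have hAm : ∀ i, A i ≤ m := fun i => by
    have := Finset.single_le_sum (f := A) (fun _ _ => Nat.zero_le _) (Finset.mem_univ i)
    omega
  rw [← expect_cnt g hAm]
  have : ∀ u', (cnt g A u' : ℝ) = cnt g A u := fun u' => by
    obtain ⟨e, he⟩ := exists_agree hg hA (u' - u)
    rw [← cnt_add_range g A u e]
    refine congrArg _ (cnt_congr g fun i j hj => ?_)
    have := he i j hj
    simp [this]
  simp only [this, Fintype.expect_const]

theorem cnt_le {t : ℕ} {g : (Fin m → ZMod 2) →+ Dig s m} (hg : IsDigNet t g)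
    {A : Fin s → ℕ} (hA : m ≤ ∑ i, A i + t) (u : Dig s m) : cnt g A u ≤ 2 ^ t := by
  obtain ⟨B, hB, hs⟩ := exists_le_sum_eq A (k := m - t) (by omega)
  rw [← hg.2 B (by have := hg.1; omega) u]
  exact Finset.card_le_card (Finset.monotone_filter_right _ fun e _ he => he.mono hB)

/-- The digit array whose only nonzero digits are at the positions prescribed by `A`. -/
def topDigit (m : ℕ) (A : Fin s → ℕ) : Dig s m := fun i j => if (j : ℕ) + 1 = A i then 1 else 0

/-- The microlocal discrepancy at the digit level. -/
def lam (g : (Fin m → ZMod 2) →+ Dig s m) (A : Fin s → ℕ) (z : Dig s m) : ℝ :=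
  (cnt g A (z + topDigit m A) : ℝ) - 2 ^ m / 2 ^ ∑ i, A i

theorem agree_iff_inPi {A : Fin s → ℕ} {x z : Dig s m} :
    Agree A x (z + topDigit m A) ↔ ∀ i, InPi (A i) (x i + z i) := by
  refine forall_congr' fun i => forall_congr' fun j => ?_
  refine imp_congr Nat.lt_iff_add_one_le ?_
  have h2 : z i j + z i j = 0 := by
    rcases zmod_two_cases (z i j) with h | h <;> rw [h] <;> rfl
  simp only [topDigit, Pi.add_apply]
  constructor
  · intro h
    rw [h, add_right_comm, h2, zero_add]
  · intro h
    rw [← h, add_left_comm, h2, add_zero]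

theorem sum_inPi (g : (Fin m → ZMod 2) →+ Dig s m) (A : Fin s → ℕ) (z : Dig s m) :
    (∑ e, if ∀ i, InPi (A i) (g e i + z i) then (1 : ℝ) else 0) =
      cnt g A (z + topDigit m A) := by
  rw [cnt, Finset.card_filter]
  push_cast
  simp only [agree_iff_inPi]

theorem lam_eq_zero {r : ℕ} {t : ℕ} {g : (Fin m → ZMod 2) →+ Dig (r + 1) m} (hg : IsDigNet t g)
    {A : Fin (r + 1) → ℕ} (hA : ∑ i, A i + t ≤ m) (z : Dig (r + 1) m) : lam g A z = 0 := by
  rw [lam, cnt_eq_of_le hg hA, sub_self]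

theorem two_pow_div_le {a m t : ℕ} (h : m ≤ a + t) : (2 : ℝ) ^ m / 2 ^ a ≤ 2 ^ t := by
  rw [div_le_iff₀ (by positivity), ← pow_add]
  exact pow_le_pow_right₀ (by norm_num) (by omega)

theorem abs_lam_le {t : ℕ} {g : (Fin m → ZMod 2) →+ Dig s m} (hg : IsDigNet t g)
    {A : Fin s → ℕ} (hA : m ≤ ∑ i, A i + t) (z : Dig s m) : |lam g A z| ≤ 2 ^ t := by
  have h1 : (cnt g A (z + topDigit m A) : ℝ) ≤ 2 ^ t := by exact_mod_cast cnt_le hg hA _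
  have h2 := two_pow_div_le hA
  have h3 : (0 : ℝ) ≤ 2 ^ m / 2 ^ ∑ i, A i := by positivity
  rw [lam, abs_le]
  constructor <;> linarith [Nat.cast_nonneg (α := ℝ) (cnt g A (z + topDigit m A))]

theorem expect_add_right {M : Type*} [AddCommMonoid M] [Module ℚ≥0 M] (f : Dig s m → M)
    (w : Dig s m) : (𝔼 z, f (z + w)) = 𝔼 z, f z :=
  Fintype.expect_equiv (Equiv.addRight w) _ _ fun _ => rfl

theorem expect_sq_lam_le {t : ℕ} {g : (Fin m → ZMod 2) →+ Dig s m} (hg : IsDigNet t g)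
    {A : Fin s → ℕ} (hAm : ∀ i, A i ≤ m) (hA : m ≤ ∑ i, A i + t) :
    (𝔼 z, lam g A z ^ 2) ≤ 2 ^ t * (2 ^ m / 2 ^ ∑ i, A i) := by
  have h1 : ∀ z, lam g A z ^ 2 ≤ 2 ^ t * cnt g A (z + topDigit m A) -
      2 * (2 ^ m / 2 ^ ∑ i, A i) * (cnt g A (z + topDigit m A)) + (2 ^ m / 2 ^ ∑ i, A i) ^ 2 := by
    intro z
    have h1 : (cnt g A (z + topDigit m A) : ℝ) ≤ 2 ^ t := by exact_mod_cast cnt_le hg hA _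
    have h0 := Nat.cast_nonneg (α := ℝ) (cnt g A (z + topDigit m A))
    rw [lam]
    nlinarith
  refine (Finset.expect_le_expect fun z _ => h1 z).trans ?_
  rw [Finset.expect_add_distrib, Finset.expect_sub_distrib, ← Finset.mul_expect,
    ← Finset.mul_expect, Fintype.expect_const,
    expect_add_right (fun z => (cnt g A z : ℝ)) (topDigit m A), expect_cnt g hAm]
  nlinarith [sq_nonneg ((2 : ℝ) ^ m / 2 ^ ∑ i, A i)]

theorem one_fourth_le_sq_lam (g : (Fin m → ZMod 2) →+ Dig s m) {A : Fin s → ℕ}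
    (hA : ∑ i, A i = m + 1) (z : Dig s m) : 1 / 4 ≤ lam g A z ^ 2 := by
  have h : (2 : ℝ) ^ m / 2 ^ (m + 1) = 1 / 2 := by
    rw [pow_succ]
    field_simp
  rw [lam, hA, h]
  rcases Nat.eq_zero_or_pos (cnt g A (z + topDigit m A)) with h1 | h1
  · rw [h1]; norm_num
  · have : (1 : ℝ) ≤ cnt g A (z + topDigit m A) := by exact_mod_cast h1
    nlinarith

theorem lam_congr (g : (Fin m → ZMod 2) →+ Dig s m) {A : Fin s → ℕ} {z z' : Dig s m}
    (h : Agree A z z') : lam g A z = lam g A z' := by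
  rw [lam, lam, cnt_congr g (u' := z' + topDigit m A)]
  intro i j hj
  simp [h i j hj]

theorem lam_add_range (g : (Fin m → ZMod 2) →+ Dig s m) (A : Fin s → ℕ) (z : Dig s m)
    (e : Fin m → ZMod 2) : lam g A (z + g e) = lam g A z := by
  rw [lam, lam, add_right_comm, cnt_add_range]

theorem expect_sq_lam_mul_sq_lam {r : ℕ} {t : ℕ} {g : (Fin m → ZMod 2) →+ Dig (r + 1) m}
    (hg : IsDigNet t g) {A B : Fin (r + 1) → ℕ} (hAB : ∑ i, min (A i) (B i) + t ≤ m) :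
    (𝔼 z, lam g A z ^ 2 * lam g B z ^ 2) = (𝔼 z, lam g A z ^ 2) * 𝔼 z, lam g B z ^ 2 := by
  have key : ∀ w, (𝔼 z, lam g A z ^ 2 * lam g B z ^ 2) =
      𝔼 z, lam g A z ^ 2 * lam g B (z + w) ^ 2 := by
    intro w
    obtain ⟨e, he⟩ := exists_agree hg hAB w
    set v : Dig (r + 1) m := fun i j => if (j : ℕ) < A i then 0 else w i j - g e i j with hv
    have hB : ∀ z, lam g B (z + w) = lam g B (z + v) := by
      intro z
      rw [← lam_add_range g B (z + v) e]
      refine lam_congr g fun i j hj => ?_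
      simp only [Pi.add_apply, hv]
      split_ifs with h
      · rw [he i j (lt_min h hj), add_zero]
      · ring
    have hA : ∀ z, lam g A z = lam g A (z + v) := by
      intro z
      refine lam_congr g fun i j hj => ?_
      simp [hv, hj]
    simp only [hB]
    rw [← expect_add_right (fun z => lam g A z ^ 2 * lam g B z ^ 2) v]
    refine Finset.expect_congr rfl fun z _ => ?_
    rw [← hA]
  have h2 : (𝔼 z, lam g A z ^ 2 * lam g B z ^ 2) =
      𝔼 w : Dig (r + 1) m, 𝔼 z, lam g A z ^ 2 * lam g B (z + w) ^ 2 := by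
    rw [Finset.expect_congr rfl fun w _ => (key w).symm, Fintype.expect_const]
  rw [h2, Finset.expect_comm, Finset.expect_mul]
  refine Finset.expect_congr rfl fun z _ => ?_
  rw [← Finset.mul_expect]
  congr 1
  simp only [add_comm z]
  exact expect_add_right (fun w => lam g B w ^ 2) z

end NetCLT

namespace NetCLT

/-- The sign of the coefficient of index `A`. -/
def signA {s : ℕ} (A : Fin s → ℕ) : ℝ := ∏ i, if A i = 0 then 1 else -1

theorem abs_signA {s : ℕ} (A : Fin s → ℕ) : |signA A| = 1 := by
  rw [signA, Finset.abs_prod]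
  refine Finset.prod_eq_one fun i _ => ?_
  split_ifs <;> simp

/-- The box of indices with entries at most `m`. -/
def indexBox (s m : ℕ) : Finset (Fin s → ℕ) := Fintype.piFinset fun _ => Finset.range (m + 1)

theorem mem_indexBox {s m : ℕ} {A : Fin s → ℕ} : A ∈ indexBox s m ↔ ∀ i, A i ≤ m := by
  simp [indexBox]

section Expansion

variable {s m : ℕ}

/-- The coefficient of the Rademacher function of index `A`. -/
def coef (g : (Fin m → ZMod 2) →+ Dig s m) (A : Fin s → ℕ) (z : Dig s m) : ℝ :=
  (1 / 2 ^ s) * signA A * lam g A z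

/-- The discrepancy function with the values on the boundary of dyadic boxes averaged. -/
def discDig (g : (Fin m → ZMod 2) →+ Dig s m) (t y : Dig s m) : ℝ :=
  (∑ e, ∏ i, ((if bval (g e i + t i) < bval (y i) then (1 : ℝ) else 0) +
    if g e i + t i = y i then 1 / 2 else 0)) - 2 ^ m * ∏ i, (bval (y i) + 1 / 2 ^ (m + 1))

theorem one_sub_sum_div_two (y : Fin m → ZMod 2) (f : ℕ → ℝ) (hf : f 0 = 1) :
    (1 - ∑ a : Fin m, sgn (y a) * f ((a : ℕ) + 1)) / 2 =
      ∑ a ∈ Finset.range (m + 1), (1 / 2) * (if a = 0 then 1 else -1) * rad a y * f a := by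
  rw [Finset.sum_range, Fin.sum_univ_succ]
  simp only [Fin.val_zero, Fin.val_succ, rad_zero, rad_succ, hf, Nat.add_eq_zero_iff, one_ne_zero,
    and_false, if_true, if_false]
  rw [sub_div, Finset.sum_div, sub_eq_add_neg, ← Finset.sum_neg_distrib]
  congr 1
  · norm_num
  · exact Finset.sum_congr rfl fun a _ => by ring

theorem prod_one_sub_sum_div_two (y : Dig s m) (f : Fin s → ℕ → ℝ) (hf : ∀ i, f i 0 = 1) :
    ∏ i, ((1 - ∑ a : Fin m, sgn (y i a) * f i ((a : ℕ) + 1)) / 2) =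
      ∑ A ∈ indexBox s m, (1 / 2 ^ s) * signA A * radA A y * ∏ i, f i (A i) := by
  simp only [fun i => one_sub_sum_div_two (y i) (f i) (hf i)]
  rw [Finset.prod_univ_sum]
  refine Finset.sum_congr rfl fun A _ => ?_
  rw [Finset.prod_mul_distrib, Finset.prod_mul_distrib, Finset.prod_mul_distrib]
  simp [signA, radA]

theorem discDig_eq (g : (Fin m → ZMod 2) →+ Dig s m) (t y : Dig s m) :
    discDig g t y = ∑ A ∈ indexBox s m, coef g A (t + y) * radA A y := by
  have h1 : ∀ e, (∏ i, ((if bval (g e i + t i) < bval (y i) then (1 : ℝ) else 0) +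
      if g e i + t i = y i then 1 / 2 else 0)) =
      ∑ A ∈ indexBox s m, (1 / 2 ^ s) * signA A * radA A y *
        if ∀ i, InPi (A i) (g e i + (t + y) i) then 1 else 0 := by
    intro e
    simp only [fun i => lt_indicator_expansion (g e i + t i) (y i)]
    rw [prod_one_sub_sum_div_two y (fun i a => if InPi a (g e i + t i + y i) then 1 else 0)
      fun i => if_pos (inPi_zero _)]
    refine Finset.sum_congr rfl fun A _ => ?_
    rw [Finset.prod_ite_zero]
    simp [add_assoc]
  have h2 : ∏ i, (bval (y i) + 1 / 2 ^ (m + 1)) =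
      ∑ A ∈ indexBox s m, (1 / 2 ^ s) * signA A * radA A y * (1 / 2 ^ ∑ i, A i) := by
    simp only [bval_midpoint]
    rw [prod_one_sub_sum_div_two y (fun _ a => 1 / 2 ^ a) fun i => by simp]
    refine Finset.sum_congr rfl fun A _ => ?_
    simp [Finset.prod_pow_eq_pow_sum]
  simp only [discDig, h1, h2]
  rw [Finset.sum_comm, Finset.mul_sum, ← Finset.sum_sub_distrib]
  refine Finset.sum_congr rfl fun A _ => ?_
  rw [← Finset.mul_sum, sum_inPi, coef, lam]
  ring

/-- The discrepancy of the digitally shifted net as a function of the shift and of `Y`. -/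
def disc (g : (Fin m → ZMod 2) →+ Dig s m) (t : Dig s m) (Y : Fin s → ℝ) : ℝ :=
  (∑ e, if ∀ i, bval (g e i + t i) < Y i then (1 : ℝ) else 0) - 2 ^ m * ∏ i, Y i

theorem card_boundary_le {τ : ℕ} {g : (Fin m → ZMod 2) →+ Dig s m} (hg : IsDigNet τ g)
    (t y : Dig s m) : (Finset.univ.filter fun e => ∃ i, g e i + t i = y i).card ≤ s * 2 ^ τ := by
  have h : (Finset.univ.filter fun e => ∃ i, g e i + t i = y i) ⊆
      Finset.univ.biUnion fun i : Fin s =>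
        Finset.univ.filter fun e => Agree (fun l => if l = i then m else 0) (g e) (y - t) := by
    intro e he
    obtain ⟨i, hi⟩ := (Finset.mem_filter.1 he).2
    refine Finset.mem_biUnion.2 ⟨i, Finset.mem_univ _, Finset.mem_filter.2 ⟨Finset.mem_univ _, ?_⟩⟩
    intro l j hj
    by_cases hl : l = i
    · subst hl
      exact eq_sub_of_add_eq (congrFun hi j)
    · simp [hl] at hj
  refine (Finset.card_le_card h).trans ?_
  have h2 := Finset.card_biUnion_le_card_mul (Finset.univ : Finset (Fin s))
    (fun i => Finset.univ.filter fun e => Agree (fun l => if l = i then m else 0) (g e) (y - t))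
    (2 ^ τ) fun i _ => cnt_le hg (by simp) _
  simpa using h2

theorem abs_disc_sub_discDig_le {τ : ℕ} {g : (Fin m → ZMod 2) →+ Dig s m} (hg : IsDigNet τ g)
    (t : Dig s m) {Y : Fin s → ℝ} (hY : ∀ i, Y i ∈ Set.Ico (0 : ℝ) 1) :
    |disc g t Y - discDig g t fun i => digB m (Y i)| ≤ s * 2 ^ τ + s := by
  set y : Dig s m := fun i => digB m (Y i) with hy
  have hle : ∀ i, bval (y i) ≤ Y i := fun i => bval_digB_le m (hY i).1 (hY i).2
  have hlt : ∀ i, Y i < bval (y i) + 1 / 2 ^ m := fun i => lt_bval_digB_add m (hY i).1 (hY i).2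
  have hpos : (0 : ℝ) < 1 / 2 ^ m := by positivity
  have h1 : ∀ e, |(if ∀ i, bval (g e i + t i) < Y i then (1 : ℝ) else 0) -
      ∏ i, ((if bval (g e i + t i) < bval (y i) then (1 : ℝ) else 0) +
        if g e i + t i = y i then 1 / 2 else 0)| ≤ if ∃ i, g e i + t i = y i then 1 else 0 := by
    intro e
    have hfac : ∀ i, 0 ≤ ((if bval (g e i + t i) < bval (y i) then (1 : ℝ) else 0) +
        if g e i + t i = y i then 1 / 2 else 0) ∧
        ((if bval (g e i + t i) < bval (y i) then (1 : ℝ) else 0) +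
        if g e i + t i = y i then 1 / 2 else 0) ≤ 1 := by
      intro i
      by_cases h : g e i + t i = y i
      · simp only [h, lt_irrefl, if_true, if_false]; norm_num
      · simp only [h, if_false]
        split_ifs <;> norm_num
    split_ifs with h2 h3 h3
    · have ha := Finset.prod_nonneg (s := Finset.univ) fun i _ => (hfac i).1
      have hb := Finset.prod_le_one (s := Finset.univ) (fun i _ => (hfac i).1) fun i _ => (hfac i).2
      rw [abs_le]; constructor <;> linarith
    · rw [Finset.prod_eq_one, sub_self, abs_zero]
      intro i _
      have hne : g e i + t i ≠ y i := fun h => h3 ⟨i, h⟩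
      rw [if_neg hne, add_zero, if_pos]
      have := h2 i
      rcases bval_eq_or_lt (g e i + t i) (y i) with h | h | h
      · exact absurd h hne
      · linarith
      · linarith [hlt i]
    · have ha := Finset.prod_nonneg (s := Finset.univ) fun i _ => (hfac i).1
      have hb := Finset.prod_le_one (s := Finset.univ) (fun i _ => (hfac i).1) fun i _ => (hfac i).2
      rw [abs_le]; constructor <;> linarith
    · simp only [not_forall] at h2
      obtain ⟨i, hi⟩ := h2
      have hne : g e i + t i ≠ y i := fun h => h3 ⟨i, h⟩
      rw [Finset.prod_eq_zero (Finset.mem_univ i), sub_self, abs_zero]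
      rw [if_neg hne, add_zero, if_neg]
      intro h
      exact hi (h.trans_le (hle i))
  have h2 : |(∏ i, Y i) - ∏ i, (bval (y i) + 1 / 2 ^ (m + 1))| ≤ s * (1 / 2 ^ m) := by
    have hhalf : (1 : ℝ) / 2 ^ (m + 1) = 1 / 2 ^ m / 2 := by rw [pow_succ]; field_simp
    refine (abs_prod_sub_prod_le _ _ _ (fun i => ?_) fun i => ?_).trans
      ((Finset.sum_le_card_nsmul _ _ (1 / 2 ^ m) fun i _ => ?_).trans (by simp))
    · rw [abs_le]; constructor <;> linarith [(hY i).1, (hY i).2]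
    · have := bval_le (y i)
      have := bval_nonneg (y i)
      rw [hhalf, abs_le]; constructor <;> linarith
    · have := hle i
      have := hlt i
      rw [hhalf, abs_le]; constructor <;> linarith
  have h3 : |∑ e, ((if ∀ i, bval (g e i + t i) < Y i then (1 : ℝ) else 0) -
      ∏ i, ((if bval (g e i + t i) < bval (y i) then (1 : ℝ) else 0) +
        if g e i + t i = y i then 1 / 2 else 0))| ≤ s * 2 ^ τ := by
    refine (Finset.abs_sum_le_sum_abs _ _).trans ((Finset.sum_le_sum fun e _ => h1 e).trans ?_)
    rw [Finset.sum_boole]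
    exact_mod_cast card_boundary_le hg t y
  have h4 : disc g t Y - discDig g t y = ∑ e, ((if ∀ i, bval (g e i + t i) < Y i then (1 : ℝ) else 0) -
      ∏ i, ((if bval (g e i + t i) < bval (y i) then (1 : ℝ) else 0) +
        if g e i + t i = y i then 1 / 2 else 0)) -
      2 ^ m * ((∏ i, Y i) - ∏ i, (bval (y i) + 1 / 2 ^ (m + 1))) := by
    rw [Finset.sum_sub_distrib, disc, discDig]; ring
  rw [h4]
  refine (abs_sub _ _).trans (add_le_add h3 ?_)
  rw [abs_mul, abs_of_pos (show (0 : ℝ) < 2 ^ m by positivity)]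
  calc (2 : ℝ) ^ m * _ ≤ 2 ^ m * (s * (1 / 2 ^ m)) := by gcongr
    _ = s := by field_simp

end Expansion

end NetCLT

namespace NetCLT

section ChaosMoments

variable {r m : ℕ} {S : Finset (Fin (r + 1) → ℕ)} {c : (Fin (r + 1) → ℕ) → ℝ} {κ : ℝ}

/-- Pairs of indices with the same leading entry. -/
def leadPairs (S : Finset (Fin (r + 1) → ℕ)) : Finset ((Fin (r + 1) → ℕ) × (Fin (r + 1) → ℕ)) :=
  (S ×ˢ S).filter fun p => p.1 0 = p.2 0

/-- Quadruples of indices that coincide in pairs in each coordinate, the first two being distinct. -/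
def quads (S : Finset (Fin (r + 1) → ℕ)) :
    Finset (((Fin (r + 1) → ℕ) × (Fin (r + 1) → ℕ)) × ((Fin (r + 1) → ℕ) × (Fin (r + 1) → ℕ))) :=
  ((S ×ˢ S) ×ˢ (S ×ˢ S)).filter fun p => p.1.1 ≠ p.1.2 ∧ p.1.1 0 = p.1.2 0 ∧ p.2.1 0 = p.2.2 0 ∧
      ∀ j, Paired (p.1.1 j) (p.1.2 j) (p.2.1 j) (p.2.2 j)

/-- The product of the lower-order Rademacher functions of a pair of indices. -/
def radPair (p : (Fin (r + 1) → ℕ) × (Fin (r + 1) → ℕ)) (v : Fin r → Fin m → ZMod 2) : ℝ :=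
  radA (Fin.tail p.1) v * radA (Fin.tail p.2) v

theorem mem_leadPairs {p : (Fin (r + 1) → ℕ) × (Fin (r + 1) → ℕ)} :
    p ∈ leadPairs S ↔ (p.1 ∈ S ∧ p.2 ∈ S) ∧ p.1 0 = p.2 0 := by
  rw [leadPairs, Finset.mem_filter, Finset.mem_product]

theorem sum_ite_eq_succ {m a : ℕ} (h1 : 1 ≤ a) (h2 : a ≤ m) (x : ℝ) :
    (∑ j : Fin m, if a = (j : ℕ) + 1 then x else 0) = x := by
  rw [Finset.sum_eq_single (⟨a - 1, by omega⟩ : Fin m)]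
  · rw [if_pos (by simp; omega)]
  · intro j _ hj
    refine if_neg fun h => hj (Fin.ext ?_)
    simp; omega
  · simp

theorem sq_chaosCoef (j : Fin m) (v : Fin r → Fin m → ZMod 2) :
    chaosCoef S c j v ^ 2 =
      ∑ p ∈ leadPairs S, if p.1 0 = (j : ℕ) + 1 then c p.1 * c p.2 * radPair p v else 0 := by
  rw [chaosCoef, sq, Finset.sum_mul_sum, ← Finset.sum_product', leadPairs, Finset.sum_filter]
  refine Finset.sum_congr rfl fun p _ => ?_
  unfold radPair
  by_cases h1 : p.1 0 = (j : ℕ) + 1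
  · by_cases h2 : p.2 0 = (j : ℕ) + 1
    · rw [if_pos h1, if_pos h2, if_pos (h1.trans h2.symm), if_pos h1]; ring
    · rw [if_neg h2, mul_zero, if_neg fun h => h2 (h.symm.trans h1)]
  · rw [if_neg h1, zero_mul, if_neg h1, ite_self]

theorem sum_sq_chaosCoef (hS : ∀ A ∈ S, 1 ≤ A 0 ∧ ∀ i, A i ≤ m) (v : Fin r → Fin m → ZMod 2) :
    ∑ j, chaosCoef S c j v ^ 2 = ∑ A ∈ S, c A ^ 2 +
      ∑ p ∈ (leadPairs S).filter (fun p => p.1 ≠ p.2), c p.1 * c p.2 * radPair p v := by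
  simp only [sq_chaosCoef]
  rw [Finset.sum_comm, ← Finset.sum_filter_add_sum_filter_not _
    (fun p : (Fin (r + 1) → ℕ) × (Fin (r + 1) → ℕ) => p.1 = p.2)]
  have h : ∀ p ∈ leadPairs S, (∑ j : Fin m, if p.1 0 = (j : ℕ) + 1 then
      c p.1 * c p.2 * radPair p v else 0) = c p.1 * c p.2 * radPair p v := fun p hp =>
    sum_ite_eq_succ (hS _ (mem_leadPairs.1 hp).1.1).1 ((hS _ (mem_leadPairs.1 hp).1.1).2 0) _
  congr 1
  · refine (Finset.sum_nbij' (fun A => (A, A)) Prod.fst ?_ ?_ ?_ ?_ ?_).symm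
    · intro A hA
      exact Finset.mem_filter.2 ⟨mem_leadPairs.2 ⟨⟨hA, hA⟩, rfl⟩, rfl⟩
    · intro p hp
      exact (mem_leadPairs.1 (Finset.mem_filter.1 hp).1).1.1
    · intro A _
      rfl
    · intro p hp
      exact Prod.ext rfl (Finset.mem_filter.1 hp).2
    · intro A hA
      rw [h (A, A) (mem_leadPairs.2 ⟨⟨hA, hA⟩, rfl⟩), radPair, radA_mul_self]
      ring
  · exact Finset.sum_congr rfl fun p hp => h p (Finset.mem_filter.1 hp).1

theorem expect_sum_radPair_le
    {X : Finset (((Fin (r + 1) → ℕ) × (Fin (r + 1) → ℕ)) × ((Fin (r + 1) → ℕ) × (Fin (r + 1) → ℕ)))}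
    {k : ((Fin (r + 1) → ℕ) × (Fin (r + 1) → ℕ)) × ((Fin (r + 1) → ℕ) × (Fin (r + 1) → ℕ)) → ℝ}
    {K : ℝ} (hK : 0 ≤ K) (hk : ∀ x ∈ X, |k x| ≤ K)
    (hX : ∀ x ∈ X, (∀ j, x.1.1 j ≤ m) ∧ (∀ j, x.1.2 j ≤ m) ∧ (∀ j, x.2.1 j ≤ m) ∧ ∀ j, x.2.2 j ≤ m)
    (hX0 : ∀ x ∈ X, x.1.1 0 = x.1.2 0 ∧ x.2.1 0 = x.2.2 0) :
    (𝔼 v : Fin r → Fin m → ZMod 2, ∑ x ∈ X, k x * (radPair x.1 v * radPair x.2 v)) ≤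
      K * (X.filter fun x => ∀ j, Paired (x.1.1 j) (x.1.2 j) (x.2.1 j) (x.2.2 j)).card := by
  rw [Finset.expect_sum_comm]
  have h : ∀ x ∈ X, (𝔼 v : Fin r → Fin m → ZMod 2, k x * (radPair x.1 v * radPair x.2 v)) ≤
      if ∀ j, Paired (x.1.1 j) (x.1.2 j) (x.2.1 j) (x.2.2 j) then K else 0 := by
    intro x hx
    rw [← Finset.mul_expect]
    have e : (𝔼 v : Fin r → Fin m → ZMod 2, radPair x.1 v * radPair x.2 v) =
        𝔼 v : Fin r → Fin m → ZMod 2, radA (Fin.tail x.1.1) v * radA (Fin.tail x.1.2) v *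
          radA (Fin.tail x.2.1) v * radA (Fin.tail x.2.2) v :=
      Finset.expect_congr rfl fun v _ => by unfold radPair; ring
    rw [e]
    split_ifs with hp
    · refine (le_abs_self _).trans ?_
      rw [abs_mul]
      calc _ ≤ K * 1 := mul_le_mul (hk x hx) (abs_expect_radA_four_le _ _ _ _) (abs_nonneg _) hK
        _ = K := mul_one K
    · obtain ⟨a1, a2, a3, a4⟩ := hX x hx
      rw [expect_radA_four (A := Fin.tail x.1.1) (B := Fin.tail x.1.2) (C := Fin.tail x.2.1)
        (D := Fin.tail x.2.2) (fun i => a1 i.succ) (fun i => a2 i.succ) (fun i => a3 i.succ)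
        (fun i => a4 i.succ), mul_zero]
      intro h'
      refine hp fun j => ?_
      refine Fin.cases ?_ (fun i => h' i) j
      exact Or.inl (hX0 x hx)
  refine (Finset.sum_le_sum h).trans (le_of_eq ?_)
  rw [← Finset.sum_filter, Finset.sum_const, nsmul_eq_mul, mul_comm]

theorem expect_sq_cross_le (hS : ∀ A ∈ S, 1 ≤ A 0 ∧ ∀ i, A i ≤ m) (hκ : 0 ≤ κ)
    (hc : ∀ A ∈ S, |c A| ≤ κ) :
    (𝔼 v : Fin r → Fin m → ZMod 2,
      (∑ p ∈ (leadPairs S).filter (fun p => p.1 ≠ p.2), c p.1 * c p.2 * radPair p v) ^ 2) ≤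
      κ ^ 4 * (quads S).card := by
  set T := (leadPairs S).filter fun p => p.1 ≠ p.2 with hT
  have hTm : ∀ p ∈ T, (p.1 ∈ S ∧ p.2 ∈ S) ∧ p.1 0 = p.2 0 := fun p hp =>
    mem_leadPairs.1 (Finset.mem_filter.1 hp).1
  have h1 : ∀ v : Fin r → Fin m → ZMod 2, (∑ p ∈ T, c p.1 * c p.2 * radPair p v) ^ 2 =
      ∑ x ∈ T ×ˢ T, (c x.1.1 * c x.1.2 * (c x.2.1 * c x.2.2)) * (radPair x.1 v * radPair x.2 v) := by
    intro v
    rw [sq, Finset.sum_mul_sum, ← Finset.sum_product']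
    exact Finset.sum_congr rfl fun x _ => by ring
  simp only [h1]
  refine (expect_sum_radPair_le (K := κ ^ 4) (by positivity) ?_ ?_ ?_).trans ?_
  · intro x hx
    rw [Finset.mem_product] at hx
    have a1 := hTm _ hx.1
    have a2 := hTm _ hx.2
    rw [abs_mul, abs_mul, abs_mul]
    calc _ ≤ κ * κ * (κ * κ) := by
          gcongr
          exacts [hc _ a1.1.1, hc _ a1.1.2, hc _ a2.1.1, hc _ a2.1.2]
      _ = κ ^ 4 := by ring
  · intro x hx
    rw [Finset.mem_product] at hx
    have a1 := hTm _ hx.1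
    have a2 := hTm _ hx.2
    exact ⟨(hS _ a1.1.1).2, (hS _ a1.1.2).2, (hS _ a2.1.1).2, (hS _ a2.1.2).2⟩
  · intro x hx
    rw [Finset.mem_product] at hx
    exact ⟨(hTm _ hx.1).2, (hTm _ hx.2).2⟩
  · gcongr
    intro x hx
    rw [Finset.mem_filter, Finset.mem_product] at hx
    have a1 := hTm _ hx.1.1
    have a2 := hTm _ hx.1.2
    exact Finset.mem_filter.2 ⟨Finset.mem_product.2 ⟨Finset.mem_product.2 a1.1,
      Finset.mem_product.2 a2.1⟩, (Finset.mem_filter.1 hx.1.1).2, a1.2, a2.2, hx.2⟩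

theorem card_paired_le :
    (((leadPairs S ×ˢ leadPairs S).filter fun x => x.1.1 0 = x.2.1 0).filter fun x =>
      ∀ j, Paired (x.1.1 j) (x.1.2 j) (x.2.1 j) (x.2.2 j)).card ≤
      (quads S).card + (leadPairs S).card := by
  refine (Finset.card_le_card (t := quads S ∪ (leadPairs S).image fun p => ((p.1, p.1), (p.2, p.2)))
    ?_).trans ((Finset.card_union_le _ _).trans (Nat.add_le_add_left Finset.card_image_le _))
  rintro ⟨⟨A, B⟩, ⟨C, D⟩⟩ hx
  rw [Finset.mem_filter, Finset.mem_filter, Finset.mem_product, mem_leadPairs, mem_leadPairs] at hx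
  dsimp only at hx
  obtain ⟨⟨⟨⟨⟨hA, hB⟩, h1⟩, ⟨⟨hC, hD⟩, h2⟩⟩, h3⟩, h4⟩ := hx
  rw [Finset.mem_union]
  by_cases hAB : A = B
  · right
    subst hAB
    have hCD : C = D := by
      funext j
      rcases h4 j with h | h | h <;> omega
    subst hCD
    exact Finset.mem_image.2 ⟨(A, C), mem_leadPairs.2 ⟨⟨hA, hC⟩, h3⟩, rfl⟩
  · left
    exact Finset.mem_filter.2 ⟨Finset.mem_product.2 ⟨Finset.mem_product.2 ⟨hA, hB⟩,
      Finset.mem_product.2 ⟨hC, hD⟩⟩, hAB, h1, h2, h4⟩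

theorem expect_sum_chaosCoef_four_le (hS : ∀ A ∈ S, 1 ≤ A 0 ∧ ∀ i, A i ≤ m) (hκ : 0 ≤ κ)
    (hc : ∀ A ∈ S, |c A| ≤ κ) :
    (𝔼 v : Fin r → Fin m → ZMod 2, ∑ j, chaosCoef S c j v ^ 4) ≤
      κ ^ 4 * ((quads S).card + (leadPairs S).card : ℕ) := by
  set X := (leadPairs S ×ˢ leadPairs S).filter fun x => x.1.1 0 = x.2.1 0 with hX
  have hXm : ∀ x ∈ X, ((x.1.1 ∈ S ∧ x.1.2 ∈ S) ∧ x.1.1 0 = x.1.2 0) ∧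
      ((x.2.1 ∈ S ∧ x.2.2 ∈ S) ∧ x.2.1 0 = x.2.2 0) := fun x hx => by
    rw [hX, Finset.mem_filter, Finset.mem_product, mem_leadPairs, mem_leadPairs] at hx
    exact hx.1
  have h1 : ∀ v : Fin r → Fin m → ZMod 2, ∑ j, chaosCoef S c j v ^ 4 =
      ∑ x ∈ X, (c x.1.1 * c x.1.2 * (c x.2.1 * c x.2.2)) * (radPair x.1 v * radPair x.2 v) := by
    intro v
    have h2 : ∀ j : Fin m, chaosCoef S c j v ^ 4 = ∑ x ∈ X, if x.1.1 0 = (j : ℕ) + 1 then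
        (c x.1.1 * c x.1.2 * (c x.2.1 * c x.2.2)) * (radPair x.1 v * radPair x.2 v) else 0 := by
      intro j
      rw [show 4 = 2 * 2 from rfl, pow_mul, sq_chaosCoef, sq, Finset.sum_mul_sum,
        ← Finset.sum_product', hX, Finset.sum_filter]
      refine Finset.sum_congr rfl fun x _ => ?_
      by_cases h1 : x.1.1 0 = (j : ℕ) + 1
      · by_cases h2 : x.2.1 0 = (j : ℕ) + 1
        · rw [if_pos h1, if_pos h2, if_pos (h1.trans h2.symm), if_pos h1]; ring
        · rw [if_neg h2, mul_zero, if_neg fun h => h2 (h.symm.trans h1)]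
      · rw [if_neg h1, zero_mul, if_neg h1, ite_self]
    simp only [h2]
    rw [Finset.sum_comm]
    refine Finset.sum_congr rfl fun x hx => ?_
    have := hS _ (hXm x hx).1.1.1
    exact sum_ite_eq_succ this.1 (this.2 0) _
  simp only [h1]
  refine (expect_sum_radPair_le (K := κ ^ 4) (by positivity) ?_ ?_ ?_).trans ?_
  · intro x hx
    obtain ⟨a1, a2⟩ := hXm x hx
    rw [abs_mul, abs_mul, abs_mul]
    calc _ ≤ κ * κ * (κ * κ) := by
          gcongr
          exacts [hc _ a1.1.1, hc _ a1.1.2, hc _ a2.1.1, hc _ a2.1.2]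
      _ = κ ^ 4 := by ring
  · intro x hx
    obtain ⟨a1, a2⟩ := hXm x hx
    exact ⟨(hS _ a1.1.1).2, (hS _ a1.1.2).2, (hS _ a2.1.1).2, (hS _ a2.1.2).2⟩
  · intro x hx
    exact ⟨(hXm x hx).1.2, (hXm x hx).2.2⟩
  · have := card_paired_le (S := S)
    gcongr

theorem expect_abs_le_sqrt {ι : Type*} [Fintype ι] [Nonempty ι] (f : ι → ℝ) :
    (𝔼 i, |f i|) ≤ √(𝔼 i, f i ^ 2) := by
  refine Real.le_sqrt_of_sq_le ?_
  have h := Finset.expect_mul_sq_le_sq_mul_sq Finset.univ (fun i => |f i|) fun _ => (1 : ℝ)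
  simpa [Fintype.expect_const] using h

theorem expect_abs_sum_sq_chaosCoef_sub_one_le (hS : ∀ A ∈ S, 1 ≤ A 0 ∧ ∀ i, A i ≤ m) (hκ : 0 ≤ κ)
    (hc : ∀ A ∈ S, |c A| ≤ κ) :
    (𝔼 v : Fin r → Fin m → ZMod 2, |∑ j, chaosCoef S c j v ^ 2 - 1|) ≤
      √(κ ^ 4 * (quads S).card) + |∑ A ∈ S, c A ^ 2 - 1| := by
  have h : ∀ v : Fin r → Fin m → ZMod 2, |∑ j, chaosCoef S c j v ^ 2 - 1| ≤
      |∑ p ∈ (leadPairs S).filter (fun p => p.1 ≠ p.2), c p.1 * c p.2 * radPair p v| +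
        |∑ A ∈ S, c A ^ 2 - 1| := by
    intro v
    rw [sum_sq_chaosCoef hS, add_sub_right_comm, add_comm]
    exact abs_add_le _ _
  refine (Finset.expect_le_expect fun v _ => h v).trans ?_
  rw [Finset.expect_add_distrib, Fintype.expect_const]
  gcongr
  exact (expect_abs_le_sqrt _).trans (Real.sqrt_le_sqrt (expect_sq_cross_le hS hκ hc))

theorem norm_expect_cexp_sub_le (hS : ∀ A ∈ S, 1 ≤ A 0 ∧ ∀ i, A i ≤ m) (hκ : 0 ≤ κ)
    (hc : ∀ A ∈ S, |c A| ≤ κ) (θ : ℝ) :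
    ‖(𝔼 y : Fin (r + 1) → Fin m → ZMod 2,
        Complex.exp ((θ * ∑ A ∈ S, c A * radA A y : ℝ) * Complex.I)) -
        (Real.exp (-θ ^ 2 / 2) : ℝ)‖ ≤
      2 * θ ^ 4 * (κ ^ 4 * ((quads S).card + (leadPairs S).card : ℕ)) +
        θ ^ 2 / 2 * (√(κ ^ 4 * (quads S).card) + |∑ A ∈ S, c A ^ 2 - 1|) := by
  refine (norm_expect_cexp_chaos_sub_le S hS c θ).trans ?_
  have h1 := expect_sum_chaosCoef_four_le hS hκ hc
  have h2 := expect_abs_sum_sq_chaosCoef_sub_one_le hS hκ hc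
  have h3 : 0 ≤ θ ^ 4 := by positivity
  gcongr

end ChaosMoments

end NetCLT

namespace NetCLT

section Digital

variable {r m t L : ℕ} {g : (Fin m → ZMod 2) →+ Dig (r + 1) m}

/-- The indices carrying the main part of the discrepancy. -/
def mainSet (r m t L : ℕ) : Finset (Fin (r + 1) → ℕ) :=
  (indexBox (r + 1) m).filter fun A => 1 ≤ A 0 ∧ m < ∑ i, A i + t ∧ ∑ i, A i < m + L

theorem mem_mainSet {A : Fin (r + 1) → ℕ} : A ∈ mainSet r m t L ↔
    (∀ i, A i ≤ m) ∧ 1 ≤ A 0 ∧ m < ∑ i, A i + t ∧ ∑ i, A i < m + L := by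
  rw [mainSet, Finset.mem_filter, mem_indexBox]

theorem inWindow_mainSet : InWindow (mainSet r m t L) m t (t + L) := fun A hA => by
  rw [mem_mainSet] at hA
  exact ⟨hA.1, by omega, by omega⟩

/-- The main part of the discrepancy. -/
def mainPart (t L : ℕ) (g : (Fin m → ZMod 2) →+ Dig (r + 1) m) (z y : Dig (r + 1) m) : ℝ :=
  ∑ A ∈ mainSet r m t L, coef g A z * radA A y

/-- The variance of the main part of the discrepancy. -/
def mainVar (t L : ℕ) (g : (Fin m → ZMod 2) →+ Dig (r + 1) m) : ℝ :=
  ∑ A ∈ mainSet r m t L, 𝔼 z, coef g A z ^ 2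

theorem sq_coef {s : ℕ} (g : (Fin m → ZMod 2) →+ Dig s m) (A : Fin s → ℕ) (z : Dig s m) :
    coef g A z ^ 2 = (1 / 2 ^ s) ^ 2 * lam g A z ^ 2 := by
  have : signA A ^ 2 = 1 := by rw [← sq_abs, abs_signA, one_pow]
  rw [coef, mul_pow, mul_pow, this, mul_one]

theorem sq_coef_le {s : ℕ} (g : (Fin m → ZMod 2) →+ Dig s m) (A : Fin s → ℕ) (z : Dig s m) :
    coef g A z ^ 2 ≤ lam g A z ^ 2 := by
  rw [sq_coef]
  have h : (1 / 2 ^ s : ℝ) ≤ 1 := by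
    rw [div_le_one (by positivity)]
    exact one_le_pow₀ (by norm_num)
  have h2 : (1 / 2 ^ s : ℝ) ^ 2 ≤ 1 := pow_le_one₀ (by positivity) h
  nlinarith [sq_nonneg (lam g A z)]

theorem abs_coef_le (hg : IsDigNet t g) {A : Fin (r + 1) → ℕ} (hA : m ≤ ∑ i, A i + t)
    (z : Dig (r + 1) m) : |coef g A z| ≤ 2 ^ t :=
  (sq_le_sq.1 (sq_coef_le g A z)).trans (abs_lam_le hg hA z)

theorem expect_expect_sq {S : Finset (Fin (r + 1) → ℕ)} (hS : ∀ A ∈ S, ∀ i, A i ≤ m) :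
    (𝔼 z, 𝔼 y : Dig (r + 1) m, (∑ A ∈ S, coef g A z * radA A y) ^ 2) =
      ∑ A ∈ S, 𝔼 z, coef g A z ^ 2 := by
  simp only [expect_sq_sum_radA S hS]
  rw [Finset.expect_sum_comm]

theorem expect_sq_mainPart : (𝔼 z, 𝔼 y, mainPart t L g z y ^ 2) = mainVar t L g :=
  expect_expect_sq fun _ hA => (mem_mainSet.1 hA).1

theorem mainVar_ge (hr : 1 ≤ r) (hL : 2 ≤ L) :
    (1 / 2 ^ (r + 1)) ^ 2 / 4 * (m / (r + 1) : ℕ) ^ r ≤ mainVar t L g := by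
  have hcard := le_card_of_sum_eq (m := m) hr
    (S := (mainSet r m t L).filter fun A => ∑ i, A i = m + 1) fun A h1 h2 h3 => by
      rw [Finset.mem_filter, mem_mainSet]
      exact ⟨⟨h2, h1, by omega, by omega⟩, h3⟩
  have h1 : ∀ A ∈ (mainSet r m t L).filter fun A => ∑ i, A i = m + 1,
      (1 / 2 ^ (r + 1) : ℝ) ^ 2 / 4 ≤ 𝔼 z, coef g A z ^ 2 := by
    intro A hA
    refine Finset.le_expect Finset.univ_nonempty fun z _ => ?_
    rw [sq_coef]
    have := one_fourth_le_sq_lam g (Finset.mem_filter.1 hA).2 z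
    have h0 : (0 : ℝ) ≤ (1 / 2 ^ (r + 1)) ^ 2 := by positivity
    nlinarith
  calc _ ≤ (1 / 2 ^ (r + 1) : ℝ) ^ 2 / 4 *
        ((mainSet r m t L).filter fun A => ∑ i, A i = m + 1).card := by
        gcongr
        exact_mod_cast hcard
    _ ≤ ∑ A ∈ (mainSet r m t L).filter fun A => ∑ i, A i = m + 1, 𝔼 z, coef g A z ^ 2 := by
        rw [mul_comm, ← nsmul_eq_mul]
        exact Finset.card_nsmul_le_sum _ _ _ h1
    _ ≤ _ := Finset.sum_le_sum_of_subset_of_nonneg (Finset.filter_subset _ _) fun A _ _ =>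
        Finset.expect_nonneg fun z _ => sq_nonneg _

theorem expect_sq_remainder_le (hg : IsDigNet t g) (hr : 1 ≤ r) :
    (𝔼 z, 𝔼 y, (∑ A ∈ indexBox (r + 1) m, coef g A z * radA A y - mainPart t L g z y) ^ 2) ≤
      (m + 1) ^ (r + 1) * (2 ^ t / 2 ^ L) + ((m + 1) ^ (r - 1) * (t + L) : ℕ) * (2 ^ t) ^ 2 := by
  have h1 : ∀ z y, ∑ A ∈ indexBox (r + 1) m, coef g A z * radA A y - mainPart t L g z y =
      ∑ A ∈ indexBox (r + 1) m \ mainSet r m t L, coef g A z * radA A y := fun z y => by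
    rw [mainPart, ← Finset.sum_sdiff (s₁ := mainSet r m t L) (s₂ := indexBox (r + 1) m)
      (Finset.filter_subset _ _), add_sub_cancel_right]
  simp only [h1]
  rw [expect_expect_sq fun A hA => mem_indexBox.1 (Finset.mem_sdiff.1 hA).1]
  set Z := (indexBox (r + 1) m).filter fun A => A 0 = 0 ∧ m < ∑ i, A i + t ∧ ∑ i, A i < m + L with hZ
  have h2 : ∀ A ∈ indexBox (r + 1) m \ mainSet r m t L, (𝔼 z, coef g A z ^ 2) ≤
      2 ^ t / 2 ^ L + if A ∈ Z then (2 ^ t) ^ 2 else 0 := by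
    intro A hA
    rw [Finset.mem_sdiff, mem_indexBox, mem_mainSet] at hA
    have hpos : (0 : ℝ) ≤ 2 ^ t / 2 ^ L := by positivity
    have hpos2 : (0 : ℝ) ≤ if A ∈ Z then (2 ^ t) ^ 2 else 0 := by positivity
    rcases Nat.lt_or_ge m (∑ i, A i + t) with h3 | h3
    · rcases Nat.lt_or_ge (∑ i, A i) (m + L) with h4 | h4
      · have hAZ : A ∈ Z := by
          rw [hZ, Finset.mem_filter, mem_indexBox]
          refine ⟨hA.1, ?_, h3, h4⟩
          by_contra h0
          exact hA.2 ⟨hA.1, Nat.one_le_iff_ne_zero.2 h0, h3, h4⟩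
        rw [if_pos hAZ]
        refine le_add_of_nonneg_of_le hpos (Finset.expect_le Finset.univ_nonempty fun z _ => ?_)
        rw [sq_le_sq, abs_of_pos (show (0 : ℝ) < 2 ^ t by positivity)]
        exact abs_coef_le hg h3.le z
      · refine le_add_of_le_of_nonneg ((Finset.expect_le_expect fun z _ => sq_coef_le g A z).trans
          ((expect_sq_lam_le hg hA.1 h3.le).trans ?_)) hpos2
        rw [div_eq_mul_inv (2 ^ t : ℝ)]
        gcongr
        rw [div_le_iff₀ (by positivity), ← div_eq_inv_mul, le_div_iff₀ (by positivity), ← pow_add]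
        exact pow_le_pow_right₀ (by norm_num) h4
    · have : ∀ z, coef g A z ^ 2 = 0 := fun z => by
        rw [sq_coef, lam_eq_zero hg h3]; ring
      simp only [this, Finset.expect_const_zero]
      positivity
  refine (Finset.sum_le_sum h2).trans ?_
  rw [Finset.sum_add_distrib, Finset.sum_const, nsmul_eq_mul, ← Finset.sum_filter, Finset.sum_const,
    nsmul_eq_mul]
  have h5 : (indexBox (r + 1) m).card = (m + 1) ^ (r + 1) := by
    simp [indexBox, Fintype.card_piFinset]
  have h6 : (indexBox (r + 1) m \ mainSet r m t L).card ≤ (m + 1) ^ (r + 1) := by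
    rw [← h5]
    exact Finset.card_le_card Finset.sdiff_subset
  have h7 : ((indexBox (r + 1) m \ mainSet r m t L).filter fun A => A ∈ Z).card ≤
      (m + 1) ^ (r - 1) * (t + L) := by
    refine (Finset.card_le_card (t := Z) fun A hA => (Finset.mem_filter.1 hA).2).trans ?_
    refine card_filter_zero_le (t := t) (m := m) (fun A hA => ?_)
      (i := Fin.last r) (fun h => ?_) fun A hA => ?_
    · rw [hZ, Finset.mem_filter, mem_indexBox] at hA
      exact ⟨hA.1, by omega, by omega⟩
    · have := congrArg Fin.val h
      simp at this
      omega
    · exact (Finset.mem_filter.1 hA).2.1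
  gcongr
  exact_mod_cast h6

/-- The number of strongly overlapping pairs of indices. -/
def overlapPairs (r m t L : ℕ) : Finset ((Fin (r + 1) → ℕ) × (Fin (r + 1) → ℕ)) :=
  (mainSet r m t L ×ˢ mainSet r m t L).filter fun p => m < ∑ i, min (p.1 i) (p.2 i) + t

theorem expect_sq_sum_sq_sub_one_le (hg : IsDigNet t g) {τ : ℝ} (hτ : 0 < τ)
    (hτ2 : τ ^ 2 = mainVar t L g) :
    (𝔼 z, (∑ A ∈ mainSet r m t L, (coef g A z / τ) ^ 2 - 1) ^ 2) ≤
      (2 ^ t / τ) ^ 4 * (overlapPairs r m t L).card := by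
  set S := mainSet r m t L with hS
  set f : (Fin (r + 1) → ℕ) → Dig (r + 1) m → ℝ := fun A z => (coef g A z / τ) ^ 2 with hf
  have hmean : ∑ A ∈ S, 𝔼 z, f A z = 1 := by
    have : ∀ A, (𝔼 z, f A z) = (𝔼 z, coef g A z ^ 2) / τ ^ 2 := fun A => by
      simp only [hf, div_pow]
      rw [Finset.expect_div]
    simp only [this]
    rw [← Finset.sum_div, div_eq_one_iff_eq (by positivity), hτ2, mainVar]
  have h0 : (𝔼 z, (∑ A ∈ S, f A z - 1) ^ 2) =
      ∑ p ∈ S ×ˢ S, ((𝔼 z, f p.1 z * f p.2 z) - (𝔼 z, f p.1 z) * 𝔼 z, f p.2 z) := by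
    have e0 : ∀ u v : (Fin (r + 1) → ℕ) → ℝ, ∑ p ∈ S ×ˢ S, u p.1 * v p.2 =
        (∑ A ∈ S, u A) * ∑ A ∈ S, v A := fun u v => by
      rw [Finset.sum_mul_sum, ← Finset.sum_product']
    have e1 : ∀ z, (∑ A ∈ S, f A z - 1) ^ 2 =
        (∑ p ∈ S ×ˢ S, f p.1 z * f p.2 z) - 2 * ∑ A ∈ S, f A z + 1 := fun z => by
      rw [e0 (fun A => f A z) fun A => f A z]; ring
    simp only [e1]
    rw [Finset.expect_add_distrib, Finset.expect_sub_distrib, ← Finset.mul_expect,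
      Finset.expect_sum_comm, Finset.expect_sum_comm, hmean, Fintype.expect_const,
      Finset.sum_sub_distrib, e0 (fun A => 𝔼 z, f A z) fun A => 𝔼 z, f A z, hmean]
    ring
  change (𝔼 z, (∑ A ∈ S, f A z - 1) ^ 2) ≤ _
  rw [h0]
  have hnn : ∀ A z, 0 ≤ f A z := fun A z => sq_nonneg _
  have h1 : ∀ p ∈ S ×ˢ S, ((𝔼 z, f p.1 z * f p.2 z) - (𝔼 z, f p.1 z) * 𝔼 z, f p.2 z) ≤
      if m < ∑ i, min (p.1 i) (p.2 i) + t then (2 ^ t / τ) ^ 4 else 0 := by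
    rintro ⟨A, B⟩ hp
    rw [Finset.mem_product, hS, mem_mainSet, mem_mainSet] at hp
    dsimp only at hp ⊢
    split_ifs with h
    · have hb : ∀ A : Fin (r + 1) → ℕ, m < ∑ i, A i + t → ∀ z, f A z ≤ (2 ^ t / τ) ^ 2 := by
        intro A hA z
        rw [hf, sq_le_sq, abs_div, abs_div, abs_of_pos (show (0 : ℝ) < 2 ^ t by positivity)]
        gcongr
        exact abs_coef_le hg hA.le z
      refine (sub_le_self _ (mul_nonneg (Finset.expect_nonneg fun z _ => hnn _ _)
        (Finset.expect_nonneg fun z _ => hnn _ _))).trans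
        (Finset.expect_le Finset.univ_nonempty fun z _ => ?_)
      calc _ ≤ (2 ^ t / τ) ^ 2 * (2 ^ t / τ) ^ 2 :=
            mul_le_mul (hb A hp.1.2.2.1 z) (hb B hp.2.2.2.1 z) (hnn _ _) (by positivity)
        _ = _ := by ring
    · have h2 := expect_sq_lam_mul_sq_lam hg (A := A) (B := B) (not_lt.1 h)
      have h3 : ∀ A z, f A z = ((1 / 2 ^ (r + 1)) ^ 2 / τ ^ 2) * lam g A z ^ 2 := fun A z => by
        rw [hf]
        dsimp only
        rw [div_pow, sq_coef]; ring
      have h4 : ∀ z, f A z * f B z =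
          ((1 / 2 ^ (r + 1)) ^ 2 / τ ^ 2) ^ 2 * (lam g A z ^ 2 * lam g B z ^ 2) := fun z => by
        rw [h3, h3]; ring
      simp only [h4]
      simp only [h3]
      rw [← Finset.mul_expect, ← Finset.mul_expect, ← Finset.mul_expect, h2]
      apply le_of_eq
      ring
  refine (Finset.sum_le_sum h1).trans (le_of_eq ?_)
  rw [← Finset.sum_filter, Finset.sum_const, nsmul_eq_mul, mul_comm, overlapPairs]

theorem norm_expect_cexp_mainPart_sub_le (hg : IsDigNet t g) {τ : ℝ} (hτ : 0 < τ)
    (hτ2 : τ ^ 2 = mainVar t L g) (θ : ℝ) :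
    ‖(𝔼 z, 𝔼 y, Complex.exp ((θ * (mainPart t L g z y / τ) : ℝ) * Complex.I)) -
        (Real.exp (-θ ^ 2 / 2) : ℝ)‖ ≤
      2 * θ ^ 4 * ((2 ^ t / τ) ^ 4 *
        ((quads (mainSet r m t L)).card + (leadPairs (mainSet r m t L)).card : ℕ)) +
      θ ^ 2 / 2 * (√((2 ^ t / τ) ^ 4 * (quads (mainSet r m t L)).card) +
        √((2 ^ t / τ) ^ 4 * (overlapPairs r m t L).card)) := by
  have hS : ∀ A ∈ mainSet r m t L, 1 ≤ A 0 ∧ ∀ i, A i ≤ m := fun A hA =>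
    ⟨(mem_mainSet.1 hA).2.1, (mem_mainSet.1 hA).1⟩
  have hz : ∀ z, ‖(𝔼 y, Complex.exp ((θ * (mainPart t L g z y / τ) : ℝ) * Complex.I)) -
        (Real.exp (-θ ^ 2 / 2) : ℝ)‖ ≤
      2 * θ ^ 4 * ((2 ^ t / τ) ^ 4 *
        ((quads (mainSet r m t L)).card + (leadPairs (mainSet r m t L)).card : ℕ)) +
      θ ^ 2 / 2 * (√((2 ^ t / τ) ^ 4 * (quads (mainSet r m t L)).card) +
        |∑ A ∈ mainSet r m t L, (coef g A z / τ) ^ 2 - 1|) := by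
    intro z
    have h := norm_expect_cexp_sub_le (c := fun A => coef g A z / τ) (κ := 2 ^ t / τ) hS
      (by positivity) (fun A hA => by
        rw [abs_div, abs_of_pos hτ]
        gcongr
        exact abs_coef_le hg (mem_mainSet.1 hA).2.2.1.le z) θ
    have e : ∀ y, mainPart t L g z y / τ = ∑ A ∈ mainSet r m t L, coef g A z / τ * radA A y :=
      fun y => by
        rw [mainPart, Finset.sum_div]
        exact Finset.sum_congr rfl fun A _ => by ring
    simp only [e]
    exact h
  have h1 : (𝔼 z, 𝔼 y, Complex.exp ((θ * (mainPart t L g z y / τ) : ℝ) * Complex.I)) -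
        (Real.exp (-θ ^ 2 / 2) : ℝ) =
      𝔼 z, ((𝔼 y, Complex.exp ((θ * (mainPart t L g z y / τ) : ℝ) * Complex.I)) -
        (Real.exp (-θ ^ 2 / 2) : ℝ)) := by
    rw [Finset.expect_sub_distrib, Fintype.expect_const]
  rw [h1]
  refine (norm_expect_le _).trans ((Finset.expect_le_expect fun z _ => hz z).trans ?_)
  rw [Finset.expect_add_distrib, Fintype.expect_const, ← Finset.mul_expect,
    Finset.expect_add_distrib, Fintype.expect_const]
  have h2 : (𝔼 z, |∑ A ∈ mainSet r m t L, (coef g A z / τ) ^ 2 - 1|) ≤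
      √((2 ^ t / τ) ^ 4 * (overlapPairs r m t L).card) :=
    (expect_abs_le_sqrt _).trans (Real.sqrt_le_sqrt (expect_sq_sum_sq_sub_one_le hg hτ hτ2))
  gcongr

end Digital

end NetCLT

namespace NetCLT

/-- The half-open unit cube. -/
def icoCube (s : ℕ) : Set (Fin s → ℝ) := Set.univ.pi fun _ => Set.Ico (0 : ℝ) 1

theorem mem_icoCube {s : ℕ} {Y : Fin s → ℝ} : Y ∈ icoCube s ↔ ∀ i, Y i ∈ Set.Ico (0 : ℝ) 1 := by
  simp only [icoCube, Set.mem_univ_pi]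

theorem measurableSet_icoCube (s : ℕ) : MeasurableSet (icoCube s) :=
  MeasurableSet.univ_pi fun _ => measurableSet_Ico

/-- Lebesgue measure on the half-open unit cube. -/
def cubeMeasure (s : ℕ) : Measure (Fin s → ℝ) := volume.restrict (icoCube s)

instance isProbabilityMeasure_cubeMeasure (s : ℕ) : IsProbabilityMeasure (cubeMeasure s) :=
  ⟨by rw [cubeMeasure, Measure.restrict_apply_univ, icoCube, Real.volume_pi_Ico]; simp⟩

/-- The uniform distribution on digit arrays. -/
def digMeasure (s m : ℕ) : Measure (Dig s m) := (PMF.uniformOfFintype (Dig s m)).toMeasure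

instance isProbabilityMeasure_digMeasure (s m : ℕ) : IsProbabilityMeasure (digMeasure s m) :=
  PMF.toMeasure.isProbabilityMeasure _

theorem card_dig (s m : ℕ) : Fintype.card (Dig s m) = 2 ^ (s * m) := by
  simp [ZMod.card, ← pow_mul, mul_comm]

variable {𝕜 : Type*} [RCLike 𝕜]

theorem integral_digMeasure {s m : ℕ} (f : Dig s m → 𝕜) : ∫ u, f u ∂digMeasure s m = 𝔼 u, f u := by
  rw [digMeasure, PMF.integral_eq_sum, Fintype.expect_eq_sum_div_card, Finset.sum_div]
  refine Finset.sum_congr rfl fun u _ => ?_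
  rw [PMF.uniformOfFintype_apply, ENNReal.toReal_inv, ENNReal.toReal_natCast, RCLike.real_smul_eq_coe_mul]
  push_cast
  rw [div_eq_inv_mul]

/-- The joint distribution of a uniform digital shift and a uniform point of the cube. -/
def shiftMeasure (s m : ℕ) : Measure (Dig s m × (Fin s → ℝ)) :=
  (digMeasure s m).prod (cubeMeasure s)

instance isProbabilityMeasure_shiftMeasure (s m : ℕ) : IsProbabilityMeasure (shiftMeasure s m) := by
  unfold shiftMeasure
  infer_instance

theorem integral_shiftMeasure {s m : ℕ} {f : Dig s m × (Fin s → ℝ) → 𝕜}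
    (hf : Integrable f (shiftMeasure s m)) :
    ∫ p, f p ∂shiftMeasure s m = 𝔼 u, ∫ Y, f (u, Y) ∂cubeMeasure s := by
  rw [shiftMeasure, integral_prod _ hf, integral_digMeasure]

theorem measurable_bdigit (a : ℕ) : Measurable (bdigit a) := by
  unfold bdigit
  exact (measurable_of_countable fun k : ℤ => k.toNat % 2).comp
    (Int.measurable_floor.comp (measurable_id.mul_const _))

theorem measurable_digB (m : ℕ) : Measurable (digB m) :=
  measurable_pi_lambda _ fun _ =>
    (measurable_of_countable fun k : ℕ => (k : ZMod 2)).comp (measurable_bdigit _)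

/-- The arrays of leading digits of the coordinates of a point. -/
def digArr (s m : ℕ) (Y : Fin s → ℝ) : Dig s m := fun i => digB m (Y i)

theorem measurable_digArr (s m : ℕ) : Measurable (digArr s m) :=
  measurable_pi_lambda _ fun i => (measurable_digB m).comp (measurable_pi_apply i)

theorem cubeMeasure_digArr_eq {s m : ℕ} (y : Dig s m) :
    (cubeMeasure s).real (digArr s m ⁻¹' {y}) = (2 ^ (s * m) : ℝ)⁻¹ := by
  have h : digArr s m ⁻¹' {y} ∩ icoCube s =
      Set.univ.pi fun i => Set.Ico (bval (y i)) (bval (y i) + 1 / 2 ^ m) := by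
    ext Y
    rw [Set.mem_inter_iff, mem_icoCube, Set.mem_preimage, Set.mem_singleton_iff, Set.mem_univ_pi]
    constructor
    · rintro ⟨rfl, h⟩ i
      exact (digB_eq_iff m (h i).1 (h i).2 _).1 rfl
    · intro h
      have h2 : ∀ i, Y i ∈ Set.Ico (0 : ℝ) 1 := fun i =>
        ⟨(bval_nonneg _).trans (h i).1, (h i).2.trans_le (by linarith [bval_le (y i)])⟩
      exact ⟨funext fun i => (digB_eq_iff m (h2 i).1 (h2 i).2 _).2 (h i), h2⟩
  rw [measureReal_def, cubeMeasure,
    Measure.restrict_apply (measurable_digArr s m (measurableSet_singleton y)), h,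
    Real.volume_pi_Ico_toReal fun i => by
      have : (0 : ℝ) < 1 / 2 ^ m := by positivity
      linarith]
  simp [pow_mul, mul_comm s m]

theorem integral_cubeMeasure_digArr {s m : ℕ} (f : Dig s m → 𝕜) :
    ∫ Y, f (digArr s m Y) ∂cubeMeasure s = 𝔼 y, f y := by
  have hmeas := (measurable_digArr s m).aemeasurable (μ := cubeMeasure s)
  have := Measure.isProbabilityMeasure_map hmeas
  rw [← integral_map hmeas (measurable_of_countable f).aestronglyMeasurable,
    integral_fintype Integrable.of_finite, Fintype.expect_eq_sum_div_card, Finset.sum_div]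
  refine Finset.sum_congr rfl fun y _ => ?_
  rw [map_measureReal_apply (measurable_digArr s m) (measurableSet_singleton y),
    cubeMeasure_digArr_eq, card_dig, RCLike.real_smul_eq_coe_mul]
  push_cast
  rw [div_eq_inv_mul]

theorem integral_shiftMeasure_digArr {s m : ℕ} (f : Dig s m → Dig s m → 𝕜) :
    ∫ p, f (p.1 + digArr s m p.2) (digArr s m p.2) ∂shiftMeasure s m = 𝔼 z, 𝔼 y, f z y := by
  have hmeas : Measurable fun p : Dig s m × (Fin s → ℝ) => (p.1, digArr s m p.2) :=
    measurable_fst.prodMk ((measurable_digArr s m).comp measurable_snd)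
  have hinteg : Integrable (fun p : Dig s m × (Fin s → ℝ) =>
      f (p.1 + digArr s m p.2) (digArr s m p.2)) (shiftMeasure s m) := by
    have := Measure.isProbabilityMeasure_map (hmeas.aemeasurable (μ := shiftMeasure s m))
    exact Integrable.comp_measurable (f := fun p : Dig s m × (Fin s → ℝ) => (p.1, digArr s m p.2))
      (g := fun q : Dig s m × Dig s m => f (q.1 + q.2) q.2) Integrable.of_finite hmeas
  rw [integral_shiftMeasure hinteg]
  calc _ = 𝔼 u, 𝔼 y, f (u + y) y :=
        Finset.expect_congr rfl fun u _ => integral_cubeMeasure_digArr fun y => f (u + y) y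
    _ = 𝔼 y, 𝔼 u, f (u + y) y := Finset.expect_comm _ _ _
    _ = 𝔼 y, 𝔼 z, f z y :=
        Finset.expect_congr rfl fun y _ => expect_add_right (fun z => f z y) y
    _ = _ := Finset.expect_comm _ _ _

theorem measurable_disc {s m : ℕ} (g : (Fin m → ZMod 2) →+ Dig s m) (u : Dig s m) :
    Measurable (disc g u) := by
  unfold disc
  refine Measurable.sub (Finset.measurable_sum _ fun e _ => ?_) ?_
  · refine Measurable.ite ?_ measurable_const measurable_const
    simp only [Set.ofPred_forall]
    exact MeasurableSet.iInter fun i => measurableSet_lt measurable_const (measurable_pi_apply i)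
  · exact measurable_const.mul (Finset.measurable_prod _ fun i _ => measurable_pi_apply i)

theorem measurable_disc_prod {s m : ℕ} (g : (Fin m → ZMod 2) →+ Dig s m) :
    Measurable fun p : Dig s m × (Fin s → ℝ) => disc g p.1 p.2 :=
  measurable_from_prod_countable_right fun u => measurable_disc g u

theorem exists_equiv_bval (m : ℕ) : ∃ e : (Fin m → ZMod 2) ≃ Fin (2 ^ m),
    ∀ x, ((e x : ℕ) : ℝ) / 2 ^ m = bval x := by
  have h : ∀ x : Fin m → ZMod 2, ∃ K : Fin (2 ^ m), ((K : ℕ) : ℝ) / 2 ^ m = bval x := fun x => by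
    obtain ⟨K, hK⟩ := exists_bval_eq_div x
    have h1 := bval_lt_one x
    rw [hK, div_lt_one (by positivity)] at h1
    exact ⟨⟨K, by exact_mod_cast h1⟩, hK.symm⟩
  choose e he using h
  refine ⟨Equiv.ofBijective e ?_, he⟩
  rw [Fintype.bijective_iff_injective_and_card]
  refine ⟨fun x y hxy => bval_injective m ?_, by simp [ZMod.card]⟩
  rw [← he, ← he, hxy]

theorem sum_Qpt (s m : ℕ) (F : (Fin s → ℝ) → ℝ) :
    (2 : ℝ) ^ (-(s * m : ℤ)) * ∑ T : Fin s → Fin (2 ^ m), F (Qpt m T) =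
      𝔼 u : Dig s m, F fun i => bval (u i) := by
  obtain ⟨e, he⟩ := exists_equiv_bval m
  rw [Fintype.expect_eq_sum_div_card, card_dig,
    ← Equiv.sum_comp (Equiv.piCongrRight fun _ : Fin s => e) fun T => F (Qpt m T), zpow_neg,
    ← div_eq_inv_mul]
  have h : ∀ u : Dig s m, Qpt m (Equiv.piCongrRight (fun _ : Fin s => e) u) =
      fun i => bval (u i) := fun u => funext fun i => he (u i)
  simp only [h]
  push_cast
  norm_cast

theorem Dloc_eq_disc {s m : ℕ} (C : Fin s → Matrix (Fin m) (Fin m) (ZMod 2)) (u : Dig s m)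
    (Y : Fin s → ℝ) :
    Dloc (fun n : Fin (2 ^ m) => xorVec (netPoint m s C (n : ℕ)) fun i => bval (u i)) Y =
      disc (netHom m s C) u Y := by
  unfold Dloc disc
  have h : ∀ (n : Fin (2 ^ m)) i, xorVec (netPoint m s C (n : ℕ)) (fun i => bval (u i)) i =
      bval (netHom m s C (bitVec m n) i + u i) := fun n i => by
    rw [xorVec, netPoint_eq_bval, xorReal_bval]
  simp only [h, bval_nonneg, true_and]
  rw [sum_netHom m s C fun x => if ∀ i, bval (x i + u i) < Y i then (1 : ℝ) else 0]
  push_cast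
  rfl

theorem abs_disc_le {s m : ℕ} (g : (Fin m → ZMod 2) →+ Dig s m) (u : Dig s m) {Y : Fin s → ℝ}
    (hY : Y ∈ icoCube s) : |disc g u Y| ≤ 2 ^ m := by
  rw [mem_icoCube] at hY
  have h1 : (∑ e : Fin m → ZMod 2, if ∀ i, bval (g e i + u i) < Y i then (1 : ℝ) else 0) ≤ 2 ^ m := by
    refine (Finset.sum_le_card_nsmul _ _ 1 fun e _ => by split_ifs <;> norm_num).trans ?_
    simp [ZMod.card]
  have h2 : (0 : ℝ) ≤ ∑ e : Fin m → ZMod 2, if ∀ i, bval (g e i + u i) < Y i then (1 : ℝ) else 0 :=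
    Finset.sum_nonneg fun e _ => by split_ifs <;> norm_num
  have h3 : 0 ≤ ∏ i, Y i := Finset.prod_nonneg fun i _ => (hY i).1
  have h4 : ∏ i, Y i ≤ 1 := Finset.prod_le_one (fun i _ => (hY i).1) fun i _ => (hY i).2.le
  have h5 : (0 : ℝ) < 2 ^ m := by positivity
  rw [disc, abs_le]
  constructor <;> nlinarith

theorem ae_mem_icoCube (s m : ℕ) : ∀ᵐ p ∂shiftMeasure s m, p.2 ∈ icoCube s :=
  Measure.quasiMeasurePreserving_snd.ae
    (p := fun Y => Y ∈ icoCube s) (ae_restrict_mem (measurableSet_icoCube s))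

theorem Msp_two_eq {s m : ℕ} (C : Fin s → Matrix (Fin m) (Fin m) (ZMod 2)) :
    Msp s m 2 (fun n : Fin (2 ^ m) => netPoint m s C (n : ℕ)) =
      √(∫ p, disc (netHom m s C) p.1 p.2 ^ 2 ∂shiftMeasure s m) := by
  have hinteg : Integrable (fun p => disc (netHom m s C) p.1 p.2 ^ 2) (shiftMeasure s m) := by
    refine Integrable.of_bound ((measurable_disc_prod _).pow_const 2).aestronglyMeasurable
      ((2 ^ m) ^ 2) ?_
    filter_upwards [ae_mem_icoCube s m] with p hp
    rw [Real.norm_eq_abs, abs_pow]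
    gcongr
    exact abs_disc_le _ _ hp
  rw [integral_shiftMeasure hinteg, Real.sqrt_eq_rpow, Msp]
  have h := sum_Qpt s m fun X => ∫ Y in cube s,
    |Dloc (fun n : Fin (2 ^ m) => xorVec (netPoint m s C (n : ℕ)) X) Y| ^ (2 : ℝ)
  rw [h]
  congr 1
  refine Finset.expect_congr rfl fun u _ => ?_
  have hc : icoCube s =ᵐ[volume] cube s := by
    rw [icoCube, cube, Set.pi_univ_Icc]
    exact Measure.univ_pi_Ico_ae_eq_Icc
  rw [cubeMeasure, setIntegral_congr_set hc]
  simp only [Dloc_eq_disc, Real.rpow_two, sq_abs]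

theorem distribution_eq {s m : ℕ} (C : Fin s → Matrix (Fin m) (Fin m) (ZMod 2)) (M w : ℝ) :
    (2 : ℝ) ^ (-(s * m : ℤ)) * ∑ T : Fin s → Fin (2 ^ m),
      (volume {Y : Fin s → ℝ | (∀ i, Y i ∈ Set.Ico (0 : ℝ) 1) ∧
        Dloc (fun n : Fin (2 ^ m) => xorVec (netPoint m s C (n : ℕ)) (Qpt m T)) Y / M < w}).toReal =
    ((shiftMeasure s m).map fun p => disc (netHom m s C) p.1 p.2 / M).real (Set.Iio w) := by
  have hS : MeasurableSet
      ((fun p : Dig s m × (Fin s → ℝ) => disc (netHom m s C) p.1 p.2 / M) ⁻¹' Set.Iio w) :=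
    ((measurable_disc_prod _).div_const M) measurableSet_Iio
  have h := sum_Qpt s m fun X => (volume {Y : Fin s → ℝ | (∀ i, Y i ∈ Set.Ico (0 : ℝ) 1) ∧
        Dloc (fun n : Fin (2 ^ m) => xorVec (netPoint m s C (n : ℕ)) X) Y / M < w}).toReal
  rw [h, map_measureReal_apply ((measurable_disc_prod _).div_const M) measurableSet_Iio,
    ← integral_indicator_one hS, integral_shiftMeasure ((integrable_const 1).indicator hS)]
  refine Finset.expect_congr rfl fun u _ => ?_
  have hu : MeasurableSet {Y : Fin s → ℝ | disc (netHom m s C) u Y / M < w} :=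
    ((measurable_disc _ u).div_const M) measurableSet_Iio
  refine Eq.trans ?_ (integral_indicator_one hu).symm
  rw [measureReal_def, cubeMeasure, Measure.restrict_apply hu]
  congr 2
  ext Y
  rw [Set.mem_ofPred_eq, Set.mem_inter_iff, mem_icoCube, Dloc_eq_disc, and_comm]
  rfl

end NetCLT

namespace NetCLT

section Perturbation

variable {Ω : Type*} [MeasurableSpace Ω] {μ : Measure Ω} {D W : Ω → ℝ}

theorem norm_cexp_mul_I_sub_le (a b : ℝ) :
    ‖Complex.exp ((a : ℝ) * Complex.I) - Complex.exp ((b : ℝ) * Complex.I)‖ ≤ |a - b| := by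
  have h : Complex.exp ((a : ℝ) * Complex.I) - Complex.exp ((b : ℝ) * Complex.I) =
      Complex.exp ((b : ℝ) * Complex.I) * (Complex.exp (Complex.I * ((a - b : ℝ))) - 1) := by
    rw [mul_sub, mul_one, ← Complex.exp_add]
    congr 2
    push_cast
    ring
  rw [h, norm_mul, Complex.norm_exp_ofReal_mul_I, one_mul]
  exact Real.norm_exp_I_mul_ofReal_sub_one_le

theorem integral_abs_le [IsProbabilityMeasure μ] {f : Ω → ℝ} (hf : MemLp f 2 μ) {M : ℝ} (hM : 0 < M)
    (h : ∫ x, f x ^ 2 ∂μ ≤ M ^ 2) : ∫ x, |f x| ∂μ ≤ M := by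
  have h1 : ∫ x, |f x| ∂μ ≤ ∫ x, (M / 2 + (2 * M)⁻¹ * f x ^ 2) ∂μ := by
    refine integral_mono (hf.integrable one_le_two).abs
      ((integrable_const _).add (hf.integrable_sq.const_mul _)) fun x => ?_
    have h2 : M / 2 + (2 * M)⁻¹ * f x ^ 2 - |f x| = (2 * M)⁻¹ * (M - |f x|) ^ 2 := by
      have := sq_abs (f x)
      field_simp
      linear_combination -this
    have : 0 ≤ (2 * M)⁻¹ * (M - |f x|) ^ 2 := by positivity
    linarith
  rw [integral_add (integrable_const _) (hf.integrable_sq.const_mul _), integral_const_mul,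
    integral_const, probReal_univ, one_smul] at h1
  have h3 : (2 * M)⁻¹ * ∫ x, f x ^ 2 ∂μ ≤ (2 * M)⁻¹ * M ^ 2 := by gcongr
  have h4 : (2 * M)⁻¹ * M ^ 2 = M / 2 := by field_simp
  linarith

theorem abs_sqrt_integral_sq_sub_le (hD : MemLp D 2 μ) (hW : MemLp W 2 μ) {τ ρ : ℝ} (hρ : 0 < ρ)
    (hτ : ρ < τ) (hWτ : ∫ x, W x ^ 2 ∂μ = τ ^ 2) (hR : ∫ x, (D x - W x) ^ 2 ∂μ ≤ ρ ^ 2) :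
    |√(∫ x, D x ^ 2 ∂μ) - τ| ≤ ρ := by
  have hτ0 : 0 < τ := hρ.trans hτ
  have hR2 : MemLp (fun x => D x - W x) 2 μ := hD.sub hW
  have hnn : 0 ≤ ∫ x, (D x - W x) ^ 2 ∂μ := integral_nonneg fun x => sq_nonneg _
  have hlin : ∀ a b : ℝ, ∫ x, (a * W x ^ 2 + b * (D x - W x) ^ 2) ∂μ =
      a * τ ^ 2 + b * ∫ x, (D x - W x) ^ 2 ∂μ := fun a b => by
    rw [integral_add (hW.integrable_sq.const_mul _) (hR2.integrable_sq.const_mul _),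
      integral_const_mul, integral_const_mul, hWτ]
  have hi : ∀ a b : ℝ, Integrable (fun x => a * W x ^ 2 + b * (D x - W x) ^ 2) μ := fun a b =>
    (hW.integrable_sq.const_mul _).add (hR2.integrable_sq.const_mul _)
  have hup : ∫ x, D x ^ 2 ∂μ ≤ (τ + ρ) ^ 2 := by
    have h1 : ∫ x, D x ^ 2 ∂μ ≤
        ∫ x, ((1 + ρ / τ) * W x ^ 2 + (1 + τ / ρ) * (D x - W x) ^ 2) ∂μ := by
      refine integral_mono hD.integrable_sq (hi _ _) fun x => ?_
      have h2 : (1 + ρ / τ) * W x ^ 2 + (1 + τ / ρ) * (D x - W x) ^ 2 - D x ^ 2 =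
          (ρ * W x - τ * (D x - W x)) ^ 2 / (τ * ρ) := by
        field_simp
        ring
      have : 0 ≤ (ρ * W x - τ * (D x - W x)) ^ 2 / (τ * ρ) := by positivity
      linarith
    rw [hlin] at h1
    have h3 : (1 + τ / ρ) * ∫ x, (D x - W x) ^ 2 ∂μ ≤ (1 + τ / ρ) * ρ ^ 2 := by gcongr
    have h4 : (1 + ρ / τ) * τ ^ 2 + (1 + τ / ρ) * ρ ^ 2 = (τ + ρ) ^ 2 := by
      field_simp
      ring
    linarith
  have hlow : (τ - ρ) ^ 2 ≤ ∫ x, D x ^ 2 ∂μ := by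
    have h1 : ∫ x, ((1 - ρ / τ) * W x ^ 2 + (1 - τ / ρ) * (D x - W x) ^ 2) ∂μ ≤
        ∫ x, D x ^ 2 ∂μ := by
      refine integral_mono (hi _ _) hD.integrable_sq fun x => ?_
      have h2 : D x ^ 2 - ((1 - ρ / τ) * W x ^ 2 + (1 - τ / ρ) * (D x - W x) ^ 2) =
          (ρ * W x + τ * (D x - W x)) ^ 2 / (τ * ρ) := by
        field_simp
        ring
      have : 0 ≤ (ρ * W x + τ * (D x - W x)) ^ 2 / (τ * ρ) := by positivity
      dsimp only
      linarith
    rw [hlin] at h1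
    have h0 : 1 - τ / ρ ≤ 0 := by rw [sub_nonpos, le_div_iff₀ hρ]; linarith
    have h3 : (1 - τ / ρ) * ρ ^ 2 ≤ (1 - τ / ρ) * ∫ x, (D x - W x) ^ 2 ∂μ :=
      mul_le_mul_of_nonpos_left hR h0
    have h4 : (1 - ρ / τ) * τ ^ 2 + (1 - τ / ρ) * ρ ^ 2 = (τ - ρ) ^ 2 := by
      field_simp
      ring
    linarith
  rw [abs_le]
  constructor
  · linarith [Real.le_sqrt_of_sq_le hlow]
  · linarith [Real.sqrt_le_sqrt hup, Real.sqrt_sq (show 0 ≤ τ + ρ by linarith)]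

/-- Stability of the characteristic function of a normalized variable under `L²` perturbation. -/
theorem norm_integral_cexp_sub_le [IsProbabilityMeasure μ] (hD : MemLp D 2 μ) (hW : MemLp W 2 μ)
    {τ ρ : ℝ} (hρ : 0 < ρ)   (hτ : ρ < τ) (hWτ : ∫ x, W x ^ 2 ∂μ = τ ^ 2) (hR : ∫ x, (D x - W x) ^ 2 ∂μ ≤ ρ ^ 2) (θ : ℝ) :
    ‖(∫ x, Complex.exp ((θ * (D x / √(∫ x, D x ^ 2 ∂μ)) : ℝ) * Complex.I) ∂μ) -
      ∫ x, Complex.exp ((θ * (W x / τ) : ℝ) * Complex.I) ∂μ‖ ≤ |θ| * (2 * (ρ / τ)) := by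
  have hτ0 : 0 < τ := hρ.trans hτ
  have hM := abs_sqrt_integral_sq_sub_le hD hW hρ hτ hWτ hR
  set M := √(∫ x, D x ^ 2 ∂μ) with hMdef
  have hM0 : 0 < M := by linarith [(abs_le.1 hM).1]
  have hM2 : ∫ x, D x ^ 2 ∂μ = M ^ 2 :=
    (Real.sq_sqrt (integral_nonneg fun x => sq_nonneg _)).symm
  have hR2 : MemLp (fun x => D x - W x) 2 μ := hD.sub hW
  have hexp : ∀ f : Ω → ℝ, AEMeasurable f μ →
      Integrable (fun x => Complex.exp ((f x : ℝ) * Complex.I)) μ := fun f hf =>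
    Integrable.of_bound (C := 1)
      ((Complex.continuous_exp.comp (Complex.continuous_ofReal.mul
        continuous_const)).comp_aestronglyMeasurable hf.aestronglyMeasurable)
      (ae_of_all _ fun x => (Complex.norm_exp_ofReal_mul_I _).le)
  have hDm := hD.aestronglyMeasurable.aemeasurable
  have hWm := hW.aestronglyMeasurable.aemeasurable
  rw [← integral_sub (hexp _ ((hDm.div_const M).const_mul θ))
    (hexp _ ((hWm.div_const τ).const_mul θ))]
  refine (norm_integral_le_integral_norm _).trans ?_
  have hinteg := ((hD.integrable one_le_two).abs.const_mul (ρ / (M * τ))).add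
    ((hR2.integrable one_le_two).abs.const_mul τ⁻¹)
  have hpt : ∀ x, ‖Complex.exp ((θ * (D x / M) : ℝ) * Complex.I) -
      Complex.exp ((θ * (W x / τ) : ℝ) * Complex.I)‖ ≤
      |θ| * (ρ / (M * τ) * |D x| + τ⁻¹ * |D x - W x|) := fun x => by
    refine (norm_cexp_mul_I_sub_le _ _).trans ?_
    rw [← mul_sub, abs_mul]
    gcongr
    have h1 : D x / M - W x / τ = (τ - M) / (M * τ) * D x + τ⁻¹ * (D x - W x) := by
      field_simp
      ring
    rw [h1]
    refine (abs_add_le _ _).trans ?_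
    rw [abs_mul, abs_mul, abs_div, abs_of_pos (mul_pos hM0 hτ0), abs_of_pos (inv_pos.2 hτ0),
      abs_sub_comm τ]
    gcongr
  refine (integral_mono_of_nonneg (ae_of_all _ fun x => norm_nonneg _) (hinteg.const_mul |θ|)
    (ae_of_all _ hpt)).trans ?_
  have e := integral_add ((hD.integrable one_le_two).abs.const_mul (ρ / (M * τ)))
    ((hR2.integrable one_le_two).abs.const_mul τ⁻¹)
  simp only [Pi.add_apply]
  rw [integral_const_mul, e, integral_const_mul, integral_const_mul]
  gcongr
  have h1 : ρ / (M * τ) * ∫ x, |D x| ∂μ ≤ ρ / (M * τ) * M := by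
    gcongr
    exact integral_abs_le hD hM0 hM2.le
  have h2 : τ⁻¹ * ∫ x, |D x - W x| ∂μ ≤ τ⁻¹ * ρ := by
    gcongr
    exact integral_abs_le hR2 hρ hR
  have h3 : ρ / (M * τ) * M + τ⁻¹ * ρ = 2 * (ρ / τ) := by
    field_simp
    ring
  linarith

end Perturbation

end NetCLT

namespace NetCLT

/-- The excess of the index sums entering the main part of the discrepancy. -/
def cutoff (m : ℕ) : ℕ := 2 * Nat.clog 2 (m + 1)

/-- The rate controlling all error terms. -/
def rate (r m t : ℕ) : ℝ := (2 ^ t) ^ 4 * ((t + cutoff m : ℕ) : ℝ) ^ (2 * r + 3) / (m + 1)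

/-- The constant in the lower bound for the variance. -/
def varConst (r : ℕ) : ℝ := (1 / 2 ^ (r + 1)) ^ 2 / 4 / (2 * (r + 1)) ^ r

/-- The constant in the bounds for the numbers of interacting indices. -/
def countConst (r : ℕ) : ℕ := (r + 1) * 3 ^ (r + 1) + 1

theorem varConst_pos (r : ℕ) : 0 < varConst r := by unfold varConst; positivity

theorem two_le_cutoff {m : ℕ} (hm : 1 ≤ m) : 2 ≤ cutoff m := by
  have : 0 < Nat.clog 2 (m + 1) := Nat.clog_pos (by norm_num) (by omega)
  unfold cutoff
  omega

theorem sq_le_two_pow_cutoff (m : ℕ) : ((m : ℝ) + 1) ^ 2 ≤ 2 ^ cutoff m := by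
  have h : m + 1 ≤ 2 ^ Nat.clog 2 (m + 1) := Nat.le_pow_clog (by norm_num) _
  rw [cutoff, mul_comm, pow_mul]
  gcongr
  exact_mod_cast h

theorem rate_pos {r m t : ℕ} (hm : 1 ≤ m) : 0 < rate r m t := by
  have := two_le_cutoff hm
  have : (0 : ℝ) < ((t + cutoff m : ℕ) : ℝ) := by
    exact_mod_cast (by omega : 0 < t + cutoff m)
  unfold rate
  positivity

section Digital

variable {r m t : ℕ} {g : (Fin m → ZMod 2) →+ Dig (r + 1) m}

theorem varConst_mul_le_mainVar (hr : 1 ≤ r) (hm : 2 * r + 1 ≤ m) :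
    varConst r * (m + 1) ^ r ≤ mainVar t (cutoff m) g := by
  refine le_trans ?_ (mainVar_ge hr (two_le_cutoff (by omega)))
  have h : m + 1 ≤ (2 * (r + 1)) * (m / (r + 1)) := by
    have h1 := Nat.div_add_mod m (r + 1)
    have h2 := Nat.mod_lt m (show 0 < r + 1 by omega)
    rw [mul_assoc]
    omega
  have h' : ((m : ℝ) + 1) ≤ (2 * (r + 1)) * (m / (r + 1) : ℕ) := by exact_mod_cast h
  calc varConst r * (m + 1) ^ r ≤ varConst r * ((2 * (r + 1)) * (m / (r + 1) : ℕ)) ^ r := by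
        have := varConst_pos r
        gcongr
    _ = _ := by
        rw [varConst, mul_pow (2 * ((r : ℝ) + 1)), ← mul_assoc, div_mul_cancel₀ _ (by positivity)]

theorem card_le_countConst (hr : 1 ≤ r) (hm : 1 ≤ m) :
    (quads (mainSet r m t (cutoff m))).card + (leadPairs (mainSet r m t (cutoff m))).card ≤
      countConst r * ((m + 1) ^ (2 * r - 1) * (t + cutoff m) ^ (2 * r + 3)) ∧
    (overlapPairs r m t (cutoff m)).card ≤
      countConst r * ((m + 1) ^ (2 * r - 1) * (t + cutoff m) ^ (2 * r + 3)) := by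
  have hw1 : 1 ≤ t + cutoff m := by have := two_le_cutoff hm; omega
  have hwin := inWindow_mainSet (r := r) (m := m) (t := t) (L := cutoff m)
  obtain ⟨k, rfl⟩ : ∃ k, r = k + 1 := ⟨r - 1, by omega⟩
  have h1 := card_quads_le hwin
  have h2 := card_pairs_le hwin (i := Fin.last (k + 1)) (Fin.last_pos.ne')
  have h3 := card_overlap_le hwin
  generalize t + cutoff m = w at *
  rw [Nat.add_sub_cancel] at h1 h2
  have e : 2 * (k + 1) - 1 = 2 * k + 1 := by omega
  rw [e]
  have hp : ∀ a b : ℕ, a ≤ b → w ^ a ≤ w ^ b := fun a b h => Nat.pow_le_pow_right hw1 h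
  constructor
  · calc _ ≤ ((k + 1 + 1) * 3 ^ (k + 1 + 1)) * (((m + 1) ^ (k + 1) * w) * ((m + 1) ^ k * (w * w))) +
          ((m + 1) ^ (k + 1) * w) * ((m + 1) ^ k * w) := add_le_add h1 h2
      _ = ((k + 1 + 1) * 3 ^ (k + 1 + 1)) * ((m + 1) ^ (2 * k + 1) * w ^ 3) +
          (m + 1) ^ (2 * k + 1) * w ^ 2 := by ring
      _ ≤ ((k + 1 + 1) * 3 ^ (k + 1 + 1)) * ((m + 1) ^ (2 * k + 1) * w ^ (2 * (k + 1) + 3)) +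
          (m + 1) ^ (2 * k + 1) * w ^ (2 * (k + 1) + 3) := by
          gcongr 1
          · gcongr 2
            exact hp _ _ (by omega)
          · gcongr 1
            exact hp _ _ (by omega)
      _ = _ := by rw [countConst]; ring
  · calc _ ≤ (m + 1) ^ (k + 1) * w * (w ^ (k + 1 + 1) * w ^ (k + 1 + 1)) := h3
      _ = 1 * ((m + 1) ^ (k + 1) * w ^ (2 * (k + 1) + 3)) := by ring
      _ ≤ _ := by
          refine Nat.mul_le_mul (by unfold countConst; omega) (Nat.mul_le_mul_right _ ?_)
          exact Nat.pow_le_pow_right (by omega) (by omega)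

theorem pow_four_mul_card_le (hr : 1 ≤ r) {τ : ℝ}
    (hτ2 : varConst r * (m + 1) ^ r ≤ τ ^ 2) {q : ℕ}
    (hq : q ≤ countConst r * ((m + 1) ^ (2 * r - 1) * (t + cutoff m) ^ (2 * r + 3))) :
    (2 ^ t / τ) ^ 4 * (q : ℝ) ≤ countConst r / varConst r ^ 2 * rate r m t := by
  have hc := varConst_pos r
  have hm0 : (0 : ℝ) < (m : ℝ) + 1 := by positivity
  have hq' : (q : ℝ) ≤ countConst r *
      (((m : ℝ) + 1) ^ (2 * r - 1) * ((t + cutoff m : ℕ) : ℝ) ^ (2 * r + 3)) := by exact_mod_cast hq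
  have h4 : (varConst r * ((m : ℝ) + 1) ^ r) ^ 2 ≤ τ ^ 4 := by
    calc _ ≤ (τ ^ 2) ^ 2 := by gcongr
      _ = _ := by ring
  have e : ((m : ℝ) + 1) ^ (2 * r - 1) * ((m : ℝ) + 1) = (((m : ℝ) + 1) ^ r) ^ 2 := by
    rw [← pow_succ, ← pow_mul]
    congr 1
    omega
  rw [div_pow]
  calc (2 ^ t) ^ 4 / τ ^ 4 * (q : ℝ) ≤ (2 ^ t) ^ 4 / (varConst r * ((m : ℝ) + 1) ^ r) ^ 2 *
        (countConst r * (((m : ℝ) + 1) ^ (2 * r - 1) * ((t + cutoff m : ℕ) : ℝ) ^ (2 * r + 3))) := by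
        gcongr
    _ = _ := by
        rw [mul_pow, ← e, rate]
        field_simp

/-- The main part of the discrepancy as a function of the shift and the point. -/
def mainVal (t : ℕ) (g : (Fin m → ZMod 2) →+ Dig (r + 1) m)
    (p : Dig (r + 1) m × (Fin (r + 1) → ℝ)) : ℝ :=
  mainPart t (cutoff m) g (p.1 + digArr (r + 1) m p.2) (digArr (r + 1) m p.2)

theorem measurable_comp_digArr {s m : ℕ} (f : Dig s m → Dig s m → ℝ) :
    Measurable fun p : Dig s m × (Fin s → ℝ) => f (p.1 + digArr s m p.2) (digArr s m p.2) :=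
  (measurable_of_countable fun q : Dig s m × Dig s m => f (q.1 + q.2) q.2).comp
    (measurable_fst.prodMk ((measurable_digArr s m).comp measurable_snd))

theorem memLp_comp_digArr {s m : ℕ} (f : Dig s m → Dig s m → ℝ) :
    MemLp (fun p : Dig s m × (Fin s → ℝ) => f (p.1 + digArr s m p.2) (digArr s m p.2)) 2
      (shiftMeasure s m) := by
  refine MemLp.of_bound (measurable_comp_digArr f).aestronglyMeasurable (∑ z, ∑ y, |f z y|)
    (ae_of_all _ fun p => ?_)
  rw [Real.norm_eq_abs]
  exact (Finset.single_le_sum (f := fun y => |f (p.1 + digArr s m p.2) y|)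
    (fun y _ => abs_nonneg _) (Finset.mem_univ _)).trans
    (Finset.single_le_sum (f := fun z => ∑ y, |f z y|)
      (fun z _ => Finset.sum_nonneg fun y _ => abs_nonneg _) (Finset.mem_univ _))

theorem memLp_disc {s m : ℕ} (g : (Fin m → ZMod 2) →+ Dig s m) :
    MemLp (fun p => disc g p.1 p.2) 2 (shiftMeasure s m) := by
  refine MemLp.of_bound (measurable_disc_prod g).aestronglyMeasurable (2 ^ m) ?_
  filter_upwards [ae_mem_icoCube s m] with p hp
  exact abs_disc_le _ _ hp

theorem integral_sq_disc_sub_mainVal_le (hg : IsDigNet t g) (hr : 1 ≤ r) :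
    ∫ p, (disc g p.1 p.2 - mainVal t g p) ^ 2 ∂shiftMeasure (r + 1) m ≤
      2 * ((r + 1 : ℕ) * 2 ^ t + (r + 1 : ℕ)) ^ 2 +
        2 * ((m + 1) ^ (r + 1) * (2 ^ t / 2 ^ cutoff m) +
          ((m + 1) ^ (r - 1) * (t + cutoff m) : ℕ) * (2 ^ t) ^ 2) := by
  set f : Dig (r + 1) m → Dig (r + 1) m → ℝ := fun z y =>
    ∑ A ∈ indexBox (r + 1) m, coef g A z * radA A y - mainPart t (cutoff m) g z y with hf
  have hL := memLp_comp_digArr f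
  have hpt : ∀ᵐ p ∂shiftMeasure (r + 1) m, (disc g p.1 p.2 - mainVal t g p) ^ 2 ≤
      2 * ((r + 1 : ℕ) * 2 ^ t + (r + 1 : ℕ)) ^ 2 +
        2 * f (p.1 + digArr (r + 1) m p.2) (digArr (r + 1) m p.2) ^ 2 := by
    filter_upwards [ae_mem_icoCube (r + 1) m] with p hp
    have h1 := abs_disc_sub_discDig_le hg p.1 (mem_icoCube.1 hp)
    have h2 : disc g p.1 p.2 - mainVal t g p =
        (disc g p.1 p.2 - discDig g p.1 fun i => digB m (p.2 i)) +
          f (p.1 + digArr (r + 1) m p.2) (digArr (r + 1) m p.2) := by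
      rw [discDig_eq, mainVal, hf]
      change _ = _ - ∑ A ∈ _, coef g A (p.1 + digArr (r + 1) m p.2) * radA A (digArr (r + 1) m p.2) + _
      ring
    have h3 := sq_le_sq' (abs_le.1 h1).1 (abs_le.1 h1).2
    rw [h2]
    nlinarith [sq_nonneg ((disc g p.1 p.2 - discDig g p.1 fun i => digB m (p.2 i)) -
      f (p.1 + digArr (r + 1) m p.2) (digArr (r + 1) m p.2))]
  refine (integral_mono_of_nonneg (ae_of_all _ fun p => sq_nonneg _)
    ((integrable_const _).add (hL.integrable_sq.const_mul 2)) hpt).trans ?_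
  have e := integral_add (μ := shiftMeasure (r + 1) m)
    (integrable_const (2 * ((r + 1 : ℕ) * 2 ^ t + (r + 1 : ℕ)) ^ 2 : ℝ))
    (hL.integrable_sq.const_mul 2)
  simp only [Pi.add_apply]
  rw [e, integral_const, probReal_univ, one_smul, integral_const_mul,
    integral_shiftMeasure_digArr fun z y => f z y ^ 2]
  gcongr
  exact expect_sq_remainder_le hg hr

theorem integral_sq_disc_sub_mainVal_le_rate (hg : IsDigNet t g) (hr : 1 ≤ r) (hm : 1 ≤ m) {τ : ℝ}
    (hτ2 : varConst r * (m + 1) ^ r ≤ τ ^ 2) :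
    ∫ p, (disc g p.1 p.2 - mainVal t g p) ^ 2 ∂shiftMeasure (r + 1) m ≤
      (8 * (r + 1) ^ 2 + 4) / varConst r * rate r m t * τ ^ 2 := by
  refine (integral_sq_disc_sub_mainVal_le hg hr).trans ?_
  have hw1 : 1 ≤ t + cutoff m := by have := two_le_cutoff hm; omega
  have hw : (1 : ℝ) ≤ ((t + cutoff m : ℕ) : ℝ) := by exact_mod_cast hw1
  have hcut := sq_le_two_pow_cutoff m
  have hc := varConst_pos r
  have hrate := rate_pos (r := r) (t := t) hm
  obtain ⟨k, rfl⟩ : ∃ k, r = k + 1 := ⟨r - 1, by omega⟩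
  rw [Nat.add_sub_cancel]
  have hX : (1 : ℝ) ≤ 2 ^ t := one_le_pow₀ (by norm_num)
  have hn : (1 : ℝ) ≤ (m : ℝ) + 1 := by linarith [(Nat.cast_nonneg m : (0 : ℝ) ≤ m)]
  set w : ℝ := ((t + cutoff m : ℕ) : ℝ) with hwdef
  set X : ℝ := 2 ^ t with hXdef
  set n : ℝ := (m : ℝ) + 1 with hndef
  set U : ℝ := n ^ k * (X ^ 4 * w ^ (2 * (k + 1) + 3)) with hU
  have hnk : 1 ≤ n ^ k := one_le_pow₀ hn
  have hXw : X ^ 2 * w ≤ X ^ 4 * w ^ (2 * (k + 1) + 3) :=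
    mul_le_mul (pow_le_pow_right₀ hX (by norm_num)) (le_self_pow₀ hw (by omega)) (by linarith)
      (by positivity)
  have hX2 : X ^ 2 ≤ X ^ 2 * w := le_mul_of_one_le_right (by positivity) hw
  have h1 : X ^ 2 ≤ U := by
    refine (hX2.trans hXw).trans ?_
    exact le_mul_of_one_le_left (by positivity) hnk
  have h2 : n ^ (k + 1 + 1) * (X / 2 ^ cutoff m) ≤ U := by
    calc n ^ (k + 1 + 1) * (X / 2 ^ cutoff m) ≤ n ^ (k + 1 + 1) * (X / n ^ 2) := by gcongr
      _ = n ^ k * X := by field_simp; ring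
      _ ≤ n ^ k * X ^ 2 := by gcongr; exact le_self_pow₀ hX (by norm_num)
      _ ≤ U := by rw [hU]; gcongr; exact hX2.trans hXw
  have h3 : (((m + 1) ^ k * (t + cutoff m) : ℕ) : ℝ) * X ^ 2 ≤ U := by
    have : (((m + 1) ^ k * (t + cutoff m) : ℕ) : ℝ) = n ^ k * w := by
      rw [hwdef, hndef]
      push_cast
      ring
    rw [this, hU, mul_assoc, mul_comm w]
    gcongr
  have h4 : (((k + 1 + 1 : ℕ) : ℝ) * X + (k + 1 + 1 : ℕ)) ^ 2 ≤ 4 * ((k + 1 : ℕ) + 1) ^ 2 * X ^ 2 := by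
    calc (((k + 1 + 1 : ℕ) : ℝ) * X + (k + 1 + 1 : ℕ)) ^ 2
        ≤ (((k + 1 + 1 : ℕ) : ℝ) * X + (k + 1 + 1 : ℕ) * X) ^ 2 := by
          gcongr
          exact le_mul_of_one_le_right (by positivity) hX
      _ = _ := by push_cast; ring
  have h5 : U ≤ rate (k + 1) m t / varConst (k + 1) * τ ^ 2 := by
    calc U = rate (k + 1) m t / varConst (k + 1) * (varConst (k + 1) * n ^ (k + 1)) := by
          rw [hU, rate]
          field_simp
          ring
      _ ≤ _ := by gcongr
  have h6 : 4 * (((k + 1 : ℕ) : ℝ) + 1) ^ 2 * X ^ 2 ≤ 4 * ((k + 1 : ℕ) + 1) ^ 2 * U := by gcongr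
  calc _ ≤ (8 * (((k + 1 : ℕ) : ℝ) + 1) ^ 2 + 4) * U := by linarith
    _ ≤ (8 * (((k + 1 : ℕ) : ℝ) + 1) ^ 2 + 4) * (rate (k + 1) m t / varConst (k + 1) * τ ^ 2) := by
        gcongr
    _ = _ := by ring

/-- Quantitative Gaussian approximation for the normalized discrepancy. -/
theorem norm_integral_cexp_disc_sub_le (hg : IsDigNet t g) (hr : 1 ≤ r) (hm : 2 * r + 1 ≤ m)
    (hsmall : (8 * (r + 1) ^ 2 + 4) / varConst r * rate r m t < 1) (θ : ℝ) :
    ‖(∫ p, Complex.exp ((θ * (disc g p.1 p.2 /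
        √(∫ p, disc g p.1 p.2 ^ 2 ∂shiftMeasure (r + 1) m)) : ℝ) * Complex.I)
          ∂shiftMeasure (r + 1) m) - (Real.exp (-θ ^ 2 / 2) : ℝ)‖ ≤
      |θ| * (2 * √((8 * (r + 1) ^ 2 + 4) / varConst r * rate r m t)) +
        (2 * θ ^ 4 * (countConst r / varConst r ^ 2 * rate r m t) +
        θ ^ 2 / 2 * (√(countConst r / varConst r ^ 2 * rate r m t) +
          √(countConst r / varConst r ^ 2 * rate r m t))) := by
  have hm1 : 1 ≤ m := by omega
  have hc := varConst_pos r
  have hrate := rate_pos (r := r) (t := t) hm1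
  have hvar := varConst_mul_le_mainVar (t := t) (g := g) hr hm
  have hvar0 : 0 < mainVar t (cutoff m) g := lt_of_lt_of_le (by positivity) hvar
  set τ := √(mainVar t (cutoff m) g) with hτdef
  have hτ : 0 < τ := Real.sqrt_pos.2 hvar0
  have hτ2 : τ ^ 2 = mainVar t (cutoff m) g := Real.sq_sqrt hvar0.le
  have hvarτ : varConst r * (m + 1) ^ r ≤ τ ^ 2 := hτ2 ▸ hvar
  set a := (8 * ((r : ℝ) + 1) ^ 2 + 4) / varConst r * rate r m t with ha
  have ha0 : 0 < a := by positivity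
  have hsq : √a < 1 := by rw [Real.sqrt_lt' one_pos]; simpa using hsmall
  have h1 := norm_integral_cexp_sub_le (memLp_disc g)
    (memLp_comp_digArr fun z y => mainPart t (cutoff m) g z y) (τ := τ) (ρ := √a * τ)
    (mul_pos (Real.sqrt_pos.2 ha0) hτ) (by nlinarith)
    (by rw [integral_shiftMeasure_digArr fun z y => mainPart t (cutoff m) g z y ^ 2,
      expect_sq_mainPart, hτ2])
    (by
      rw [mul_pow, Real.sq_sqrt ha0.le]
      exact integral_sq_disc_sub_mainVal_le_rate hg hr hm1 hvarτ) θ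
  rw [mul_div_assoc, div_self hτ.ne', mul_one, integral_shiftMeasure_digArr fun z y =>
    Complex.exp ((θ * (mainPart t (cutoff m) g z y / τ) : ℝ) * Complex.I)] at h1
  obtain ⟨hb1, hb2⟩ := card_le_countConst (t := t) hr hm1
  have h2 := norm_expect_cexp_mainPart_sub_le hg hτ hτ2 θ
  refine (norm_sub_le_norm_sub_add_norm_sub _ _ _).trans (add_le_add h1 (h2.trans ?_))
  exact add_le_add (mul_le_mul_of_nonneg_left (pow_four_mul_card_le hr hvarτ hb1) (by positivity))
    (mul_le_mul_of_nonneg_left (add_le_add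
      (Real.sqrt_le_sqrt (pow_four_mul_card_le hr hvarτ ((Nat.le_add_right _ _).trans hb1)))
      (Real.sqrt_le_sqrt (pow_four_mul_card_le hr hvarτ hb2))) (by positivity))

end Digital

end NetCLT

namespace NetCLT

theorem le_of_le_logb_div {t m : ℕ} (ht : (t : ℝ) ≤ Real.logb 2 m / 10) : t ≤ m := by
  have h : Real.logb 2 m ≤ m := by
    rcases Nat.eq_zero_or_pos m with rfl | hm
    · simp
    rw [Real.logb_le_iff_le_rpow (by norm_num) (by exact_mod_cast hm), Real.rpow_natCast]
    exact_mod_cast Nat.lt_two_pow_self.le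
  have hm : (0 : ℝ) ≤ m := Nat.cast_nonneg m
  exact_mod_cast (by linarith : (t : ℝ) ≤ m)

theorem two_pow_pow_four_le {t m : ℕ} (hm : 1 ≤ m) (ht : (t : ℝ) ≤ Real.logb 2 m / 10) :
    ((2 : ℝ) ^ t) ^ 4 ≤ ((m + 1 : ℕ) : ℝ) ^ (2 / 5 : ℝ) := by
  have hm0 : (0 : ℝ) < m := by exact_mod_cast hm
  calc ((2 : ℝ) ^ t) ^ 4 = (2 : ℝ) ^ ((t : ℝ) * 4) := by
        rw [← pow_mul, ← Real.rpow_natCast]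
        push_cast
        rfl
    _ ≤ (2 : ℝ) ^ (Real.logb 2 m * (2 / 5)) :=
        Real.rpow_le_rpow_of_exponent_le one_le_two (by linarith)
    _ = (m : ℝ) ^ (2 / 5 : ℝ) := by
        rw [Real.rpow_mul zero_le_two, Real.rpow_logb two_pos (by norm_num) hm0]
    _ ≤ _ := by
        gcongr
        omega

theorem add_cutoff_le {t m : ℕ} (hm : 1 ≤ m) (ht : (t : ℝ) ≤ Real.logb 2 m / 10) :
    ((t + cutoff m : ℕ) : ℝ) ≤ 5 / Real.log 2 * Real.log ((m + 1 : ℕ) : ℝ) := by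
  have hm0 : (0 : ℝ) < m := by exact_mod_cast hm
  have h1 : (1 : ℝ) ≤ Real.logb 2 ((m + 1 : ℕ) : ℝ) := by
    rw [Real.le_logb_iff_rpow_le (by norm_num) (by positivity), Real.rpow_one]
    exact_mod_cast Nat.succ_le_succ hm
  have h2 : (Nat.clog 2 (m + 1) : ℝ) ≤ Real.logb 2 ((m + 1 : ℕ) : ℝ) + 1 := by
    rw [← Real.natCeil_logb_natCast]
    exact_mod_cast (Nat.ceil_lt_add_one (zero_le_one.trans h1)).le
  have h3 : Real.logb 2 m ≤ Real.logb 2 ((m + 1 : ℕ) : ℝ) :=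
    Real.logb_le_logb_of_le (by norm_num) hm0 (by exact_mod_cast Nat.le_succ m)
  have h4 : 5 / Real.log 2 * Real.log ((m + 1 : ℕ) : ℝ) = 5 * Real.logb 2 ((m + 1 : ℕ) : ℝ) := by
    rw [Real.logb]
    ring
  rw [h4, cutoff]
  push_cast at *
  linarith

theorem tendsto_rate {t : ℕ → ℕ} (ht : ∀ m, (t m : ℝ) ≤ Real.logb 2 m / 10) (r : ℕ) :
    Tendsto (fun m => rate r m (t m)) atTop (nhds 0) := by
  have hx : Tendsto (fun m : ℕ => ((m + 1 : ℕ) : ℝ)) atTop atTop :=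
    tendsto_natCast_atTop_atTop.comp (tendsto_add_atTop_nat 1)
  have hlim := ((isLittleO_log_rpow_rpow_atTop ((2 * r + 3 : ℕ) : ℝ)
    (by norm_num : (0 : ℝ) < 3 / 5)).tendsto_div_nhds_zero.comp hx).const_mul
      ((5 / Real.log 2) ^ (2 * r + 3))
  rw [mul_zero] at hlim
  refine tendsto_of_tendsto_of_tendsto_of_le_of_le' tendsto_const_nhds hlim ?_ ?_
  · filter_upwards [eventually_ge_atTop 1] with m hm using (rate_pos hm).le
  · filter_upwards [eventually_ge_atTop 1] with m hm
    have hm0 : (0 : ℝ) < ((m + 1 : ℕ) : ℝ) := by positivity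
    have hlog : 0 ≤ Real.log 2 := Real.log_nonneg one_le_two
    have hsplit : ((m + 1 : ℕ) : ℝ) =
        ((m + 1 : ℕ) : ℝ) ^ (2 / 5 : ℝ) * ((m + 1 : ℕ) : ℝ) ^ (3 / 5 : ℝ) := by
      rw [← Real.rpow_add hm0]
      norm_num
    calc rate r m (t m) ≤ ((m + 1 : ℕ) : ℝ) ^ (2 / 5 : ℝ) *
          (5 / Real.log 2 * Real.log ((m + 1 : ℕ) : ℝ)) ^ (2 * r + 3) / ((m + 1 : ℕ) : ℝ) := by
          rw [rate, ← Nat.cast_succ]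
          gcongr
          · exact two_pow_pow_four_le hm (ht m)
          · exact add_cutoff_le hm (ht m)
      _ = _ := by
          simp only [Function.comp_apply, Real.rpow_natCast]
          generalize ((m + 1 : ℕ) : ℝ) = x at hm0 hsplit
          have h1 : 0 < x ^ (2 / 5 : ℝ) := by positivity
          have h2 : 0 < x ^ (3 / 5 : ℝ) := by positivity
          nth_rewrite 3 [hsplit]
          rw [mul_pow]
          field_simp

/-- Convergence of the characteristic functions of the normalized discrepancies. -/
theorem tendsto_charFun_disc {r : ℕ} (hr : 1 ≤ r) {t : ℕ → ℕ}
    (ht : ∀ m, (t m : ℝ) ≤ Real.logb 2 m / 10)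
    {g : ∀ m, (Fin m → ZMod 2) →+ Dig (r + 1) m} (hg : ∀ m, IsDigNet (t m) (g m)) (θ : ℝ) :
    Tendsto (fun m => charFun ((shiftMeasure (r + 1) m).map fun p => disc (g m) p.1 p.2 /
        √(∫ p, disc (g m) p.1 p.2 ^ 2 ∂shiftMeasure (r + 1) m)) θ) atTop
      (nhds (charFun (ProbabilityTheory.gaussianReal 0 1) θ)) := by
  have hlim : charFun (ProbabilityTheory.gaussianReal 0 1) θ = (Real.exp (-θ ^ 2 / 2) : ℝ) := by
    rw [ProbabilityTheory.charFun_gaussianReal]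
    push_cast
    congr 1
    simp
    ring
  have hrate := tendsto_rate ht r
  have hsmall := hrate.const_mul ((8 * ((r : ℝ) + 1) ^ 2 + 4) / varConst r)
  have hcount := hrate.const_mul ((countConst r : ℝ) / varConst r ^ 2)
  have hbound := (((hsmall.sqrt).const_mul 2).const_mul |θ|).add
    ((hcount.const_mul (2 * θ ^ 4)).add ((hcount.sqrt.add hcount.sqrt).const_mul (θ ^ 2 / 2)))
  simp only [mul_zero, Real.sqrt_zero, add_zero] at hbound hsmall
  rw [tendsto_iff_norm_sub_tendsto_zero]
  refine squeeze_zero' (Eventually.of_forall fun _ => norm_nonneg _) ?_ hbound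
  filter_upwards [eventually_ge_atTop (2 * r + 1), hsmall.eventually_lt_const one_pos] with m hm hs
  have hmeas := (measurable_disc_prod (g m)).div_const
    √(∫ p, disc (g m) p.1 p.2 ^ 2 ∂shiftMeasure (r + 1) m)
  rw [hlim, charFun_apply_real, integral_map hmeas.aemeasurable (by fun_prop)]
  simp only [← Complex.ofReal_mul]
  exact norm_integral_cexp_disc_sub_le (hg m) hr hm hs θ

theorem gaussianReal_real_Iio (w : ℝ) :
    (ProbabilityTheory.gaussianReal 0 1).real (Set.Iio w) = PhiCDF w := by
  rw [measureReal_def, ProbabilityTheory.gaussianReal_apply_eq_integral 0 one_ne_zero,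
    ENNReal.toReal_ofReal (integral_nonneg fun _ => ProbabilityTheory.gaussianPDFReal_nonneg _ _ _)]
  simp [ProbabilityTheory.gaussianPDFReal, PhiCDF, integral_const_mul]

theorem tendsto_real_Iio_of_tendsto_charFun {μ : ℕ → Measure ℝ}
    (hμ : ∀ m, IsProbabilityMeasure (μ m))
    (h : ∀ θ, Tendsto (fun m => charFun (μ m) θ) atTop
      (nhds (charFun (ProbabilityTheory.gaussianReal 0 1) θ))) (w : ℝ) :
    Tendsto (fun m => (μ m).real (Set.Iio w)) atTop (nhds (PhiCDF w)) := by
  let law : ℕ → ProbabilityMeasure ℝ := fun m => ⟨μ m, hμ m⟩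
  let gauss : ProbabilityMeasure ℝ := ⟨ProbabilityTheory.gaussianReal 0 1, inferInstance⟩
  have hlaw : Tendsto law atTop (nhds gauss) :=
    ProbabilityMeasure.tendsto_iff_tendsto_charFun.2 h
  have hnull : (gauss : Measure ℝ) (frontier (Set.Iio w)) = 0 := by
    have := ProbabilityTheory.nullSingletonClass_gaussianReal (μ := 0) (v := 1) one_ne_zero
    rw [frontier_Iio]
    exact measure_singleton (μ := ProbabilityTheory.gaussianReal 0 1) w
  rw [← gaussianReal_real_Iio]
  exact (ENNReal.tendsto_toReal (measure_ne_top _ _)).comp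
    (ProbabilityMeasure.tendsto_measure_of_null_frontier_of_tendsto' hlaw hnull)

/-- Convergence of the distribution functions of the normalized discrepancies. -/
theorem tendsto_distribution_disc {r : ℕ} (hr : 1 ≤ r) {t : ℕ → ℕ}
    (ht : ∀ m, (t m : ℝ) ≤ Real.logb 2 m / 10)
    {g : ∀ m, (Fin m → ZMod 2) →+ Dig (r + 1) m} (hg : ∀ m, IsDigNet (t m) (g m)) (w : ℝ) :
    Tendsto (fun m => ((shiftMeasure (r + 1) m).map fun p => disc (g m) p.1 p.2 /
        √(∫ p, disc (g m) p.1 p.2 ^ 2 ∂shiftMeasure (r + 1) m)).real (Set.Iio w)) atTop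
      (nhds (PhiCDF w)) :=
  tendsto_real_Iio_of_tendsto_charFun
    (fun m => Measure.isProbabilityMeasure_map
      ((measurable_disc_prod (g m)).div_const _).aemeasurable)
    (tendsto_charFun_disc hr ht hg) w

end NetCLT

/-- Theorem 1: CLT for the normalized discrepancy of digital
`(t_m, m, s)`-nets with `t_m ≤ (1/10) log₂ m`. -/
theorem statement0 (s : ℕ) (hs : 2 ≤ s) (t : ℕ → ℕ)
    (C : (m : ℕ) → Fin s → Matrix (Fin m) (Fin m) (ZMod 2))
    (hnet : ∀ m, IsNet (t m) m s fun n : Fin (2 ^ m) => netPoint m s (C m) (n : ℕ))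
    (ht : ∀ m, (t m : ℝ) ≤ Real.logb 2 m / 10) (w : ℝ) :
    Tendsto (fun m : ℕ =>
        (2 : ℝ) ^ (-(s * m : ℤ)) * ∑ T : Fin s → Fin (2 ^ m),
          (volume {Y : Fin s → ℝ | (∀ i, Y i ∈ Set.Ico (0 : ℝ) 1) ∧
              Dloc (fun n : Fin (2 ^ m) => xorVec (netPoint m s (C m) (n : ℕ)) (Qpt m T)) Y /
                  Msp s m 2 (fun n : Fin (2 ^ m) => netPoint m s (C m) (n : ℕ)) < w}).toReal)
      atTop (nhds (PhiCDF w)) := by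
  obtain ⟨r, rfl⟩ : ∃ r, s = r + 1 := ⟨s - 1, by omega⟩
  simp only [NetCLT.distribution_eq, NetCLT.Msp_two_eq]
  exact NetCLT.tendsto_distribution_disc (by omega) ht
    (fun m => NetCLT.isDigNet_netHom (NetCLT.le_of_le_logb_div (ht m)) (hnet m)) w
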